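/- For fixed σ with 1/2 < σ ≤ 1 one has ∫₁^T |G(σ+it)|² dt ≪ T. -/

import Mathlib

open Complex Real MeasureTheory Set Filter

noncomputable section

/-- The multiplicity of `ρ` as a zero of the Riemann zeta function
(the order of vanishing, i.e. the least `n` with `ζ⁽ⁿ⁾(ρ) ≠ 0`). -/
def zetaMult (ρ : ℂ) : ℕ := sInf {n : ℕ | iteratedDeriv n riemannZeta ρ ≠ 0}

/-- `ρ` is a nontrivial zero of the Riemann zeta function. -/
def IsNontrivialZero (ρ : ℂ) : Prop := riemannZeta ρ = 0 ∧ 0 < ρ.re ∧ ρ.re < 1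

/-- The defect in Stirling's approximation of `log ‖Γ(z + 1/4)‖`, up to a constant. -/
def stirlingDefect (z : ℂ) : ℝ :=
  Real.log ‖Complex.Gamma (z + 1 / 4)‖ - ((z - 1 / 4) * Complex.log z - z).re

lemma stirlingDefect_add_one_sub (z : ℂ) (hz : 0 ≤ z.re) (hz0 : z ≠ 0) :
    stirlingDefect (z + 1) - stirlingDefect z =
      (Complex.log (1 + z⁻¹ / 4) - (z + 3 / 4) * Complex.log (1 + z⁻¹) + 1).re := by
  have hinv : 0 ≤ (z⁻¹).re := by
    rw [Complex.inv_re]; exact div_nonneg hz (Complex.normSq_nonneg z)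
  have h14 : z + 1 / 4 ≠ 0 := by
    intro h
    have := congrArg Complex.re h
    norm_num at this
    linarith
  have hG : Complex.Gamma (z + 1 / 4) ≠ 0 := by
    apply Complex.Gamma_ne_zero_of_re_pos
    norm_num; linarith
  have hre1 : 0 < (1 + z⁻¹).re := by simp only [Complex.add_re, Complex.one_re]; linarith
  have hre1' : 1 + z⁻¹ ≠ 0 := fun h => by rw [h] at hre1; simp at hre1
  have hre4' : 1 + z⁻¹ / 4 ≠ 0 := by
    intro h
    have := congrArg Complex.re h
    norm_num at this
    simp at this hinv
    linarith
  have e1 : Complex.log (z + 1) = Complex.log z + Complex.log (1 + z⁻¹) := by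
    rw [show z + 1 = z * (1 + z⁻¹) by field_simp]
    apply Complex.log_mul hz0 hre1'
    have h1 := abs_le.mp (Complex.abs_arg_le_pi_div_two_iff.mpr hz)
    have h2 := abs_lt.mp (Complex.abs_arg_lt_pi_div_two_iff.mpr (Or.inl hre1))
    constructor <;> linarith [h1.1, h1.2, h2.1, h2.2]
  have e2 : Real.log ‖z + 1 / 4‖ = (Complex.log z).re + (Complex.log (1 + z⁻¹ / 4)).re := by
    rw [show z + 1 / 4 = z * (1 + z⁻¹ / 4) by field_simp, norm_mul,
      Real.log_mul (norm_ne_zero_iff.mpr hz0) (norm_ne_zero_iff.mpr hre4'),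
      Complex.log_re, Complex.log_re]
  unfold stirlingDefect
  rw [show z + 1 + 1 / 4 = (z + 1 / 4) + 1 by ring, Complex.Gamma_add_one _ h14, norm_mul,
    Real.log_mul (norm_ne_zero_iff.mpr h14) (norm_ne_zero_iff.mpr hG), e2, e1]
  have : ((z + 1 - 1 / 4) * (Complex.log z + Complex.log (1 + z⁻¹)) - (z + 1)) =
      ((z - 1 / 4) * Complex.log z - z) + Complex.log z + ((z + 3 / 4) * Complex.log (1 + z⁻¹) - 1) := by
    ring
  rw [this]
  simp only [Complex.add_re, Complex.sub_re, Complex.one_re]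
  ring

lemma abs_stirlingDefect_add_one_sub_le (z : ℂ) (hz : 0 ≤ z.re) (hz2 : 2 ≤ ‖z‖) :
    |stirlingDefect (z + 1) - stirlingDefect z| ≤ 4 / ‖z‖ ^ 2 := by
  have hz0 : z ≠ 0 := norm_pos_iff.mp (by linarith)
  rw [stirlingDefect_add_one_sub z hz hz0]
  refine (Complex.abs_re_le_norm _).trans ?_
  set u := z⁻¹ with hu
  have hzu : z * u = 1 := mul_inv_cancel₀ hz0
  have hun : ‖u‖ = ‖z‖⁻¹ := norm_inv z
  have hu2 : ‖u‖ ≤ 1 / 2 := by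
    rw [hun]; rw [inv_le_comm₀ (by linarith) (by norm_num)]; norm_num; exact hz2
  have hinv : (1 - ‖u‖)⁻¹ ≤ 2 := by
    rw [inv_le_comm₀ (by linarith) (by norm_num)]; linarith
  have h1 : ‖Complex.log (1 + u / 4) - u / 4‖ ≤ ‖u‖ ^ 2 := by
    have h4 : ‖u / 4‖ = ‖u‖ / 4 := by simp
    have := Complex.norm_log_one_add_sub_self_le (z := u / 4) (by rw [h4]; linarith)
    rw [h4] at this
    have hi : (1 - ‖u‖ / 4)⁻¹ ≤ 2 := by
      rw [inv_le_comm₀ (by linarith [norm_nonneg u]) (by norm_num)]; linarith [norm_nonneg u]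
    nlinarith [sq_nonneg ‖u‖, mul_le_mul_of_nonneg_left hi (sq_nonneg ‖u‖)]
  have h2 : ‖Complex.log (1 + u) - (u - u ^ 2 / 2)‖ ≤ ‖u‖ ^ 3 := by
    have := Complex.norm_log_sub_logTaylor_le 2 (z := u) (by linarith)
    have ht : Complex.logTaylor (2 + 1) u = u - u ^ 2 / 2 := by
      simp [Complex.logTaylor_succ, Complex.logTaylor_zero]; ring
    rw [ht] at this
    have h3 : 0 ≤ ‖u‖ ^ 3 := by positivity
    norm_num at this
    nlinarith [mul_le_mul_of_nonneg_left hinv h3]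
  have key : Complex.log (1 + u / 4) - (z + 3 / 4) * Complex.log (1 + u) + 1 =
      (Complex.log (1 + u / 4) - u / 4) - (z + 3 / 4) * (Complex.log (1 + u) - (u - u ^ 2 / 2))
        + (3 / 8) * u ^ 2 := by
    linear_combination (-1 + u / 2) * hzu
  rw [key]
  have hz34 : ‖z + 3 / 4‖ ≤ ‖z‖ + 3 / 4 := by
    refine (norm_add_le _ _).trans ?_
    norm_num
  have hzn : ‖z‖ * ‖u‖ = 1 := by rw [← norm_mul, hzu, norm_one]
  calc _ ≤ ‖Complex.log (1 + u / 4) - u / 4‖ +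
        ‖z + 3 / 4‖ * ‖Complex.log (1 + u) - (u - u ^ 2 / 2)‖ + 3 / 8 * ‖u‖ ^ 2 := by
        refine (norm_add_le _ _).trans (add_le_add ((norm_sub_le _ _).trans ?_) ?_)
        · rw [norm_mul]
        · rw [norm_mul, norm_pow]; norm_num
    _ ≤ ‖u‖ ^ 2 + (‖z‖ + 3 / 4) * ‖u‖ ^ 3 + 3 / 8 * ‖u‖ ^ 2 := by gcongr
    _ = ‖u‖ ^ 2 * (1 + 3 / 4 * ‖u‖ + 3 / 8 + 1) := by linear_combination ‖u‖ ^ 2 * hzn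
    _ ≤ ‖u‖ ^ 2 * 4 := by gcongr; linarith
    _ = 4 / ‖z‖ ^ 2 := by rw [hun]; field_simp

lemma abs_stirlingDefect_add_natCast_sub_le (z : ℂ) (hz : 0 ≤ z.re) (hz2 : 2 ≤ ‖z‖) (n : ℕ) :
    |stirlingDefect (z + n) - stirlingDefect z| ≤ 16 / ‖z‖ := by
  set r := ‖z‖ with hr
  have hsq (k : ℕ) : r ^ 2 + (k : ℝ) ^ 2 ≤ ‖z + k‖ ^ 2 := by
    rw [hr, ← Complex.normSq_eq_norm_sq, ← Complex.normSq_eq_norm_sq, Complex.normSq_apply,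
      Complex.normSq_apply]
    simp
    nlinarith [mul_nonneg hz (Nat.cast_nonneg (α := ℝ) k)]
  have main : |stirlingDefect (z + n) - stirlingDefect z| ≤
      8 * (1 / (r - 1) - 1 / (r + n - 1)) := by
    induction n with
    | zero => simp
    | succ n ih =>
      have hn : (0 : ℝ) ≤ n := Nat.cast_nonneg n
      have h2 : 2 ≤ ‖z + n‖ := by
        have := hsq n
        refine le_of_sq_le_sq ?_ (norm_nonneg _)
        nlinarith [sq_nonneg (n : ℝ)]
      have := abs_stirlingDefect_add_one_sub_le (z + n) (by simp; positivity) h2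
      have h3 : 4 / ‖z + n‖ ^ 2 ≤ 8 * (1 / (r + n - 1) - 1 / (r + n)) := by
        have h5 : 8 * (1 / (r + n - 1) - 1 / (r + n)) = 8 / ((r + n - 1) * (r + n)) := by
          have h6 : r + n - 1 ≠ 0 := by linarith
          have h7 : r + n ≠ 0 := by linarith
          field_simp
          ring
        rw [h5, div_le_div_iff₀ (by positivity) (mul_pos (by linarith) (by linarith))]
        nlinarith [hsq n, sq_nonneg (r - n)]
      push_cast
      rw [show z + ((n : ℂ) + 1) = z + n + 1 by ring, show r + ((n : ℝ) + 1) - 1 = r + n by ring]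
      calc _ ≤ |stirlingDefect (z + n + 1) - stirlingDefect (z + n)|
            + |stirlingDefect (z + n) - stirlingDefect z| := abs_sub_le _ _ _
        _ ≤ _ := by linarith
  refine main.trans ?_
  have hn : (0 : ℝ) ≤ n := Nat.cast_nonneg n
  have h1 : 0 ≤ 1 / (r + n - 1) := by apply div_nonneg <;> linarith
  have h2 : 1 / (r - 1) ≤ 2 / r := by
    rw [div_le_div_iff₀ (by linarith) (by linarith)]; linarith
  calc _ ≤ 8 * (2 / r) := by linarith
    _ = _ := by ring

lemma tendsto_log_norm_Gamma_add_sub (w : ℂ) (hw : 0 < w.re) :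
    Tendsto (fun n : ℕ => Real.log ‖Complex.Gamma (w + (n + 1))‖ - w.re * Real.log n
      - Real.log (n.factorial)) atTop (nhds 0) := by
  have hne (n : ℕ) : w + n ≠ 0 := by
    intro h
    have := congrArg Complex.re h
    simp at this
    linarith [Nat.cast_nonneg (α := ℝ) n]
  have hG0 := Complex.Gamma_ne_zero_of_re_pos hw
  have hprod (n : ℕ) : Complex.Gamma (w + (n + 1)) =
      Complex.Gamma w * ∏ j ∈ Finset.range (n + 1), (w + j) := by
    induction n with
    | zero => simp [Complex.Gamma_add_one _ (by simpa using hne 0), mul_comm]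
    | succ n ih =>
      rw [Finset.prod_range_succ, ← mul_assoc, ← ih]
      push_cast
      rw [← add_assoc w, Complex.Gamma_add_one _ (by simpa using hne (n + 1)), mul_comm]
  have h1 : Tendsto (fun n : ℕ => Real.log ‖Complex.GammaSeq w n‖) atTop
      (nhds (Real.log ‖Complex.Gamma w‖)) :=
    ((Complex.GammaSeq_tendsto_Gamma w).norm).log (norm_ne_zero_iff.mpr hG0)
  have h2 := (h1.const_sub (Real.log ‖Complex.Gamma w‖))
  rw [sub_self] at h2
  refine h2.congr' ?_
  filter_upwards [eventually_gt_atTop 0] with n hn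
  have hp : ∏ j ∈ Finset.range (n + 1), (w + j) ≠ 0 := Finset.prod_ne_zero_iff.mpr fun j _ => hne j
  have hn' : (0 : ℝ) < n := by exact_mod_cast hn
  rw [hprod, Complex.GammaSeq, norm_mul, norm_div, norm_mul,
    Complex.norm_natCast_cpow_of_pos hn, Real.log_mul (by simpa using hG0) (norm_ne_zero_iff.mpr hp),
    Real.log_div (mul_ne_zero (by positivity) (by simpa using n.factorial_ne_zero))
      (norm_ne_zero_iff.mpr hp),
    Real.log_mul (by positivity) (by simpa using n.factorial_ne_zero), Real.log_rpow hn']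
  simp
  ring

lemma tendsto_stirlingDefect_add_sub (z : ℂ) (hz : 0 ≤ z.re) :
    Tendsto (fun n : ℕ => stirlingDefect (z + (n + 1)) - stirlingDefect (n + 1))
      atTop (nhds 0) := by
  have h1 := tendsto_log_norm_Gamma_add_sub (z + 1 / 4) (by norm_num; linarith)
  have h2 := tendsto_log_norm_Gamma_add_sub (1 / 4) (by norm_num)
  have h3 : Tendsto (fun n : ℕ => z.re * (Real.log ((n : ℝ) + 1) - Real.log n)) atTop (nhds 0) := by
    simpa using Real.tendsto_log_nat_add_one_sub_log.const_mul z.re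
  have hzero : Tendsto (fun n : ℕ => z / ((n : ℂ) + 1)) atTop (nhds 0) := by
    have := tendsto_one_div_add_atTop_nhds_zero_nat (𝕜 := ℂ)
    simpa [div_eq_mul_inv] using this.const_mul z
  have h4 : Tendsto (fun n : ℕ => ((n : ℂ) + 1) * Complex.log (1 + z / ((n : ℂ) + 1))) atTop
      (nhds z) := by
    have := Complex.tendsto_nat_mul_log_one_add_of_tendsto (g := fun n : ℕ => z / n) (t := z) ?_
    · simpa [Function.comp_def] using this.comp (tendsto_add_atTop_nat 1)
    · refine tendsto_const_nhds.congr' ?_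
      filter_upwards [eventually_gt_atTop 0] with n hn
      have : (n : ℂ) ≠ 0 := by exact_mod_cast hn.ne'
      field_simp
  have h5 : Tendsto (fun n : ℕ => Complex.log (1 + z / ((n : ℂ) + 1))) atTop (nhds 0) := by
    have := (hzero.const_add 1)
    rw [add_zero] at this
    simpa using this.clog (by simp)
  have h6 : Tendsto (fun n : ℕ => (((n : ℂ) + 1) * Complex.log (1 + z / ((n : ℂ) + 1)) - z
      + (z - 1 / 4) * Complex.log (1 + z / ((n : ℂ) + 1))).re) atTop (nhds 0) := by
    have := (h4.sub_const z).add (h5.const_mul (z - 1 / 4))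
    simp only [sub_self, mul_zero, add_zero] at this
    rw [← Complex.zero_re]
    exact (Complex.continuous_re.tendsto _).comp this
  have hsum := ((h1.sub h2).sub h3).sub h6
  simp only [sub_zero] at hsum
  refine hsum.congr fun n => ?_
  have hn1 : (0 : ℝ) < (n : ℝ) + 1 := by positivity
  have hne : (n : ℂ) + 1 ≠ 0 := by exact_mod_cast Nat.succ_ne_zero n
  have hx : 1 + z / ((n : ℂ) + 1) ≠ 0 := by
    intro h
    have h' := congrArg Complex.re (show z + ((n : ℂ) + 1) = 0 by
      field_simp at h; linear_combination h)
    simp at h'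
    linarith
  have e1 : Complex.log (z + (n + 1)) = Real.log ((n : ℝ) + 1)
      + Complex.log (1 + z / ((n : ℂ) + 1)) := by
    rw [← Complex.log_ofReal_mul hn1 hx]
    congr 1
    push_cast
    field_simp
    ring
  have e2 : Complex.log ((n : ℂ) + 1) = Real.log ((n : ℝ) + 1) := by
    rw [Complex.ofReal_log hn1.le]; push_cast; rfl
  unfold stirlingDefect
  rw [e1, e2]
  have e3 : ((z + (↑n + 1) - 1 / 4) * (↑(Real.log (↑n + 1)) + Complex.log (1 + z / (↑n + 1)))
      - (z + (↑n + 1))) = (((n : ℂ) + 1 - 1 / 4) * ↑(Real.log (↑n + 1)) - (↑n + 1))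
      + ((Real.log ((n : ℝ) + 1) : ℝ) : ℂ) * z
      + (((n : ℂ) + 1) * Complex.log (1 + z / ((n : ℂ) + 1)) - z
      + (z - 1 / 4) * Complex.log (1 + z / ((n : ℂ) + 1))) := by
    ring
  have e5 (a b c : ℂ) (x : ℝ) : (a + (x : ℂ) * b + c).re = a.re + x * b.re + c.re := by simp
  rw [e3, e5,
    show z + ((n : ℂ) + 1) + 1 / 4 = z + 1 / 4 + (n + 1) by ring,
    show (n : ℂ) + 1 + 1 / 4 = 1 / 4 + (n + 1) by ring]
  have e4 : (z + 1 / 4).re = z.re + (1 / 4 : ℂ).re := Complex.add_re _ _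
  rw [e4]
  ring

/-- Stirling's formula for `log ‖Γ(z + 1/4)‖`, uniformly in the right half plane. -/
theorem exists_abs_stirlingDefect_sub_le :
    ∃ c : ℝ, ∀ z : ℂ, 0 ≤ z.re → 2 ≤ ‖z‖ → |stirlingDefect z - c| ≤ 16 / ‖z‖ := by
  have hc : CauchySeq (fun n : ℕ => stirlingDefect n) := by
    refine Metric.cauchySeq_iff'.mpr fun ε hε => ?_
    obtain ⟨N, hN⟩ := exists_nat_gt (max 2 (16 / ε))
    refine ⟨N, fun n hn => ?_⟩
    obtain ⟨k, rfl⟩ := Nat.exists_eq_add_of_le hn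
    have hN2 : (2 : ℝ) < N := (le_max_left _ _).trans_lt hN
    have := abs_stirlingDefect_add_natCast_sub_le (N : ℂ) (by simp)
      (by simpa using hN2.le) k
    rw [Real.dist_eq]
    push_cast
    refine this.trans_lt ?_
    rw [Complex.norm_natCast, div_lt_comm₀ (by linarith) hε]
    exact (le_max_right _ _).trans_lt hN
  obtain ⟨c, hc⟩ := cauchySeq_tendsto_of_complete hc
  refine ⟨c, fun z hz hz2 => ?_⟩
  have h1 : Tendsto (fun n : ℕ => stirlingDefect (z + ((n + 1 : ℕ) : ℂ))) atTop (nhds c) := by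
    have := (tendsto_stirlingDefect_add_sub z hz).add (hc.comp (tendsto_add_atTop_nat 1))
    simpa using this
  have h2 := (h1.sub_const (stirlingDefect z)).abs
  rw [abs_sub_comm]
  exact le_of_tendsto h2 (Eventually.of_forall fun n =>
    abs_stirlingDefect_add_natCast_sub_le z hz hz2 (n + 1))

lemma integrableOn_Ioi_mul_cpow {f : ℝ → ℂ} {X C ε : ℝ} (hX : 0 < X) (hf : Measurable f)
    (hb : ∀ x > X, ‖f x‖ ≤ C * x ^ ε) {s : ℂ} (hs : ε < s.re) :
    IntegrableOn (fun x : ℝ => f x * (x : ℂ) ^ (-s - 1)) (Ioi X) := by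
  have hmeas : Measurable (fun x : ℝ => f x * (x : ℂ) ^ (-s - 1)) := by fun_prop
  refine Integrable.mono' ((integrableOn_Ioi_rpow_of_lt (a := ε - s.re - 1) (by linarith) hX).const_mul C)
    hmeas.aestronglyMeasurable ?_
  refine (ae_restrict_mem measurableSet_Ioi).mono fun x hx => ?_
  have hx0 : 0 < x := hX.trans hx
  rw [norm_mul, Complex.norm_cpow_eq_rpow_re_of_pos hx0]
  have : C * x ^ (ε - s.re - 1) = C * x ^ ε * x ^ (-s - 1).re := by
    rw [mul_assoc, ← Real.rpow_add hx0]
    congr 2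
    simp
    ring
  rw [this]
  gcongr
  exact hb x hx

lemma differentiableAt_integral_Ioi_mul_cpow {f : ℝ → ℂ} {X C ε : ℝ} (hX : 0 < X)
    (hf : Measurable f) (hb : ∀ x > X, ‖f x‖ ≤ C * x ^ ε) {s : ℂ} (hs : ε < s.re) :
    DifferentiableAt ℂ (fun s : ℂ => ∫ x in Ioi X, f x * (x : ℂ) ^ (-s - 1)) s := by
  set g : ℝ → ℂ := (Ioi X).indicator f with hg
  have hgm : Measurable g := hf.indicator measurableSet_Ioi
  have hgb (x : ℝ) (hx : 0 < x) : ‖g x‖ ≤ |C| * x ^ ε := by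
    by_cases h : x ∈ Ioi X
    · rw [hg, indicator_of_mem h]
      refine (hb x h).trans ?_
      gcongr
      exact le_abs_self C
    · rw [hg, indicator_of_notMem h]; simp; positivity
  have heq : (fun s : ℂ => ∫ x in Ioi X, f x * (x : ℂ) ^ (-s - 1)) = fun s => mellin g (-s) := by
    funext s
    have h1 : ∀ x : ℝ, (x : ℂ) ^ (-s - 1) • g x =
        (Ioi X).indicator (fun x : ℝ => f x * (x : ℂ) ^ (-s - 1)) x := by
      intro x
      by_cases h : x ∈ Ioi X
      · simp only [hg, indicator_of_mem h, smul_eq_mul, mul_comm]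
      · simp only [hg, indicator_of_notMem h, smul_zero]
    simp only [mellin, h1]
    rw [setIntegral_indicator measurableSet_Ioi, Ioi_inter_Ioi, max_eq_right hX.le]
  rw [heq]
  have hloc : LocallyIntegrableOn g (Ioi 0) := by
    have hc : ContinuousOn (fun x : ℝ => |C| * x ^ ε) (Ioi 0) := fun x hx =>
      ((Real.continuousAt_rpow_const x ε (Or.inl (ne_of_gt hx))).const_mul _).continuousWithinAt
    refine (hc.locallyIntegrableOn measurableSet_Ioi).mono hgm.aestronglyMeasurable ?_
    refine Eventually.of_forall fun x => ?_
    rcases lt_or_ge 0 x with hx | hx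
    · rw [Real.norm_of_nonneg (by positivity)]
      exact hgb x hx
    · rw [hg, indicator_of_notMem (by simpa using hx.trans hX.le)]
      simp only [norm_zero]
      positivity
  have htop : g =O[atTop] (· ^ (-(-ε)) : ℝ → ℝ) := by
    refine Asymptotics.IsBigO.of_bound |C| ?_
    filter_upwards [eventually_gt_atTop 0] with x hx
    rw [neg_neg, Real.norm_of_nonneg (by positivity)]
    exact hgb x hx
  have hbot : g =O[nhdsWithin 0 (Ioi 0)] (· ^ (-((-s).re - 1)) : ℝ → ℝ) := by
    refine Asymptotics.IsBigO.of_bound 1 ?_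
    have : Iio X ∈ nhdsWithin (0 : ℝ) (Ioi 0) := mem_nhdsWithin_of_mem_nhds (Iio_mem_nhds hX)
    filter_upwards [this] with x hx
    rw [hg, indicator_of_notMem (by simpa using le_of_lt hx)]
    simp
  have := mellin_differentiableAt_of_isBigO_rpow (s := -s) hloc htop (by simpa using hs) hbot
    (by linarith)
  exact this.comp s (differentiable_neg s)

lemma norm_integral_Ioi_mul_cpow_le {f : ℝ → ℂ} {X C ε : ℝ} (hX : 0 < X)
    (hb : ∀ x > X, ‖f x‖ ≤ C * x ^ ε) {s : ℂ} (hs : ε < s.re) :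
    ‖∫ x in Ioi X, f x * (x : ℂ) ^ (-s - 1)‖ ≤ C * (X ^ (ε - s.re) / (s.re - ε)) := by
  have h := norm_integral_le_of_norm_le
    (f := fun x : ℝ => f x * (x : ℂ) ^ (-s - 1)) (μ := volume.restrict (Ioi X))
    ((integrableOn_Ioi_rpow_of_lt (a := ε - s.re - 1) (by linarith) hX).const_mul C) ?_
  · refine h.trans (le_of_eq ?_)
    rw [integral_const_mul, integral_Ioi_rpow_of_lt (by linarith) hX]
    congr 1
    rw [show ε - s.re - 1 + 1 = -(s.re - ε) by ring, neg_div_neg_eq, neg_sub]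
  · refine (ae_restrict_mem measurableSet_Ioi).mono fun x hx => ?_
    have hx0 : 0 < x := hX.trans hx
    rw [norm_mul, Complex.norm_cpow_eq_rpow_re_of_pos hx0]
    have : C * x ^ (ε - s.re - 1) = C * x ^ ε * x ^ (-s - 1).re := by
      rw [mul_assoc, ← Real.rpow_add hx0]
      congr 2
      simp
      ring
    rw [this]
    gcongr
    exact hb x hx

lemma riemannZeta_mul_sub_one_eq_of_one_lt {s : ℂ} (hs : 1 < s.re) :
    riemannZeta₁ s =
      s - s * (s - 1) * ∫ x in Ioi (1 : ℝ), ((Int.fract x : ℝ) : ℂ) * (x : ℂ) ^ (-s - 1) := by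
  have hs1 : s ≠ 1 := fun h => by rw [h] at hs; simp at hs
  have hs0 : s - 1 ≠ 0 := sub_ne_zero.mpr hs1
  have h1 : riemannZeta₁ s = (s - 1) * riemannZeta s := by
    rw [riemannZeta_eq_inv_sub_mul hs1]; field_simp
  have h2 := LSeries_eq_mul_integral (1 : ℕ → ℂ) zero_le_one hs (LSeriesSummable_one_iff.mpr hs) (by
    refine Asymptotics.IsBigO.of_bound 1 (Eventually.of_forall fun n => ?_)
    simp)
  rw [LSeries_one_eq_riemannZeta hs] at h2
  have hfr : ∀ x > (1 : ℝ), ‖((Int.fract x : ℝ) : ℂ)‖ ≤ 1 * x ^ (0 : ℝ) := by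
    intro x _
    simp [abs_of_nonneg (Int.fract_nonneg x), (Int.fract_lt_one x).le]
  have hi1 := integrableOn_Ioi_mul_cpow (f := fun x => ((Int.fract x : ℝ) : ℂ)) one_pos
    (by fun_prop) hfr (show (0 : ℝ) < s.re by linarith)
  have hi2 := integrableOn_Ioi_cpow_of_lt (a := -s) (by simpa using hs) (c := 1) one_pos
  have h3 : ∫ (t : ℝ) in Ioi 1, (∑ k ∈ Finset.Icc 1 ⌊t⌋₊, (1 : ℕ → ℂ) k) * (t : ℂ) ^ (-(s + 1)) =
      (∫ (t : ℝ) in Ioi 1, (t : ℂ) ^ (-s)) -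
        ∫ x in Ioi (1 : ℝ), ((Int.fract x : ℝ) : ℂ) * (x : ℂ) ^ (-s - 1) := by
    rw [← integral_sub hi2 hi1]
    refine setIntegral_congr_fun measurableSet_Ioi fun x hx => ?_
    have hx1 : (1 : ℝ) < x := hx
    have hx0 : (x : ℂ) ≠ 0 := by exact_mod_cast (by linarith : x ≠ 0)
    have hfl : ((⌊x⌋₊ : ℕ) : ℂ) = x - ((Int.fract x : ℝ) : ℂ) := by
      rw [← Complex.ofReal_sub, Int.self_sub_fract, ← Complex.ofReal_natCast,
        natCast_floor_eq_intCast_floor (by linarith)]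
    simp only [Pi.one_apply, Finset.sum_const, Nat.card_Icc, nsmul_eq_mul, mul_one,
      Nat.add_sub_cancel, hfl]
    rw [show -(s + 1) = -s - 1 by ring, sub_mul]
    congr 1
    rw [Complex.cpow_sub _ _ hx0, Complex.cpow_one]
    field_simp
  rw [h1, h2, h3, integral_Ioi_cpow_of_lt (by simpa using hs) one_pos]
  have h4 : -s + 1 ≠ 0 := by rw [show -s + 1 = -(s - 1) by ring]; exact neg_ne_zero.mpr hs0
  simp only [Complex.ofReal_one, Complex.one_cpow]
  field_simp
  ring

lemma riemannZeta_mul_sub_one_eq {s : ℂ} (hs : 0 < s.re) :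
    riemannZeta₁ s =
      s - s * (s - 1) * ∫ x in Ioi (1 : ℝ), ((Int.fract x : ℝ) : ℂ) * (x : ℂ) ^ (-s - 1) := by
  have hopen : IsOpen {s : ℂ | 0 < s.re} := isOpen_lt continuous_const Complex.continuous_re
  have hfr : ∀ x > (1 : ℝ), ‖((Int.fract x : ℝ) : ℂ)‖ ≤ 1 * x ^ (0 : ℝ) := by
    intro x _
    simp [abs_of_nonneg (Int.fract_nonneg x), (Int.fract_lt_one x).le]
  have hd : DifferentiableOn ℂ (fun s : ℂ => s - s * (s - 1) *
      ∫ x in Ioi (1 : ℝ), ((Int.fract x : ℝ) : ℂ) * (x : ℂ) ^ (-s - 1)) {s : ℂ | 0 < s.re} := by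
    intro s hs
    have := differentiableAt_integral_Ioi_mul_cpow (f := fun x => ((Int.fract x : ℝ) : ℂ)) one_pos
      (by fun_prop) hfr (s := s) hs
    exact (DifferentiableAt.sub (by fun_prop)
      (DifferentiableAt.mul (by fun_prop) this)).differentiableWithinAt
  refine AnalyticOnNhd.eqOn_of_preconnected_of_eventuallyEq
    (differentiable_riemannZeta₁.differentiableOn.analyticOnNhd hopen) (hd.analyticOnNhd hopen)
    (convex_halfSpace_re_gt 0).isPreconnected (z₀ := 2) (by simp) ?_ hs
  have : {s : ℂ | 1 < s.re} ∈ nhds (2 : ℂ) :=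
    (isOpen_lt continuous_const Complex.continuous_re).mem_nhds (by simp)
  filter_upwards [this] with s hs
  exact riemannZeta_mul_sub_one_eq_of_one_lt hs

/-- A linear bound for `ζ` away from the pole and to the right of `Re s = 1/4`. -/
lemma norm_riemannZeta_le {s : ℂ} (hs : 1 / 4 ≤ s.re) (him : 1 ≤ |s.im|) :
    ‖riemannZeta s‖ ≤ 5 * ‖s‖ := by
  have hs0 : (0 : ℝ) < s.re := by linarith
  have hs1 : 1 ≤ ‖s - 1‖ := by
    refine him.trans ?_
    simpa using Complex.abs_im_le_norm (s - 1)
  have hne : s ≠ 1 := fun h => by rw [h] at hs1; norm_num at hs1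
  have hne' : s - 1 ≠ 0 := sub_ne_zero.mpr hne
  have hfr : ∀ x > (1 : ℝ), ‖((Int.fract x : ℝ) : ℂ)‖ ≤ 1 * x ^ (0 : ℝ) := by
    intro x _
    simp [abs_of_nonneg (Int.fract_nonneg x), (Int.fract_lt_one x).le]
  have hb := norm_integral_Ioi_mul_cpow_le (f := fun x => ((Int.fract x : ℝ) : ℂ)) one_pos hfr
    (s := s) hs0
  simp only [Real.one_rpow, sub_zero, one_mul] at hb
  have hb4 : 1 / s.re ≤ 4 := by rw [div_le_iff₀ hs0]; linarith
  rw [riemannZeta_eq_inv_sub_mul hne, riemannZeta_mul_sub_one_eq hs0]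
  set K := ∫ x in Ioi (1 : ℝ), ((Int.fract x : ℝ) : ℂ) * (x : ℂ) ^ (-s - 1)
  have : (s - 1)⁻¹ * (s - s * (s - 1) * K) = s * ((s - 1)⁻¹ - K) := by field_simp
  rw [this, norm_mul, mul_comm]
  gcongr
  calc _ ≤ ‖(s - 1)⁻¹‖ + ‖K‖ := norm_sub_le _ _
    _ ≤ 1 + 4 := by
      gcongr
      · rw [norm_inv]; exact inv_le_one_of_one_le₀ hs1
      · exact hb.trans hb4
    _ = 5 := by norm_num

lemma norm_riemannZeta_sub_one_le {s : ℂ} (hs : 2 ≤ s.re) :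
    ‖riemannZeta s - 1‖ ≤ 0.65 * (4 * (2 : ℝ) ^ (-s.re)) := by
  have hsum2 : HasSum (fun n : ℕ => 1 / ((n : ℝ) + 2) ^ 2) (π ^ 2 / 6 - 1) := by
    have := (hasSum_nat_add_iff' 2).mpr hasSum_zeta_two
    simpa [Finset.sum_range_succ] using this
  have hle (n : ℕ) : ‖1 / ((n : ℂ) + 2) ^ s‖ ≤ (4 * (2 : ℝ) ^ (-s.re)) * (1 / ((n : ℝ) + 2) ^ 2) := by
    have hpos : (0 : ℝ) < (n : ℝ) + 2 := by positivity
    have h1 : ‖((n : ℂ) + 2) ^ s‖ = ((n : ℝ) + 2) ^ s.re := by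
      rw [show ((n : ℂ) + 2) = (((n : ℝ) + 2 : ℝ) : ℂ) by push_cast; rfl,
        Complex.norm_cpow_eq_rpow_re_of_pos hpos]
    rw [norm_div, h1, norm_one]
    have h2 : ((n : ℝ) + 2) ^ s.re = ((n : ℝ) + 2) ^ 2 * ((n : ℝ) + 2) ^ (s.re - 2) := by
      rw [← Real.rpow_natCast ((n : ℝ) + 2) 2, ← Real.rpow_add hpos]; congr 1; push_cast; ring
    have h3 : (2 : ℝ) ^ (s.re - 2) ≤ ((n : ℝ) + 2) ^ (s.re - 2) :=
      Real.rpow_le_rpow (by norm_num) (by linarith [Nat.cast_nonneg (α := ℝ) n]) (by linarith)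
    have h4 : 4 * (2 : ℝ) ^ (-s.re) = 1 / (2 : ℝ) ^ (s.re - 2) := by
      rw [Real.rpow_sub (by norm_num), Real.rpow_neg (by norm_num)]
      norm_num
      ring
    rw [h2, h4, ← one_div_mul_one_div, mul_comm]
    gcongr
  have hz : riemannZeta s - 1 = ∑' n : ℕ, 1 / ((n : ℂ) + 2) ^ s := by
    have hs1 : 1 < s.re := by linarith
    have hsm : Summable (fun n : ℕ => 1 / ((n : ℂ) + 1) ^ s) := by
      have := (summable_nat_add_iff 1).mpr (Complex.summable_one_div_nat_cpow.mpr hs1)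
      simpa using this
    rw [zeta_eq_tsum_one_div_nat_add_one_cpow hs1, hsm.tsum_eq_zero_add]
    simp only [Nat.cast_zero, zero_add, Complex.one_cpow, Nat.cast_add, Nat.cast_one]
    norm_num [add_assoc]
  rw [hz]
  refine (tsum_of_norm_bounded (hsum2.mul_left _) hle).trans ?_
  rw [mul_comm]
  gcongr
  have := Real.pi_lt_d4
  nlinarith [Real.pi_pos]

/-- `log ‖ζ(s)‖` decays exponentially as `Re s → ∞`. -/
lemma abs_log_norm_riemannZeta_le {s : ℂ} (hs : 2 ≤ s.re) :
    |Real.log ‖riemannZeta s‖| ≤ 8 * (2 : ℝ) ^ (-s.re) := by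
  have h := norm_riemannZeta_sub_one_le hs
  set y := 0.65 * (4 * (2 : ℝ) ^ (-s.re)) with hy
  have hy0 : 0 < y := by positivity
  have h2 : (2 : ℝ) ^ (-s.re) ≤ 1 / 4 := by
    have : (2 : ℝ) ^ (-s.re) ≤ (2 : ℝ) ^ (-2 : ℝ) :=
      Real.rpow_le_rpow_of_exponent_le (by norm_num) (by linarith)
    refine this.trans (le_of_eq ?_)
    rw [Real.rpow_neg (by norm_num)]
    norm_num
  have hy1 : y ≤ 0.65 := by rw [hy]; linarith
  have hup : ‖riemannZeta s‖ ≤ 1 + y := by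
    have := norm_add_le (riemannZeta s - 1) 1
    simp only [sub_add_cancel, norm_one] at this
    linarith
  have hlo : 1 - y ≤ ‖riemannZeta s‖ := by
    have := norm_sub_norm_le 1 (1 - riemannZeta s)
    simp only [sub_sub_cancel, norm_one] at this
    rw [norm_sub_rev] at this
    linarith
  have hpos : 0 < ‖riemannZeta s‖ := by linarith
  have h8 : 3 * y ≤ 8 * (2 : ℝ) ^ (-s.re) := by
    rw [hy]; linarith [Real.rpow_pos_of_pos (show (0 : ℝ) < 2 by norm_num) (-s.re)]
  refine le_trans (abs_le.mpr ⟨?_, ?_⟩) h8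
  · have h1 := Real.one_sub_inv_le_log_of_pos hpos
    have h3 : ‖riemannZeta s‖⁻¹ ≤ 1 + 3 * y := by
      rw [inv_le_comm₀ hpos (by linarith)]
      refine le_trans ?_ hlo
      rw [inv_le_comm₀ (by linarith) (by linarith), ← one_div, div_le_iff₀ (by linarith)]
      nlinarith
    linarith
  · have := Real.log_le_sub_one_of_pos hpos
    linarith

lemma lintegral_enorm_log_norm_circle_le {f : ℂ → ℂ} {c : ℂ} {ρ M : ℝ} (hρ : 0 < ρ) (hM : 0 ≤ M)
    (hf : AnalyticOnNhd ℂ f (Metric.closedBall c ρ)) (hc : f c ≠ 0)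
    (hb : ∀ z ∈ Metric.sphere c ρ, Real.log ‖f z‖ ≤ M) :
    ∫⁻ θ in Ioo (-π) π, ‖Real.log ‖f (circleMap c ρ θ)‖‖ₑ ≤
      ENNReal.ofReal (2 * π * (2 * M - Real.log ‖f c‖)) := by
  have habs : |ρ| = ρ := abs_of_pos hρ
  have h_int : CircleIntegrable (fun z => Real.log ‖f z‖) c ρ := by
    apply MeromorphicOn.circleIntegrable_log_norm
    rw [habs]
    exact fun z hz => (hf z (Metric.sphere_subset_closedBall hz)).meromorphicAt
  have havg := AnalyticOnNhd.circleAverage_log_norm hρ.ne' (by rwa [habs]) hc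
  have hge : Real.log ‖f c‖ ≤ Real.circleAverage (fun z => Real.log ‖f z‖) c ρ := by
    rw [havg, le_add_iff_nonneg_left]
    refine finsum_nonneg fun u => ?_
    rw [habs]
    by_cases hu : u ∈ Metric.closedBall c ρ
    · refine mul_nonneg ?_ ?_
      · exact_mod_cast MeromorphicOn.AnalyticOnNhd.divisor_nonneg hf u
      · by_cases h0 : ‖c - u‖ = 0
        · simp [h0]
        · apply Real.log_nonneg
          rw [← div_eq_mul_inv, one_le_div (by positivity), ← dist_eq_norm, dist_comm]
          exact hu
    · rw [Function.locallyFinsuppWithin.apply_eq_zero_of_notMem _ hu]; simp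
  have hpi : -π ≤ π := by linarith [Real.pi_pos]
  have h_int' : IntervalIntegrable (fun θ => Real.log ‖f (circleMap c ρ θ)‖) volume (-π) π := by
    have h := (periodic_circleMap c ρ).comp (fun z => Real.log ‖f z‖)
    have := h.intervalIntegrable (t := 0) (by positivity) (by rw [zero_add]; exact h_int) (-π) π
    exact this
  have hper : ∫ θ in (-π)..π, Real.log ‖f (circleMap c ρ θ)‖ =
      ∫ θ in (0)..(2 * π), Real.log ‖f (circleMap c ρ θ)‖ := by
    have h := (periodic_circleMap c ρ).comp (fun z => Real.log ‖f z‖)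
    have := h.intervalIntegral_add_eq (-π) 0
    simpa [show -π + 2 * π = π by ring] using this
  have hge' : 2 * π * Real.log ‖f c‖ ≤ ∫ θ in (-π)..π, Real.log ‖f (circleMap c ρ θ)‖ := by
    rw [hper]
    rw [Real.circleAverage_def, smul_eq_mul, inv_mul_eq_div, le_div_iff₀ (by positivity)] at hge
    linarith
  have hle : ∫ θ in (-π)..π, ‖Real.log ‖f (circleMap c ρ θ)‖‖ ≤
      ∫ θ in (-π)..π, (2 * M - Real.log ‖f (circleMap c ρ θ)‖) := by
    refine intervalIntegral.integral_mono hpi h_int'.norm (intervalIntegrable_const.sub h_int') fun θ => ?_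
    have := hb _ (circleMap_mem_sphere c hρ.le θ)
    simp only [Real.norm_eq_abs]
    rcases abs_cases (Real.log ‖f (circleMap c ρ θ)‖) with h | h <;> linarith [h.1]
  rw [intervalIntegral.integral_sub intervalIntegrable_const h_int',
    intervalIntegral.integral_const, smul_eq_mul] at hle
  have hio : IntegrableOn (fun θ => Real.log ‖f (circleMap c ρ θ)‖) (Ioo (-π) π) :=
    (intervalIntegrable_iff_integrableOn_Ioo_of_le hpi).mp h_int'
  rw [← ofReal_integral_norm_eq_lintegral_enorm hio]
  apply ENNReal.ofReal_le_ofReal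
  rw [← integral_Ioc_eq_integral_Ioo, ← intervalIntegral.integral_of_le hpi]
  linarith

lemma lintegral_enorm_log_norm_ball_le {f : ℂ → ℂ} {c : ℂ} {ρ M : ℝ} (hρ : 0 < ρ) (hM : 0 ≤ M)
    (hfm : Measurable f) (hf : AnalyticOnNhd ℂ f (Metric.closedBall c ρ)) (hc : f c ≠ 0)
    (hb : ∀ z ∈ Metric.closedBall c ρ, Real.log ‖f z‖ ≤ M) :
    ∫⁻ z in Metric.closedBall c ρ, ‖Real.log ‖f z‖‖ₑ ≤
      ENNReal.ofReal (ρ * ρ * (2 * π * (2 * M - Real.log ‖f c‖))) := by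
  set F : ℂ → ENNReal := fun z => ‖Real.log ‖f z‖‖ₑ with hF
  have hFm : Measurable F := by fun_prop
  have hball : MeasurableSet (Metric.closedBall c ρ) := Metric.isClosed_closedBall.measurableSet
  rw [← lintegral_indicator hball, ← lintegral_add_left_eq_self _ c,
    ← Complex.lintegral_comp_polarCoord_symm, polarCoord_target]
  have hm : Measurable fun p : ℝ × ℝ => ENNReal.ofReal p.1 •
      (Metric.closedBall c ρ).indicator F (c + Complex.polarCoord.symm p) := by
    have h1 : Measurable fun p : ℝ × ℝ => c + Complex.polarCoord.symm p := by
      simp only [Complex.polarCoord_symm_apply]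
      fun_prop
    exact (ENNReal.measurable_ofReal.comp measurable_fst).smul ((hFm.indicator hball).comp h1)
  rw [Measure.volume_eq_prod, ← Measure.prod_restrict, lintegral_prod _ hm.aemeasurable]
  have hin (r : ℝ) (hr : r ∈ Ioi (0 : ℝ)) : ∫⁻ θ in Ioo (-π) π, ENNReal.ofReal r •
      (Metric.closedBall c ρ).indicator F (c + Complex.polarCoord.symm (r, θ)) ≤
      (Ioc 0 ρ).indicator (fun _ => ENNReal.ofReal (ρ * (2 * π * (2 * M - Real.log ‖f c‖)))) r := by
    have hr0 : 0 < r := hr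
    have heq (θ : ℝ) : c + Complex.polarCoord.symm (r, θ) = circleMap c r θ := by
      simp only [Complex.polarCoord_symm_apply, circleMap, Complex.exp_mul_I, Complex.ofReal_cos,
        Complex.ofReal_sin]
    by_cases hrρ : r ≤ ρ
    · rw [indicator_of_mem (show r ∈ Ioc 0 ρ from ⟨hr0, hrρ⟩)]
      have hsub : Metric.closedBall c r ⊆ Metric.closedBall c ρ := Metric.closedBall_subset_closedBall hrρ
      have h1 := lintegral_enorm_log_norm_circle_le hr0 hM (hf.mono hsub) hc
        (fun z hz => hb z (hsub (Metric.sphere_subset_closedBall hz)))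
      rw [ENNReal.ofReal_mul hρ.le]
      simp only [smul_eq_mul]
      rw [lintegral_const_mul' _ _ ENNReal.ofReal_ne_top]
      gcongr
      refine (lintegral_mono fun θ => ?_).trans h1
      rw [heq]
      exact indicator_le_self _ _ _
    · rw [indicator_of_notMem (fun h => hrρ h.2)]
      simp only [heq]
      have : ∀ θ, (Metric.closedBall c ρ).indicator F (circleMap c r θ) = 0 := fun θ => by
        apply indicator_of_notMem
        simpa [circleMap, abs_of_pos hr0] using hrρ
      simp [this]
  refine (setLIntegral_mono' measurableSet_Ioi hin).trans ?_
  rw [setLIntegral_indicator measurableSet_Ioc, setLIntegral_const, mul_comm, mul_assoc ρ ρ,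
    ENNReal.ofReal_mul (q := ρ * (2 * π * (2 * M - Real.log ‖f c‖))) hρ.le]
  have hv : volume (Ioc 0 ρ ∩ Ioi 0) ≤ ENNReal.ofReal ρ :=
    (measure_mono inter_subset_left).trans (by simp)
  exact mul_le_mul_left hv _
lemma measurable_riemannZeta : Measurable riemannZeta :=
  measurable_of_continuousOn_compl_singleton 1 fun _ hs =>
    (differentiableAt_riemannZeta hs).continuousAt.continuousWithinAt

lemma lintegral_log_riemannZeta_ball_le {R t : ℝ} (hR : 4 ≤ R) (ht : |t| = R) :
    ∫⁻ z in Metric.closedBall (3 + t * I) (11 / 4), ‖Real.log ‖riemannZeta z‖‖ₑ ≤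
      ENNReal.ofReal (450 * Real.log R) := by
  have hmem (z : ℂ) (hz : z ∈ Metric.closedBall (3 + t * I : ℂ) (11 / 4)) :
      1 / 4 ≤ z.re ∧ 1 ≤ |z.im| ∧ ‖z‖ ≤ R + 9 := by
    rw [mem_closedBall_iff_norm] at hz
    have h1 := (Complex.abs_re_le_norm _).trans hz
    have h2 := (Complex.abs_im_le_norm _).trans hz
    simp at h1 h2
    have h3 : ‖z‖ ≤ ‖z - (3 + t * I)‖ + (‖(3 : ℂ)‖ + ‖t * I‖) := by
      refine le_trans ?_ (add_le_add_right (norm_add_le _ _) _)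
      simpa using norm_add_le (z - (3 + t * I)) (3 + t * I)
    have h4 : ‖(t : ℂ) * I‖ = R := by simp [ht]
    have h5 : ‖(3 : ℂ)‖ = 3 := by simp
    rw [h4, h5] at h3
    refine ⟨by linarith [(abs_le.mp h1).1], ?_, by linarith⟩
    have := abs_sub_abs_le_abs_sub t z.im
    rw [abs_sub_comm t] at this
    linarith
  have hre : ((3 : ℂ) + t * I).re = 3 := by simp
  have hlow := abs_log_norm_riemannZeta_le (s := 3 + t * I) (by rw [hre]; norm_num)
  rw [hre] at hlow
  have h8 : (2 : ℝ) ^ (-3 : ℝ) = 1 / 8 := by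
    rw [Real.rpow_neg (by norm_num)]; norm_num
  rw [h8] at hlow
  have hlogR : 1 ≤ Real.log R := by
    rw [Real.le_log_iff_exp_le (by linarith)]
    linarith [Real.exp_one_lt_d9]
  have hM : Real.log (5 * (R + 9)) ≤ 4 * Real.log R := by
    rw [show (4 : ℝ) * Real.log R = Real.log (R ^ 4) by simp [Real.log_pow]]
    apply Real.log_le_log (by linarith)
    nlinarith [pow_le_pow_left₀ (by norm_num) hR 3]
  refine (lintegral_enorm_log_norm_ball_le (M := 4 * Real.log R) (by norm_num) (by linarith)
    measurable_riemannZeta ?_ ?_ ?_).trans ?_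
  · have ho : IsOpen ({1}ᶜ : Set ℂ) := isOpen_compl_singleton
    refine AnalyticOnNhd.mono (DifferentiableOn.analyticOnNhd
      (fun s hs => (differentiableAt_riemannZeta hs).differentiableWithinAt) ho) fun z hz h => ?_
    have := (hmem z hz).2.1
    rw [mem_singleton_iff.mp h] at this
    norm_num at this
  · exact riemannZeta_ne_zero_of_one_le_re (by rw [hre]; norm_num)
  · intro z hz
    obtain ⟨h1, h2, h3⟩ := hmem z hz
    by_cases h0 : riemannZeta z = 0
    · rw [h0]; simp; linarith
    · refine le_trans ?_ hM
      apply Real.log_le_log (norm_pos_iff.mpr h0)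
      exact (norm_riemannZeta_le h1 h2).trans (by linarith)
  · apply ENNReal.ofReal_le_ofReal
    have := (abs_le.mp hlow).1
    have hpi := Real.pi_lt_d2
    have hpi0 := Real.pi_pos
    nlinarith

lemma integral_two_rpow_neg_mul_cos_le {r : ℝ} (hr : 0 < r) :
    ∫ θ in (-(π / 2))..(π / 2), 8 * (2 : ℝ) ^ (-(r * Real.cos θ)) ≤ 40 / r := by
  have hpi := Real.pi_pos
  set k := r * Real.log 2 with hk
  have hk0 : 0 < k := mul_pos hr (Real.log_pos (by norm_num))
  have hd (θ : ℝ) : HasDerivAt (fun θ => 4 * π / k * (Real.exp (k * (2 / π * θ - 1)) -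
      Real.exp (k * (2 / π * (-θ) - 1))))
      (8 * (Real.exp (k * (2 / π * θ - 1)) + Real.exp (k * (2 / π * (-θ) - 1)))) θ := by
    have h1 : HasDerivAt (fun θ : ℝ => k * (2 / π * θ - 1)) (k * (2 / π)) θ := by
      simpa using (((hasDerivAt_id θ).const_mul (2 / π)).sub_const 1).const_mul k
    have h2 : HasDerivAt (fun θ : ℝ => k * (2 / π * (-θ) - 1)) (k * (2 / π * -1)) θ := by
      simpa using (((hasDerivAt_id θ).neg.const_mul (2 / π)).sub_const 1).const_mul k
    refine ((h1.exp.sub h2.exp).const_mul (4 * π / k)).congr_deriv ?_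
    generalize Real.exp (k * (2 / π * θ - 1)) = a
    generalize Real.exp (k * (2 / π * (-θ) - 1)) = b
    field_simp
    ring
  have hle : ∫ θ in (-(π / 2))..(π / 2), 8 * (2 : ℝ) ^ (-(r * Real.cos θ)) ≤
      ∫ θ in (-(π / 2))..(π / 2),
        8 * (Real.exp (k * (2 / π * θ - 1)) + Real.exp (k * (2 / π * (-θ) - 1))) := by
    refine intervalIntegral.integral_mono_on (by linarith)
      (Continuous.intervalIntegrable (by fun_prop (disch := norm_num)) _ _)
      (Continuous.intervalIntegrable (by fun_prop) _ _) fun θ hθ => ?_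
    have hc := Real.one_sub_mul_le_cos (abs_nonneg θ) (abs_le.mpr hθ)
    rw [Real.cos_abs] at hc
    rw [Real.rpow_def_of_pos (by norm_num)]
    have h1 : Real.log 2 * -(r * Real.cos θ) ≤ k * (2 / π * |θ| - 1) := by
      rw [hk]
      have h2 : 0 < Real.log 2 * r := by rw [mul_comm]; exact hk0
      nlinarith
    have h3 := Real.exp_le_exp.mpr h1
    have h4 := Real.exp_pos (k * (2 / π * θ - 1))
    have h5 := Real.exp_pos (k * (2 / π * (-θ) - 1))
    rcases abs_cases θ with h | h <;> rw [h.1] at h3 <;> linarith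
  refine hle.trans ?_
  rw [intervalIntegral.integral_eq_sub_of_hasDerivAt (fun θ _ => hd θ)
    (Continuous.intervalIntegrable (by fun_prop) _ _)]
  have e1 : 2 / π * (π / 2) = 1 := by field_simp
  rw [neg_neg, mul_neg, e1, sub_self, mul_zero, Real.exp_zero]
  have h4 := Real.exp_pos (k * (-1 - 1))
  have h6 : 8 * π / k ≤ 40 / r := by
    rw [div_le_div_iff₀ hk0 hr, hk]
    have := Real.log_two_gt_d9
    have := Real.pi_lt_d2
    nlinarith
  have h7 : 0 < π / k := by positivity
  have h8 : 4 * π / k * (1 - Real.exp (k * (-1 - 1))) -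
      4 * π / k * (Real.exp (k * (-1 - 1)) - 1) = 8 * π / k - 8 * (π / k) * Real.exp (k * (-1 - 1)) := by
    ring
  rw [h8]
  have : 0 < 8 * (π / k) * Real.exp (k * (-1 - 1)) := by positivity
  linarith

lemma exists_radius_integral_log_riemannZeta_le {N : Set ℝ} (hN : volume N = 0) {R : ℝ}
    (hR : 4 ≤ R) : ∃ r ∈ Icc R (R + 1), r ∉ N ∧
      IntegrableOn (fun θ => Real.log ‖riemannZeta (1 / 2 + circleMap 0 r θ)‖)
        (Ioo (-(π / 2)) (π / 2)) ∧
      ∫ θ in Ioo (-(π / 2)) (π / 2), |Real.log ‖riemannZeta (1 / 2 + circleMap 0 r θ)‖| ≤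
        1000 * Real.log R / R := by
  have hpi := Real.pi_pos
  have hlogR : 1 ≤ Real.log R := by
    rw [Real.le_log_iff_exp_le (by linarith)]
    linarith [Real.exp_one_lt_d9]
  set F : ℂ → ENNReal := fun z => ‖Real.log ‖riemannZeta z‖‖ₑ with hF
  have hFm : Measurable F := by have := measurable_riemannZeta; fun_prop
  set B := fun t : ℝ => Metric.closedBall (3 + t * I : ℂ) (11 / 4) with hB
  set U := B R ∪ B (-R) with hU
  have hUm : MeasurableSet U :=
    Metric.isClosed_closedBall.measurableSet.union Metric.isClosed_closedBall.measurableSet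
  have hUint : ∫⁻ z in U, F z ≤ ENNReal.ofReal (900 * Real.log R) := by
    refine (lintegral_union_le _ _ _).trans ?_
    rw [show 900 * Real.log R = 450 * Real.log R + 450 * Real.log R by ring,
      ENNReal.ofReal_add (by linarith) (by linarith)]
    exact add_le_add
      (lintegral_log_riemannZeta_ball_le hR (abs_of_pos (by linarith)))
      (lintegral_log_riemannZeta_ball_le hR (by rw [abs_neg, abs_of_pos (by linarith)]))
  set g : ℝ → ℝ → ENNReal := fun r θ => ENNReal.ofReal r * U.indicator F (1 / 2 + circleMap 0 r θ)
    with hg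
  have hcm : Measurable fun p : ℝ × ℝ => (1 / 2 : ℂ) + circleMap 0 p.1 p.2 := by
    unfold circleMap; fun_prop
  have hgm : Measurable (Function.uncurry g) :=
    (ENNReal.measurable_ofReal.comp measurable_fst).mul ((hFm.indicator hUm).comp hcm)
  have harea : ∫⁻ r in Icc R (R + 1), ∫⁻ θ in Ioo (-(π / 2)) (π / 2), g r θ ≤
      ENNReal.ofReal (900 * Real.log R) := by
    refine le_trans ?_ hUint
    rw [← lintegral_indicator hUm (f := F), ← lintegral_add_left_eq_self (μ := volume) (U.indicator F) (1 / 2),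
      ← Complex.lintegral_comp_polarCoord_symm, polarCoord_target]
    have heq : ∀ p : ℝ × ℝ, ENNReal.ofReal p.1 • U.indicator F (1 / 2 + Complex.polarCoord.symm p) =
        Function.uncurry g p := by
      rintro ⟨r, θ⟩
      simp only [Complex.polarCoord_symm_apply, circleMap, Complex.exp_mul_I, Complex.ofReal_cos,
        Complex.ofReal_sin, smul_eq_mul, Function.uncurry, hg, zero_add]
    simp only [heq]
    rw [Measure.volume_eq_prod, ← Measure.prod_restrict, lintegral_prod _ hgm.aemeasurable]
    refine (lintegral_mono fun r => ?_).trans (lintegral_mono_set fun r hr => ?_)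
    · exact lintegral_mono_set (Ioo_subset_Ioo (by linarith) (by linarith))
    · exact lt_of_lt_of_le (by linarith) hr.1
  obtain ⟨r, hrN, hr⟩ := exists_notMem_null_le_laverage (μ := volume.restrict (Icc R (R + 1)))
    (f := fun r => ∫⁻ θ in Ioo (-(π / 2)) (π / 2), g r θ) (N := N ∪ (Icc R (R + 1))ᶜ) (by simp)
    (Measurable.lintegral_prod_right hgm).aemeasurable (by
      refine measure_union_null ?_ ?_
      · exact le_antisymm ((Measure.restrict_apply_le _ _).trans hN.le) bot_le
      · rw [Measure.restrict_apply measurableSet_Icc.compl]; simp)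
  rw [mem_union, not_or, notMem_compl_iff] at hrN
  rw [setLAverage_eq, Real.volume_Icc] at hr
  simp only [add_sub_cancel_left, ENNReal.ofReal_one, div_one] at hr
  replace hr := hr.trans harea
  have hr0 : 0 < r := by linarith [hrN.2.1]
  refine ⟨r, hrN.2, hrN.1, ?_⟩
  set h : ℝ → ℝ := fun θ => Real.log ‖riemannZeta (1 / 2 + circleMap 0 r θ)‖ with hh
  have hhm : Measurable h := by
    have := measurable_riemannZeta.comp (hcm.comp (measurable_prodMk_left (x := r)))
    exact Real.measurable_log.comp this.norm
  have hpt (θ : ℝ) (hθ : θ ∈ Ioo (-(π / 2)) (π / 2)) : ‖h θ‖ₑ ≤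
      U.indicator F (1 / 2 + circleMap 0 r θ) +
        ENNReal.ofReal (8 * (2 : ℝ) ^ (-(r * Real.cos θ))) := by
    have hcos := Real.cos_pos_of_mem_Ioo hθ
    have hre : (1 / 2 + circleMap 0 r θ).re = 1 / 2 + r * Real.cos θ := by
      simp [circleMap, Complex.exp_mul_I, Complex.cos_ofReal_re]
    have him : (1 / 2 + circleMap 0 r θ).im = r * Real.sin θ := by
      simp [circleMap, Complex.exp_mul_I, Complex.sin_ofReal_re]
    by_cases hc : 3 / 2 ≤ r * Real.cos θ
    · refine le_trans ?_ le_add_self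
      rw [← ofReal_norm, Real.norm_eq_abs]
      apply ENNReal.ofReal_le_ofReal
      refine (abs_log_norm_riemannZeta_le (by rw [hre]; linarith)).trans ?_
      rw [hre]
      gcongr
      · norm_num
      · linarith
    · refine le_trans ?_ le_self_add
      rw [indicator_of_mem]
      push Not at hc
      have hsq : (r * Real.sin θ) ^ 2 + (r * Real.cos θ) ^ 2 = r ^ 2 := by
        have := Real.sin_sq_add_cos_sq θ
        linear_combination r ^ 2 * this
      have hcp : 0 < r * Real.cos θ := by positivity
      have habs : |(|r * Real.sin θ| - R)| ≤ 1 := by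
        have h1 := hrN.2.1
        have h2 := hrN.2.2
        rw [← sq_abs (r * Real.sin θ)] at hsq
        have h3 := abs_nonneg (r * Real.sin θ)
        rw [abs_le]
        constructor <;> nlinarith
      have hnorm (t : ℝ) (ht : |r * Real.sin θ - t| ≤ 1) :
          1 / 2 + circleMap 0 r θ ∈ B t := by
        rw [hB, mem_closedBall_iff_norm, ← sq_le_sq₀ (norm_nonneg _) (by norm_num),
          ← Complex.normSq_eq_norm_sq, Complex.normSq_apply, Complex.sub_re, Complex.sub_im, hre, him]
        simp
        have := abs_le.mp ht
        nlinarith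
      rcases abs_cases (r * Real.sin θ) with h1 | h1
      · exact Or.inl (hnorm R (by rwa [h1.1] at habs))
      · refine Or.inr (hnorm (-R) ?_)
        rw [h1.1, ← abs_neg] at habs
        convert habs using 2
        ring
  have hexp : ∫⁻ θ in Ioo (-(π / 2)) (π / 2), ENNReal.ofReal (8 * (2 : ℝ) ^ (-(r * Real.cos θ))) ≤
      ENNReal.ofReal (40 / r) := by
    have hi : IntervalIntegrable (fun θ => 8 * (2 : ℝ) ^ (-(r * Real.cos θ))) volume
        (-(π / 2)) (π / 2) := Continuous.intervalIntegrable (by fun_prop (disch := norm_num)) _ _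
    rw [← ofReal_integral_eq_lintegral_ofReal
      ((intervalIntegrable_iff_integrableOn_Ioo_of_le (by linarith)).mp hi)
      (Eventually.of_forall fun θ => by positivity)]
    apply ENNReal.ofReal_le_ofReal
    rw [← integral_Ioc_eq_integral_Ioo, ← intervalIntegral.integral_of_le (by linarith)]
    exact integral_two_rpow_neg_mul_cos_le hr0
  have htot : ∫⁻ θ in Ioo (-(π / 2)) (π / 2), ‖h θ‖ₑ ≤ ENNReal.ofReal (1000 * Real.log R / R) := by
    refine (setLIntegral_mono' measurableSet_Ioo hpt).trans ?_
    have hm1 : Measurable fun θ => U.indicator F (1 / 2 + circleMap 0 r θ) :=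
      (hFm.indicator hUm).comp (hcm.comp (measurable_prodMk_left (x := r)))
    rw [lintegral_add_left hm1]
    have hr' : ∫⁻ θ in Ioo (-(π / 2)) (π / 2), U.indicator F (1 / 2 + circleMap 0 r θ) ≤
        ENNReal.ofReal (900 * Real.log R / r) := by
      rw [ENNReal.ofReal_div_of_pos hr0, ENNReal.le_div_iff_mul_le (by simp [hr0]) (by simp), mul_comm,
        ← lintegral_const_mul' _ _ ENNReal.ofReal_ne_top]
      exact hr
    refine (add_le_add hr' hexp).trans ?_
    rw [← ENNReal.ofReal_add (by positivity) (by positivity)]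
    apply ENNReal.ofReal_le_ofReal
    rw [← add_div]
    exact div_le_div₀ (by positivity) (by linarith) (by linarith) hrN.2.1
  have h_int : IntegrableOn h (Ioo (-(π / 2)) (π / 2)) :=
    ⟨hhm.aestronglyMeasurable, lt_of_le_of_lt htot ENNReal.ofReal_lt_top⟩
  refine ⟨h_int, ?_⟩
  rw [← ofReal_integral_norm_eq_lintegral_enorm h_int,
    ENNReal.ofReal_le_ofReal_iff (by positivity)] at htot
  exact htot

/-- The entire function `s (s - 1) Λ(s)` recentred at `1 / 2`. -/
def centeredXi (w : ℂ) : ℂ := (w ^ 2 - 1 / 4) * completedRiemannZeta₀ (1 / 2 + w) + 1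

lemma differentiable_centeredXi : Differentiable ℂ centeredXi := by
  have := differentiable_completedZeta₀
  unfold centeredXi
  fun_prop

lemma centeredXi_neg (w : ℂ) : centeredXi (-w) = centeredXi w := by
  unfold centeredXi
  rw [← completedRiemannZeta₀_one_sub (1 / 2 + w)]
  ring_nf

lemma centeredXi_eq {w : ℂ} (h1 : w ≠ 1 / 2) (h2 : w ≠ -(1 / 2)) (hg : Gammaℝ (1 / 2 + w) ≠ 0) :
    centeredXi w = (w ^ 2 - 1 / 4) * Gammaℝ (1 / 2 + w) * riemannZeta (1 / 2 + w) := by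
  have h0 : (1 / 2 + w : ℂ) ≠ 0 := fun h => h2 (by linear_combination h)
  have h0' : 1 - (1 / 2 + w : ℂ) ≠ 0 := fun h => h1 (by linear_combination -h)
  rw [riemannZeta_def_of_ne_zero h0, completedRiemannZeta_eq, centeredXi,
    mul_assoc, mul_div_cancel₀ _ hg]
  rw [show w ^ 2 - 1 / 4 = -((1 / 2 + w) * (1 - (1 / 2 + w))) by ring]
  generalize (1 / 2 + w : ℂ) = s at *
  field_simp
  ring

lemma Gammaℝ_half_add_ne_zero {w : ℂ} (hw : -(1 / 2) < w.re) : Gammaℝ (1 / 2 + w) ≠ 0 :=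
  Gammaℝ_ne_zero_of_re_pos (by simp; linarith)

lemma countable_riemannZetaZeros : riemannZetaZeros.Countable := by
  have : riemannZetaZeros = ⋃ n : ℕ, Metric.closedBall 0 n ∩ riemannZetaZeros := by
    rw [← iUnion_inter, Metric.iUnion_closedBall_nat, univ_inter]
  rw [this]
  exact countable_iUnion fun n => ((isCompact_closedBall 0 (n : ℝ)).inter_riemannZetaZeros_finite).countable

lemma abs_log_norm_sq_sub_quarter_le {w : ℂ} {r : ℝ} (hw : ‖w‖ = r) (hr : 4 ≤ r) :
    |Real.log ‖w ^ 2 - 1 / 4‖ - 2 * Real.log r| ≤ 1 / r := by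
  have hr0 : 0 < r := by linarith
  have h1 : ‖w ^ 2 - 1 / 4‖ ≤ r ^ 2 + 1 / 4 := by
    refine (norm_sub_le _ _).trans ?_
    rw [norm_pow, hw]; norm_num
  have h2 : r ^ 2 - 1 / 4 ≤ ‖w ^ 2 - 1 / 4‖ := by
    refine le_trans ?_ (norm_sub_norm_le _ _)
    rw [norm_pow, hw]; norm_num
  set y := ‖w ^ 2 - 1 / 4‖ with hy
  have hy0 : 0 < y := by nlinarith
  have hq : Real.log y - 2 * Real.log r = Real.log (y / r ^ 2) := by
    rw [Real.log_div hy0.ne' (by positivity), Real.log_pow]; norm_num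
  rw [hq, abs_le]
  have hyr : 0 < y / r ^ 2 := by positivity
  constructor
  · have := Real.one_sub_inv_le_log_of_pos hyr
    refine le_trans ?_ this
    rw [inv_div, neg_le, neg_sub, sub_le_iff_le_add, div_le_iff₀ hy0]
    have : (1 / r + 1) * y ≥ (1 / r + 1) * (r ^ 2 - 1 / 4) := by gcongr
    refine le_trans ?_ this
    have e : (1 / r + 1) * (r ^ 2 - 1 / 4) = r ^ 2 + r - 1 / 4 - 1 / r * (1 / 4) := by
      field_simp; ring
    rw [e]
    have : 1 / r ≤ 1 / 4 := by gcongr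
    linarith
  · refine (Real.log_le_sub_one_of_pos hyr).trans ?_
    rw [sub_le_iff_le_add, div_le_iff₀ (by positivity)]
    have e : (1 / r + 1) * r ^ 2 = r ^ 2 + r := by field_simp; ring
    rw [e]; linarith

/-- The main term of `log ‖centeredXi (r * exp (θ * I))‖` on the right half plane. -/
def logXiMain (c r θ : ℝ) : ℝ :=
  2 * Real.log r - (1 / 4 + r * Real.cos θ / 2) * Real.log π + c +
    (r / 2 * Real.cos θ - 1 / 4) * Real.log (r / 2) - r / 2 * (θ * Real.sin θ) - r / 2 * Real.cos θ

lemma exists_abs_log_norm_centeredXi_sub_le : ∃ c : ℝ, ∀ r θ : ℝ, 4 ≤ r →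
    θ ∈ Ioo (-(π / 2)) (π / 2) → riemannZeta (1 / 2 + circleMap 0 r θ) ≠ 0 →
    |Real.log ‖centeredXi (circleMap 0 r θ)‖ - logXiMain c r θ| ≤
      |Real.log ‖riemannZeta (1 / 2 + circleMap 0 r θ)‖| + 33 / r := by
  obtain ⟨c, hc⟩ := exists_abs_stirlingDefect_sub_le
  refine ⟨c, fun r θ hr hθ hz => ?_⟩
  have hpi := Real.pi_pos
  have hr0 : 0 < r := by linarith
  have hcos := Real.cos_pos_of_mem_Ioo hθ
  set w := circleMap 0 r θ with hw
  have hre : w.re = r * Real.cos θ := by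
    simp [hw, circleMap, Complex.exp_mul_I, Complex.cos_ofReal_re]
  have him : w.im = r * Real.sin θ := by
    simp [hw, circleMap, Complex.exp_mul_I, Complex.sin_ofReal_re]
  have hnorm : ‖w‖ = r := by simp [hw, circleMap, abs_of_pos hr0]
  have hw1 : w ≠ 1 / 2 := fun h => by rw [h] at hnorm; norm_num at hnorm; linarith
  have hw2 : w ≠ -(1 / 2) := fun h => by rw [h] at hnorm; norm_num at hnorm; linarith
  have hrepos : 0 < w.re := by rw [hre]; positivity
  have hG : Complex.Gamma (w / 2 + 1 / 4) ≠ 0 :=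
    Complex.Gamma_ne_zero_of_re_pos (by simp; linarith)
  have hsq : w ^ 2 - 1 / 4 ≠ 0 := by
    intro h
    have : (w - 1 / 2) * (w + 1 / 2) = 0 := by linear_combination h
    rcases mul_eq_zero.mp this with h | h
    · exact hw1 (sub_eq_zero.mp h)
    · exact hw2 (eq_neg_of_add_eq_zero_left h)
  have hπ : (π : ℂ) ≠ 0 := by exact_mod_cast hpi.ne'
  have hlog : Complex.log (w / 2) = Real.log (r / 2) + θ * I := by
    have : w / 2 = Complex.exp (Real.log (r / 2) + θ * I) := by
      rw [Complex.exp_add, ← Complex.ofReal_exp, Real.exp_log (by positivity), hw, circleMap]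
      push_cast; ring
    rw [this, Complex.log_exp] <;> simp <;> linarith [hθ.1, hθ.2]
  have hst := hc (w / 2) (by simp; linarith) (by rw [norm_div, hnorm]; norm_num; linarith)
  have hst2 : stirlingDefect (w / 2) = Real.log ‖Complex.Gamma (w / 2 + 1 / 4)‖ -
      ((r / 2 * Real.cos θ - 1 / 4) * Real.log (r / 2) - r / 2 * (θ * Real.sin θ) -
        r / 2 * Real.cos θ) := by
    rw [stirlingDefect, hlog]
    congr 1
    simp [hre, him]
    ring
  have heq : Real.log ‖centeredXi w‖ = Real.log ‖w ^ 2 - 1 / 4‖ -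
      (1 / 4 + r * Real.cos θ / 2) * Real.log π + Real.log ‖Complex.Gamma (w / 2 + 1 / 4)‖ +
        Real.log ‖riemannZeta (1 / 2 + w)‖ := by
    rw [centeredXi_eq hw1 hw2 (Gammaℝ_half_add_ne_zero (by linarith)), Gammaℝ_def,
      show (1 / 2 + w) / 2 = w / 2 + 1 / 4 by ring, norm_mul, norm_mul, norm_mul,
      Complex.norm_cpow_eq_rpow_re_of_pos hpi,
      Real.log_mul (by positivity) (by positivity), Real.log_mul (by positivity) (by positivity),
      Real.log_mul (by positivity) (by positivity), Real.log_rpow hpi]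
    simp [hre]
    ring
  have h1 := abs_log_norm_sq_sub_quarter_le hnorm hr
  have e32 : 16 / ‖w / 2‖ = 32 / r := by
    rw [norm_div, hnorm]; norm_num; field_simp; norm_num
  rw [e32, hst2] at hst
  rw [heq, logXiMain]
  have e33 : 33 / r = 1 / r + 32 / r := by rw [← add_div]; norm_num
  rw [e33]
  rw [abs_le] at h1 hst ⊢
  have h3 := neg_abs_le (Real.log ‖riemannZeta (1 / 2 + w)‖)
  have h4 := le_abs_self (Real.log ‖riemannZeta (1 / 2 + w)‖)
  constructor <;> linarith [h1.1, h1.2, hst.1, hst.2]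

lemma integral_logXiMain (c r : ℝ) : ∫ θ in (-(π / 2))..(π / 2), logXiMain c r θ =
    2 * π * Real.log r - (π / 4 + r) * Real.log π + c * π + (r - π / 4) * Real.log (r / 2) -
      2 * r := by
  have hd (θ : ℝ) : HasDerivAt (fun θ => (2 * Real.log r - 1 / 4 * Real.log π + c -
      1 / 4 * Real.log (r / 2)) * θ + (-(r / 2) * Real.log π + r / 2 * Real.log (r / 2) - r / 2) *
        Real.sin θ - r / 2 * (Real.sin θ - θ * Real.cos θ)) (logXiMain c r θ) θ := by
    have h1 := (hasDerivAt_id θ).const_mul (2 * Real.log r - 1 / 4 * Real.log π + c -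
      1 / 4 * Real.log (r / 2))
    have h2 := (Real.hasDerivAt_sin θ).const_mul
      (-(r / 2) * Real.log π + r / 2 * Real.log (r / 2) - r / 2)
    have h3 := ((Real.hasDerivAt_sin θ).sub ((hasDerivAt_id θ).mul (Real.hasDerivAt_cos θ))).const_mul
      (r / 2)
    refine ((h1.add h2).sub h3).congr_deriv ?_
    simp [logXiMain]
    ring
  rw [intervalIntegral.integral_eq_sub_of_hasDerivAt (fun θ _ => hd θ)
    (Continuous.intervalIntegrable (by unfold logXiMain; fun_prop) _ _)]
  simp
  ring

lemma circleAverage_log_norm_centeredXi (r : ℝ) :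
    Real.circleAverage (fun z => Real.log ‖centeredXi z‖) 0 r =
      1 / π * ∫ θ in (-(π / 2))..(π / 2), Real.log ‖centeredXi (circleMap 0 r θ)‖ := by
  have hpi := Real.pi_pos
  set g : ℝ → ℝ := fun θ => Real.log ‖centeredXi (circleMap 0 r θ)‖ with hg
  have hper : Function.Periodic g π := by
    intro θ
    simp only [hg]
    have : circleMap 0 r (θ + π) = -circleMap 0 r θ := by
      simp [circleMap, add_mul, Complex.exp_add]
    rw [this, centeredXi_neg]
  have h_int : CircleIntegrable (fun z => Real.log ‖centeredXi z‖) 0 r :=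
    MeromorphicOn.circleIntegrable_log_norm fun z _ =>
      (differentiable_centeredXi.analyticAt z).meromorphicAt
  have h_int' : IntervalIntegrable g volume 0 π := by
    refine IntervalIntegrable.mono_set (h_int : IntervalIntegrable g volume 0 (2 * π)) ?_
    rw [uIcc_of_le (by linarith), uIcc_of_le (by linarith)]
    exact Icc_subset_Icc_right (by linarith)
  have h_int'' : IntervalIntegrable g volume π (2 * π) := by
    refine IntervalIntegrable.mono_set (h_int : IntervalIntegrable g volume 0 (2 * π)) ?_
    rw [uIcc_of_le (by linarith), uIcc_of_le (by linarith)]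
    exact Icc_subset_Icc_left (by linarith)
  rw [Real.circleAverage_def, smul_eq_mul]
  change (2 * π)⁻¹ * ∫ θ in (0)..(2 * π), g θ = 1 / π * ∫ θ in (-(π / 2))..(π / 2), g θ
  have h1 := hper.intervalIntegral_add_eq 0 (-(π / 2))
  have h2 := hper.intervalIntegral_add_eq π (-(π / 2))
  rw [show -(π / 2) + π = π / 2 by ring] at h1 h2
  rw [zero_add] at h1
  rw [show π + π = 2 * π by ring] at h2
  rw [← intervalIntegral.integral_add_adjacent_intervals h_int' h_int'', h1, h2]
  field_simp
  ring

lemma exists_circleAverage_log_norm_centeredXi : ∃ α β κ δ C : ℝ, ∀ R : ℝ, 4 ≤ R →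
    ∃ r ∈ Icc R (R + 1), |Real.circleAverage (fun z => Real.log ‖centeredXi z‖) 0 r -
      (α * (r * Real.log r) + β * r + κ * Real.log r + δ)| ≤ C * Real.log R / R := by
  obtain ⟨c, hc⟩ := exists_abs_log_norm_centeredXi_sub_le
  have hpi := Real.pi_pos
  refine ⟨1 / π, 1 / π * (-Real.log π - Real.log 2 - 2), 1 / π * (2 * π - π / 4),
    1 / π * (-(π / 4) * Real.log π + c * π + π / 4 * Real.log 2), 1000 + 33 * π, fun R hR => ?_⟩
  have hN : volume ((fun ρ : ℂ => ‖ρ - 1 / 2‖) '' riemannZetaZeros) = 0 :=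
    (countable_riemannZetaZeros.image _).measure_zero _
  obtain ⟨r, hr, hrN, hri, hrb⟩ := exists_radius_integral_log_riemannZeta_le hN hR
  refine ⟨r, hr, ?_⟩
  have hr0 : 0 < r := by linarith [hr.1]
  have hlogR : 1 ≤ Real.log R := by
    rw [Real.le_log_iff_exp_le (by linarith)]
    linarith [Real.exp_one_lt_d9]
  have hmain : 1 / π * (r * Real.log r) + 1 / π * (-Real.log π - Real.log 2 - 2) * r +
      1 / π * (2 * π - π / 4) * Real.log r +
      1 / π * (-(π / 4) * Real.log π + c * π + π / 4 * Real.log 2) =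
      1 / π * ∫ θ in (-(π / 2))..(π / 2), logXiMain c r θ := by
    rw [integral_logXiMain, Real.log_div hr0.ne' (by norm_num)]
    ring
  have hle : -(π / 2) ≤ π / 2 := by linarith
  have hnz (θ : ℝ) : riemannZeta (1 / 2 + circleMap 0 r θ) ≠ 0 := fun h =>
    hrN ⟨1 / 2 + circleMap 0 r θ, mem_riemannZetaZeros.mpr h, by simp [abs_of_pos hr0]⟩
  have h_int : IntervalIntegrable (fun θ => Real.log ‖centeredXi (circleMap 0 r θ)‖) volume
      (-(π / 2)) (π / 2) := by
    have h1 : CircleIntegrable (fun z => Real.log ‖centeredXi z‖) 0 r :=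
      MeromorphicOn.circleIntegrable_log_norm fun z _ =>
        (differentiable_centeredXi.analyticAt z).meromorphicAt
    have h := (periodic_circleMap 0 r).comp (fun z => Real.log ‖centeredXi z‖)
    exact h.intervalIntegrable (t := 0) (by positivity) (by rw [zero_add]; exact h1) _ _
  have hcont : IntervalIntegrable (fun θ => logXiMain c r θ) volume (-(π / 2)) (π / 2) :=
    Continuous.intervalIntegrable (by unfold logXiMain; fun_prop) _ _
  rw [hmain, circleAverage_log_norm_centeredXi, ← mul_sub, abs_mul, abs_of_pos (by positivity),
    ← intervalIntegral.integral_sub h_int hcont]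
  have hb : |∫ θ in (-(π / 2))..(π / 2), (Real.log ‖centeredXi (circleMap 0 r θ)‖ -
      logXiMain c r θ)| ≤ 1000 * Real.log R / R + 33 / r * π := by
    rw [intervalIntegral.integral_of_le hle, integral_Ioc_eq_integral_Ioo]
    have hbd : ∀ᵐ θ ∂(volume.restrict (Ioo (-(π / 2)) (π / 2))),
        ‖Real.log ‖centeredXi (circleMap 0 r θ)‖ - logXiMain c r θ‖ ≤
          |Real.log ‖riemannZeta (1 / 2 + circleMap 0 r θ)‖| + 33 / r := by
      filter_upwards [ae_restrict_mem measurableSet_Ioo] with θ hθ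
      exact hc r θ (by linarith [hr.1]) hθ (hnz θ)
    refine (norm_integral_le_of_norm_le (hri.norm.add (integrable_const (33 / r))) hbd).trans ?_
    rw [integral_add' hri.norm (integrable_const _), setIntegral_const]
    refine add_le_add hrb (le_of_eq ?_)
    simp [Measure.real, Real.volume_Ioo]
    rw [ENNReal.toReal_ofReal hpi.le]
    ring
  have h33 : 33 / r * π ≤ 33 * π * Real.log R / R := by
    rw [div_mul_eq_mul_div]
    refine div_le_div₀ (by positivity) ?_ (by linarith) hr.1
    nlinarith
  have hpi1 : 1 / π ≤ 1 := by
    rw [div_le_one hpi]; linarith [Real.pi_gt_three]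
  calc _ ≤ 1 * (1000 * Real.log R / R + 33 * π * Real.log R / R) := by
        gcongr
        exact hb.trans (by linarith)
    _ = _ := by ring

lemma abs_mul_log_sub_mul_log_le {x y : ℝ} (hx : 8 ≤ x) (h1 : x - 3 ≤ y) (h2 : y ≤ x + 3) :
    |y * Real.log y - x * Real.log x| ≤ 12 * Real.log x := by
  have hx0 : 0 < x := by linarith
  have hy0 : 0 < y := by linarith
  have hlx : 1 ≤ Real.log x := by
    rw [Real.le_log_iff_exp_le hx0]; linarith [Real.exp_one_lt_d9]
  have hly : Real.log y ≤ 2 * Real.log x := by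
    rw [show 2 * Real.log x = Real.log (x ^ 2) by simp [Real.log_pow]]
    exact Real.log_le_log hy0 (by nlinarith)
  have hly0 : 0 ≤ Real.log y := Real.log_nonneg (by linarith)
  have e : y * Real.log y - x * Real.log x = (y - x) * Real.log y + x * Real.log (y / x) := by
    rw [Real.log_div hy0.ne' hx0.ne']; ring
  have h3 : x * Real.log (y / x) ≤ 6 := by
    have := Real.log_le_sub_one_of_pos (div_pos hy0 hx0)
    have h4 : x * Real.log (y / x) ≤ x * (y / x - 1) := by gcongr
    have h5 : x * (y / x - 1) = y - x := by field_simp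
    linarith
  have h4 : -6 ≤ x * Real.log (y / x) := by
    have := Real.one_sub_inv_le_log_of_pos (div_pos hy0 hx0)
    have h4 : x * (1 - (y / x)⁻¹) ≤ x * Real.log (y / x) := by gcongr
    have h5 : x * (1 - (y / x)⁻¹) = x * (y - x) / y := by field_simp
    have h6 : -6 ≤ x * (y - x) / y := by
      rw [le_div_iff₀ hy0]
      nlinarith
    linarith
  rw [e, abs_le]
  constructor <;> nlinarith

lemma exists_slope_sub_le (α β κ δ C : ℝ) (hC : 0 ≤ C) : ∃ C' : ℝ, ∀ J : ℝ → ℝ, ∀ x r₁ r₂ : ℝ, 8 ≤ x →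
    x - 3 ≤ r₁ → r₁ + 1 ≤ r₂ → r₂ ≤ x + 3 →
    |J r₁ - (α * (r₁ * Real.log r₁) + β * r₁ + κ * Real.log r₁ + δ)| ≤ C * Real.log x / x →
    |J r₂ - (α * (r₂ * Real.log r₂) + β * r₂ + κ * Real.log r₂ + δ)| ≤ C * Real.log x / x →
    |(J r₂ - J r₁) / (Real.log r₂ - Real.log r₁) - (α * (x * Real.log x) + (α + β) * x)| ≤
      C' * Real.log x := by
  refine ⟨4 * C + 12 * |α| + 3 * |α + β| + |κ|, fun J x r₁ r₂ hx h1 h12 h2 hJ1 hJ2 => ?_⟩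
  set A : ℝ → ℝ := fun r => α * (r * Real.log r) + β * r + κ * Real.log r + δ with hA
  have hx0 : 0 < x := by linarith
  have hr1 : 0 < r₁ := by linarith
  have hr2 : 0 < r₂ := by linarith
  have hlx : 1 ≤ Real.log x := by
    rw [Real.le_log_iff_exp_le hx0]; linarith [Real.exp_one_lt_d9]
  have hdA (r : ℝ) (hr : 0 < r) :
      HasDerivAt A (α * (Real.log r + 1) + β + κ * r⁻¹) r := by
    have hl := Real.hasDerivAt_log hr.ne'
    have := ((((hasDerivAt_id r).mul hl).const_mul α).add ((hasDerivAt_id r).const_mul β)).add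
      (hl.const_mul κ) |>.add_const δ
    refine this.congr_deriv ?_
    simp [hr.ne']
  obtain ⟨ξ, hξ, hξe⟩ := exists_ratio_hasDerivAt_eq_ratio_slope A
    (fun r => α * (Real.log r + 1) + β + κ * r⁻¹) (by linarith : r₁ < r₂)
    (fun r hr => (hdA r (by linarith [hr.1])).continuousAt.continuousWithinAt)
    (fun r hr => hdA r (by linarith [hr.1])) Real.log (fun r => r⁻¹)
    (fun r hr => (Real.continuousAt_log (by linarith [hr.1])).continuousWithinAt)
    (fun r hr => Real.hasDerivAt_log (by linarith [hr.1]))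
  have hξ0 : 0 < ξ := by linarith [hξ.1]
  set L := Real.log r₂ - Real.log r₁ with hL
  have hLlow : 1 / (2 * x) ≤ L := by
    rw [hL, ← Real.log_div hr2.ne' hr1.ne']
    refine le_trans ?_ (Real.one_sub_inv_le_log_of_pos (div_pos hr2 hr1))
    rw [inv_div, one_sub_div hr2.ne']
    refine div_le_div₀ (by linarith) (by linarith) hr2 (by linarith)
  have hL0 : 0 < L := lt_of_lt_of_le (by positivity) hLlow
  have hslope : (A r₂ - A r₁) / L = α * (ξ * Real.log ξ) + (α + β) * ξ + κ := by
    rw [div_eq_iff hL0.ne']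
    have : (A r₂ - A r₁) * (ξ⁻¹ * ξ) = (Real.log r₂ - Real.log r₁) *
        (α * (Real.log ξ + 1) + β + κ * ξ⁻¹) * ξ := by rw [hξe]; ring
    rw [inv_mul_cancel₀ hξ0.ne', mul_one] at this
    rw [this, hL]
    field_simp
    ring
  have hJA : |(J r₂ - J r₁) / L - (A r₂ - A r₁) / L| ≤ 4 * C * Real.log x := by
    rw [← sub_div, abs_div, abs_of_pos hL0, div_le_iff₀ hL0]
    have e : J r₂ - J r₁ - (A r₂ - A r₁) = (J r₂ - A r₂) - (J r₁ - A r₁) := by ring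
    rw [e]
    refine (abs_sub _ _).trans ((add_le_add hJ2 hJ1).trans ?_)
    calc C * Real.log x / x + C * Real.log x / x = 4 * C * Real.log x * (1 / (2 * x)) := by
          field_simp; ring
      _ ≤ _ := by gcongr
  have hB : |α * (ξ * Real.log ξ) + (α + β) * ξ + κ - (α * (x * Real.log x) + (α + β) * x)| ≤
      (12 * |α| + 3 * |α + β| + |κ|) * Real.log x := by
    have e : α * (ξ * Real.log ξ) + (α + β) * ξ + κ - (α * (x * Real.log x) + (α + β) * x) =
      α * (ξ * Real.log ξ - x * Real.log x) + (α + β) * (ξ - x) + κ := by ring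
    rw [e]
    refine (abs_add_le _ _).trans ?_
    refine (add_le_add_left (abs_add_le _ _) _).trans ?_
    rw [abs_mul, abs_mul]
    have h4 := abs_mul_log_sub_mul_log_le hx (by linarith [hξ.1] : x - 3 ≤ ξ) (by linarith [hξ.2])
    have h5 : |ξ - x| ≤ 3 := by
      rw [abs_le]; constructor <;> linarith [hξ.1, hξ.2]
    have h6 : |α| * |ξ * Real.log ξ - x * Real.log x| ≤ |α| * (12 * Real.log x) := by gcongr
    have h7 : |α + β| * |ξ - x| ≤ |α + β| * (3 * Real.log x) := by
      gcongr; linarith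
    have h8 : |κ| ≤ |κ| * Real.log x := le_mul_of_one_le_right (abs_nonneg _) hlx
    nlinarith
  rw [hslope] at hJA
  have := abs_sub_le ((J r₂ - J r₁) / L) (α * (ξ * Real.log ξ) + (α + β) * ξ + κ)
    (α * (x * Real.log x) + (α + β) * x)
  nlinarith

lemma finite_analyticOrderNatAt_ne_zero {f : ℂ → ℂ} (hf : Differentiable ℂ f) (r : ℝ) :
    {u | analyticOrderNatAt f u ≠ 0 ∧ ‖u‖ ≤ r}.Finite := by
  have h := (MeromorphicOn.divisor f (Metric.closedBall 0 r)).finiteSupport (isCompact_closedBall 0 r)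
  refine h.subset fun u hu => ?_
  have hmem : u ∈ Metric.closedBall (0 : ℂ) r := by simpa using hu.2
  rw [Function.mem_support, MeromorphicOn.AnalyticOnNhd.divisor_apply
    (fun z _ => hf.analyticAt z) hmem]
  have := hu.1
  unfold analyticOrderNatAt at this
  cases h : analyticOrderAt f u with
  | top => simp [h] at this
  | coe n => simpa [h] using this

/-- The number of zeros of `f` in the closed ball of radius `r`, with multiplicity. -/
def zeroCount (f : ℂ → ℂ) (r : ℝ) : ℕ :=
  ∑ᶠ u ∈ {u | analyticOrderNatAt f u ≠ 0 ∧ ‖u‖ ≤ r}, analyticOrderNatAt f u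

lemma circleAverage_log_norm_eq_sum {f : ℂ → ℂ} (hf : Differentiable ℂ f) {r s : ℝ} (hr : 0 < r)
    (hrs : r ≤ s) :
    Real.circleAverage (fun z => Real.log ‖f z‖) 0 r =
      ∑ u ∈ (finite_analyticOrderNatAt_ne_zero hf s).toFinset, (analyticOrderNatAt f u : ℝ) *
        (if ‖u‖ ≤ r then Real.log r - Real.log ‖u‖ else 0) +
      Real.log ‖meromorphicTrailingCoeffAt f 0‖ := by
  have hd (u : ℂ) : (MeromorphicOn.divisor f (Metric.closedBall 0 |r|) u : ℝ) =
      if ‖u‖ ≤ r then (analyticOrderNatAt f u : ℝ) else 0 := by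
    rw [abs_of_pos hr]
    split_ifs with hu
    · rw [MeromorphicOn.AnalyticOnNhd.divisor_apply (fun z _ => hf.analyticAt z) (by simpa using hu),
        analyticOrderNatAt]
      cases analyticOrderAt f u <;> simp
    · rw [Function.locallyFinsuppWithin.apply_eq_zero_of_notMem _ (by simpa using hu)]; simp
  rw [MeromorphicOn.circleAverage_log_norm hr.ne' (fun z _ => (hf.analyticAt z).meromorphicAt),
    ← countingFunction_finsum_eq_finsum_add hr.ne'
      ((MeromorphicOn.divisor f _).finiteSupport (isCompact_closedBall 0 _))]
  congr 1
  rw [finsum_eq_sum_of_support_subset (s := (finite_analyticOrderNatAt_ne_zero hf s).toFinset)]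
  · refine Finset.sum_congr rfl fun u _ => ?_
    rw [hd]
    split_ifs <;> simp
  · intro u hu
    rw [Function.mem_support, hd] at hu
    simp only [Finite.coe_toFinset, mem_ofPred_eq]
    split_ifs at hu with h
    · exact ⟨fun h0 => hu (by simp [h0]), h.trans hrs⟩
    · simp at hu

lemma zeroCount_eq_sum {f : ℂ → ℂ} (hf : Differentiable ℂ f) {r s : ℝ} (hrs : r ≤ s) :
    (zeroCount f r : ℝ) = ∑ u ∈ (finite_analyticOrderNatAt_ne_zero hf s).toFinset,
      (analyticOrderNatAt f u : ℝ) * (if ‖u‖ ≤ r then 1 else 0) := by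
  rw [zeroCount, finsum_mem_eq_finite_toFinset_sum _ (finite_analyticOrderNatAt_ne_zero hf r)]
  push_cast
  simp only [mul_ite, mul_one, mul_zero]
  rw [← Finset.sum_filter]
  refine Finset.sum_congr ?_ fun _ _ => rfl
  ext u
  simp only [Finite.mem_toFinset, mem_ofPred_eq, Finset.mem_filter]
  exact ⟨fun h => ⟨⟨h.1, h.2.trans hrs⟩, h.2⟩, fun h => ⟨h.1.1, h.2⟩⟩

lemma zeroCount_mono {f : ℂ → ℂ} (hf : Differentiable ℂ f) : Monotone (zeroCount f) := by
  intro r s hrs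
  have h1 := zeroCount_eq_sum hf hrs
  have h2 := zeroCount_eq_sum hf (le_refl s)
  have : (zeroCount f r : ℝ) ≤ zeroCount f s := by
    rw [h1, h2]
    refine Finset.sum_le_sum fun u hu => ?_
    gcongr
    split_ifs with h3 h4
    · rfl
    · exact absurd (h3.trans hrs) h4
    · norm_num
    · rfl
  exact_mod_cast this

lemma zeroCount_mul_le_circleAverage_sub {f : ℂ → ℂ} (hf : Differentiable ℂ f) {r s : ℝ}
    (hr : 0 < r) (hrs : r < s) :
    zeroCount f r * (Real.log s - Real.log r) ≤
      Real.circleAverage (fun z => Real.log ‖f z‖) 0 s -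
        Real.circleAverage (fun z => Real.log ‖f z‖) 0 r ∧
    Real.circleAverage (fun z => Real.log ‖f z‖) 0 s -
        Real.circleAverage (fun z => Real.log ‖f z‖) 0 r ≤
      zeroCount f s * (Real.log s - Real.log r) := by
  have hL : Real.log r ≤ Real.log s := Real.log_le_log hr hrs.le
  rw [circleAverage_log_norm_eq_sum hf hr hrs.le, circleAverage_log_norm_eq_sum hf (hr.trans hrs) le_rfl,
    add_sub_add_right_eq_sub, ← Finset.sum_sub_distrib, zeroCount_eq_sum hf hrs.le,
    zeroCount_eq_sum hf (le_refl s), Finset.sum_mul, Finset.sum_mul]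
  have key (u : ℂ) (hu : ‖u‖ ≤ s) (hu' : ¬ ‖u‖ ≤ r) :
      Real.log r ≤ Real.log ‖u‖ ∧ Real.log ‖u‖ ≤ Real.log s :=
    ⟨Real.log_le_log hr (not_le.mp hu').le, Real.log_le_log (hr.trans (not_le.mp hu')) hu⟩
  constructor <;>
  · refine Finset.sum_le_sum fun u hu => ?_
    have hus : ‖u‖ ≤ s := by simp at hu; exact hu.2
    rw [← mul_sub, mul_assoc]
    refine mul_le_mul_of_nonneg_left ?_ (Nat.cast_nonneg _)
    rw [if_pos hus]
    split_ifs with h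
    · linarith
    · linarith [(key u hus h).1, (key u hus h).2]

lemma exists_abs_zeroCount_centeredXi_sub_le : ∃ a b C : ℝ, ∀ x : ℝ, 8 ≤ x →
    |zeroCount centeredXi x - (a * (x * Real.log x) + b * x)| ≤ C * Real.log x := by
  obtain ⟨α, β, κ, δ, C, h⟩ := exists_circleAverage_log_norm_centeredXi
  obtain ⟨C', hC'⟩ := exists_slope_sub_le α β κ δ (|C| * 4) (by positivity)
  set J : ℝ → ℝ := fun r => Real.circleAverage (fun z => Real.log ‖centeredXi z‖) 0 r with hJ
  refine ⟨α, α + β, C', fun x hx => ?_⟩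
  have hx0 : 0 < x := by linarith
  have hb (R : ℝ) (h1 : x - 3 ≤ R) (h2 : R ≤ x + 3) :
      C * Real.log R / R ≤ |C| * 4 * Real.log x / x := by
    have hR0 : 0 < R := by linarith
    have hl : Real.log R ≤ 2 * Real.log x := by
      rw [show 2 * Real.log x = Real.log (x ^ 2) by simp [Real.log_pow]]
      exact Real.log_le_log hR0 (by nlinarith)
    have hl0 : 0 ≤ Real.log R := Real.log_nonneg (by linarith)
    have hlx0 : 0 ≤ Real.log x := Real.log_nonneg (by linarith)
    calc C * Real.log R / R ≤ |C| * (2 * Real.log x) / (x / 2) := by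
          refine div_le_div₀ (by positivity) ?_ (by positivity) (by linarith)
          gcongr
          exact le_abs_self C
      _ = _ := by field_simp; ring
  have hsl (r₁ r₂ : ℝ) (h1 : x - 3 ≤ r₁) (h12 : r₁ + 1 ≤ r₂) (h2 : r₂ ≤ x + 3)
      (hJ1 : |J r₁ - (α * (r₁ * Real.log r₁) + β * r₁ + κ * Real.log r₁ + δ)| ≤
        |C| * 4 * Real.log x / x)
      (hJ2 : |J r₂ - (α * (r₂ * Real.log r₂) + β * r₂ + κ * Real.log r₂ + δ)| ≤
        |C| * 4 * Real.log x / x) := hC' J x r₁ r₂ hx h1 h12 h2 hJ1 hJ2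
  rw [abs_le]
  constructor
  · obtain ⟨r₁, hr1, hJ1⟩ := h (x - 3) (by linarith)
    obtain ⟨r₂, hr2, hJ2⟩ := h (x - 1) (by linarith)
    have h5 := hsl r₁ r₂ hr1.1 (by linarith [hr1.2, hr2.1]) (by linarith [hr2.2])
      (hJ1.trans (hb _ (by linarith) (by linarith))) (hJ2.trans (hb _ (by linarith) (by linarith)))
    have hr0 : 0 < r₁ := by linarith [hr1.1]
    have hlt : r₁ < r₂ := by linarith [hr1.2, hr2.1]
    have h6 := (zeroCount_mul_le_circleAverage_sub differentiable_centeredXi hr0 hlt).2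
    have hL : 0 < Real.log r₂ - Real.log r₁ := sub_pos.mpr (Real.log_lt_log hr0 hlt)
    rw [← div_le_iff₀ hL] at h6
    have h7 : (zeroCount centeredXi r₂ : ℝ) ≤ zeroCount centeredXi x := by
      exact_mod_cast zeroCount_mono differentiable_centeredXi (by linarith [hr2.2])
    have := (abs_le.mp h5).1
    linarith
  · obtain ⟨r₁, hr1, hJ1⟩ := h x (by linarith)
    obtain ⟨r₂, hr2, hJ2⟩ := h (x + 2) (by linarith)
    have h5 := hsl r₁ r₂ (by linarith [hr1.1]) (by linarith [hr1.2, hr2.1]) (by linarith [hr2.2])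
      (hJ1.trans (hb _ (by linarith) (by linarith))) (hJ2.trans (hb _ (by linarith) (by linarith)))
    have hr0 : 0 < r₁ := by linarith [hr1.1]
    have hlt : r₁ < r₂ := by linarith [hr1.2, hr2.1]
    have h6 := (zeroCount_mul_le_circleAverage_sub differentiable_centeredXi hr0 hlt).1
    have hL : 0 < Real.log r₂ - Real.log r₁ := sub_pos.mpr (Real.log_lt_log hr0 hlt)
    rw [← le_div_iff₀ hL] at h6
    have h7 : (zeroCount centeredXi x : ℝ) ≤ zeroCount centeredXi r₁ := by
      exact_mod_cast zeroCount_mono differentiable_centeredXi hr1.1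
    have := (abs_le.mp h5).2
    linarith

lemma analyticOrderNatAt_eq_sInf_iteratedDeriv_ne_zero {f : ℂ → ℂ} {z : ℂ} (hf : AnalyticAt ℂ f z) :
    analyticOrderNatAt f z = sInf {n : ℕ | iteratedDeriv n f z ≠ 0} := by
  have key (n : ℕ) := natCast_le_analyticOrderAt_iff_iteratedDeriv_eq_zero (n := n) hf
  by_cases htop : analyticOrderAt f z = ⊤
  · have : {n : ℕ | iteratedDeriv n f z ≠ 0} = ∅ := by
      ext n
      have := (key (n + 1)).1 (by simp [htop]) n (by omega)
      simp [this]
    rw [this]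
    simp [analyticOrderNatAt, htop]
  · obtain ⟨k, hk⟩ := ENat.ne_top_iff_exists.1 htop
    have hk' : analyticOrderNatAt f z = k := by simp [analyticOrderNatAt, ← hk]
    rw [hk']
    simp only [← hk, Nat.cast_le] at key
    have hlow := (key k).1 le_rfl
    have hne : iteratedDeriv k f z ≠ 0 := by
      intro h0
      have := (key (k + 1)).2 (fun i hi => by
        rcases Nat.lt_succ_iff_lt_or_eq.1 hi with h | h
        · exact hlow i h
        · rw [h, h0])
      omega
    refine le_antisymm ?_ (Nat.sInf_le hne)
    refine le_csInf ⟨k, hne⟩ fun n hn => ?_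
    by_contra hlt
    exact hn (hlow n (by omega))

lemma abs_re_lt_of_centeredXi_eq_zero {w : ℂ} (hw : centeredXi w = 0) : |w.re| < 1 / 2 := by
  have main (u : ℂ) (hu : centeredXi u = 0) : u.re < 1 / 2 := by
    by_contra! hle
    have h1 : u ≠ 1 / 2 := by
      rintro rfl
      simp [centeredXi] at hu
      norm_num at hu
    have h2 : u ≠ -(1 / 2) := by
      rintro rfl
      norm_num at hle
    have hg := Gammaℝ_half_add_ne_zero (w := u) (by linarith)
    rw [centeredXi_eq h1 h2 hg] at hu
    have hz : riemannZeta (1 / 2 + u) ≠ 0 := riemannZeta_ne_zero_of_one_le_re (by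
      simp; linarith)
    have hq : u ^ 2 - 1 / 4 ≠ 0 := by
      have : u ^ 2 - 1 / 4 = (u - 1 / 2) * (u - -(1 / 2)) := by ring
      rw [this]
      exact mul_ne_zero (sub_ne_zero.2 h1) (sub_ne_zero.2 h2)
    exact mul_ne_zero (mul_ne_zero hq hg) hz hu
  have h1 := main w hw
  have h2 := main (-w) (by rw [centeredXi_neg, hw])
  rw [abs_lt]
  simp at h2
  constructor <;> linarith

lemma analyticOrderNatAt_centeredXi {w : ℂ} (hw : |w.re| < 1 / 2) :
    analyticOrderNatAt centeredXi w = zetaMult (1 / 2 + w) := by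
  have hwre := abs_lt.1 hw
  have hne1 : (1 / 2 + w : ℂ) ≠ 1 := by
    intro h
    have := congrArg Complex.re h
    simp at this
    linarith
  have hζ : AnalyticAt ℂ riemannZeta (1 / 2 + w) := by
    refine DifferentiableOn.analyticAt (s := {1}ᶜ) (fun z hz => ?_)
      (isOpen_compl_singleton.mem_nhds hne1)
    exact (differentiableAt_riemannZeta hz).differentiableWithinAt
  rw [zetaMult, ← analyticOrderNatAt_eq_sInf_iteratedDeriv_ne_zero hζ]
  have hadd : AnalyticAt ℂ (fun u : ℂ => 1 / 2 + u) w := by fun_prop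
  have hζ' : AnalyticAt ℂ (fun u => riemannZeta (1 / 2 + u)) w :=
    AnalyticAt.comp (f := fun u : ℂ => 1 / 2 + u) hζ hadd
  have hG : AnalyticAt ℂ (fun u => (Gammaℝ (1 / 2 + u))⁻¹) w := by
    have h : Differentiable ℂ (fun u => (Gammaℝ (1 / 2 + u))⁻¹) :=
      differentiable_Gammaℝ_inv.comp (by fun_prop)
    exact h.analyticAt w
  have hQ : AnalyticAt ℂ (fun u : ℂ => u ^ 2 - 1 / 4) w := by fun_prop
  have hX : AnalyticAt ℂ centeredXi w := differentiable_centeredXi.analyticAt w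
  have hmem : {u : ℂ | |u.re| < 1 / 2} ∈ nhds w :=
    (isOpen_lt (by fun_prop) continuous_const).mem_nhds hw
  have hq0 (u : ℂ) (hu : |u.re| < 1 / 2) : u ≠ 1 / 2 ∧ u ≠ -(1 / 2) := by
    constructor <;> rintro rfl <;> norm_num [abs_lt] at hu
  have hEq : (fun u => (Gammaℝ (1 / 2 + u))⁻¹) * centeredXi =ᶠ[nhds w]
      (fun u : ℂ => u ^ 2 - 1 / 4) * (fun u => riemannZeta (1 / 2 + u)) := by
    filter_upwards [hmem] with u hu
    have hg := Gammaℝ_half_add_ne_zero (w := u) (by linarith [(abs_lt.1 hu).1])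
    simp only [Pi.mul_apply]
    rw [centeredXi_eq (hq0 u hu).1 (hq0 u hu).2 hg, mul_assoc, mul_left_comm, ← mul_assoc,
      mul_assoc, inv_mul_cancel_left₀ hg]
  have hord := analyticOrderAt_congr hEq
  rw [analyticOrderAt_mul hG hX, analyticOrderAt_mul hQ hζ', hG.analyticOrderAt_eq_zero.2
    (inv_ne_zero (Gammaℝ_half_add_ne_zero (by linarith))), hQ.analyticOrderAt_eq_zero.2 ?_,
    zero_add, zero_add] at hord
  · have hc := analyticOrderAt_comp_of_deriv_ne_zero (f := riemannZeta) hadd (by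
      rw [deriv_const_add]; simp)
    have : analyticOrderAt centeredXi w = analyticOrderAt riemannZeta (1 / 2 + w) := by
      rw [hord, ← hc]; rfl
    simp [analyticOrderNatAt, this]
  · have : w ^ 2 - 1 / 4 = (w - 1 / 2) * (w - -(1 / 2)) := by ring
    rw [this]
    exact mul_ne_zero (sub_ne_zero.2 (hq0 w hw).1) (sub_ne_zero.2 (hq0 w hw).2)

lemma analyticOrderNatAt_centeredXi_neg (w : ℂ) :
    analyticOrderNatAt centeredXi (-w) = analyticOrderNatAt centeredXi w := by
  have hc := analyticOrderAt_comp_of_deriv_ne_zero (f := centeredXi) (g := fun u : ℂ => -u) (z₀ := w)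
    (by fun_prop) (by simp)
  have : centeredXi ∘ (fun u : ℂ => -u) = centeredXi := by
    ext u; exact centeredXi_neg u
  rw [this] at hc
  simp [analyticOrderNatAt, hc]

lemma centeredXi_eq_zero_of_analyticOrderNatAt_ne_zero {w : ℂ}
    (hw : analyticOrderNatAt centeredXi w ≠ 0) : centeredXi w = 0 := by
  by_contra h
  exact hw (by simp [analyticOrderNatAt,
    (differentiable_centeredXi.analyticAt w).analyticOrderAt_eq_zero.2 h])

lemma finite_nontrivialZero_im_le (x : ℝ) :
    {i : {ρ : ℂ // IsNontrivialZero ρ ∧ 0 < ρ.im} | i.1.im ≤ x}.Finite := by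
  have hK : IsCompact (Icc (0 : ℝ) 1 ×ℂ Icc (0 : ℝ) x) := isCompact_Icc.reProdIm isCompact_Icc
  refine Set.Finite.of_finite_image (f := Subtype.val) (hK.inter_riemannZetaZeros_finite.subset ?_)
    Subtype.val_injective.injOn
  rintro _ ⟨i, hi, rfl⟩
  obtain ⟨⟨hz, h0, h1⟩, him⟩ := i.2
  refine ⟨?_, mem_riemannZetaZeros.2 hz⟩
  simp only [mem_reProdIm, mem_Icc]
  exact ⟨⟨h0.le, h1.le⟩, him.le, hi⟩

/-- The number, with multiplicity, of nontrivial zeros with ordinate in `(0, x]`. -/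
def zeroOrdinateCount (x : ℝ) : ℕ := ∑ i ∈ (finite_nontrivialZero_im_le x).toFinset, zetaMult i.1

lemma zeroOrdinateCount_mono : Monotone zeroOrdinateCount := by
  intro x y hxy
  refine Finset.sum_le_sum_of_subset fun i hi => ?_
  simp only [Finite.mem_toFinset, mem_ofPred_eq] at hi ⊢
  exact hi.trans hxy

lemma two_mul_zeroOrdinateCount_bounds (x : ℝ) :
    zeroCount centeredXi x ≤ 2 * zeroOrdinateCount x + zeroCount centeredXi 1 ∧
    2 * zeroOrdinateCount x ≤ zeroCount centeredXi (x + 1 / 2) := by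
  classical
  set D : ℂ → ℕ := analyticOrderNatAt centeredXi with hD
  set S : ℝ → Finset ℂ := fun r =>
    (finite_analyticOrderNatAt_ne_zero differentiable_centeredXi r).toFinset with hS
  have memS (r : ℝ) (u : ℂ) : u ∈ S r ↔ D u ≠ 0 ∧ ‖u‖ ≤ r := by
    simp [hS, hD]
  have hcount (r : ℝ) : zeroCount centeredXi r = ∑ u ∈ S r, D u := by
    rw [zeroCount, finsum_mem_eq_finite_toFinset_sum _
      (finite_analyticOrderNatAt_ne_zero differentiable_centeredXi r)]
  have hre (u : ℂ) (hu : D u ≠ 0) : |u.re| < 1 / 2 :=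
    abs_re_lt_of_centeredXi_eq_zero (centeredXi_eq_zero_of_analyticOrderNatAt_ne_zero hu)
  set P : ℝ → Finset ℂ := fun r => (S r).filter (fun u => 0 < u.im) with hP
  set Q : ℝ → Finset ℂ := fun r => (S r).filter (fun u => u.im < 0) with hQ
  have hPQ (r : ℝ) : ∑ u ∈ Q r, D u = ∑ u ∈ P r, D u := by
    refine Finset.sum_nbij' (fun u => -u) (fun u => -u) ?_ ?_ (by simp) (by simp) ?_
    · intro u hu
      simp only [hQ, hP, Finset.mem_filter, memS, norm_neg, neg_im] at hu ⊢
      rw [hD, analyticOrderNatAt_centeredXi_neg]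
      exact ⟨hu.1, by linarith [hu.2]⟩
    · intro u hu
      simp only [hQ, hP, Finset.mem_filter, memS, norm_neg, neg_im] at hu ⊢
      rw [hD, analyticOrderNatAt_centeredXi_neg]
      exact ⟨hu.1, by linarith [hu.2]⟩
    · intro u hu
      exact (analyticOrderNatAt_centeredXi_neg u).symm
  have hdisj (r : ℝ) : Disjoint (P r) (Q r) := by
    rw [Finset.disjoint_left]
    intro u hu hu'
    simp only [hP, hQ, Finset.mem_filter] at hu hu'
    linarith [hu.2, hu'.2]
  have hlow (r : ℝ) : 2 * ∑ u ∈ P r, D u ≤ zeroCount centeredXi r := by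
    rw [hcount, two_mul]
    nth_rewrite 2 [← hPQ]
    rw [← Finset.sum_union (hdisj r)]
    exact Finset.sum_le_sum_of_subset
      (Finset.union_subset (Finset.filter_subset _ _) (Finset.filter_subset _ _))
  have hup (r : ℝ) : zeroCount centeredXi r ≤ 2 * ∑ u ∈ P r, D u + zeroCount centeredXi 1 := by
    rw [hcount, hcount, two_mul]
    nth_rewrite 2 [← hPQ]
    rw [← Finset.sum_union (hdisj r)]
    refine le_trans (Finset.sum_le_sum_of_subset (t := (P r ∪ Q r) ∪ S 1) ?_)
      (Finset.sum_union_inter (s₁ := P r ∪ Q r) (s₂ := S 1) (f := D) ▸ Nat.le_add_right _ _)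
    intro u hu
    rcases lt_trichotomy u.im 0 with h | h | h
    · simp [hQ, hu, h]
    · refine Finset.mem_union_right _ ((memS 1 u).2 ⟨((memS r u).1 hu).1, ?_⟩)
      refine (norm_le_abs_re_add_abs_im u).trans ?_
      rw [h, abs_zero]
      linarith [hre u ((memS r u).1 hu).1]
    · simp [hP, hu, h]
  have hN : zeroOrdinateCount x = ∑ u ∈ (finite_nontrivialZero_im_le x).toFinset.image
      (fun i => i.1 - 1 / 2), D u := by
    rw [Finset.sum_image (fun i _ j _ h => Subtype.ext (sub_left_injective h)), zeroOrdinateCount]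
    refine Finset.sum_congr rfl fun i _ => ?_
    obtain ⟨⟨hz, h0, h1⟩, him⟩ := i.2
    rw [hD, analyticOrderNatAt_centeredXi]
    · congr 1; ring
    · simp only [sub_re, abs_lt]
      norm_num
      constructor <;> linarith
  constructor
  · refine (hup x).trans ?_
    gcongr
    rw [hN]
    refine Finset.sum_le_sum_of_subset fun u hu => ?_
    simp only [hP, Finset.mem_filter, memS] at hu
    obtain ⟨⟨hu0, hux⟩, him⟩ := hu
    have hr := abs_lt.1 (hre u hu0)
    have hz : riemannZeta (1 / 2 + u) = 0 := by
      have h0 := centeredXi_eq_zero_of_analyticOrderNatAt_ne_zero hu0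
      have h1 : u ≠ 1 / 2 := by rintro rfl; simp at him
      have h2 : u ≠ -(1 / 2) := by rintro rfl; simp at him
      have hg := Gammaℝ_half_add_ne_zero (w := u) (by linarith)
      rw [centeredXi_eq h1 h2 hg] at h0
      have hq : u ^ 2 - 1 / 4 ≠ 0 := by
        have : u ^ 2 - 1 / 4 = (u - 1 / 2) * (u - -(1 / 2)) := by ring
        rw [this]
        exact mul_ne_zero (sub_ne_zero.2 h1) (sub_ne_zero.2 h2)
      exact (mul_eq_zero.1 h0).resolve_left (mul_ne_zero hq hg)
    have him' : (1 / 2 + u : ℂ).im = u.im := by simp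
    have hre' : (1 / 2 + u : ℂ).re = 1 / 2 + u.re := by simp
    refine Finset.mem_image.2 ⟨⟨1 / 2 + u, ⟨hz, ?_, ?_⟩, ?_⟩, ?_, ?_⟩
    · rw [hre']; linarith
    · rw [hre']; linarith
    · rwa [him']
    · simp only [Finite.mem_toFinset, mem_ofPred_eq, him']
      exact ((le_abs_self _).trans (abs_im_le_norm u)).trans hux
    · ring
  · refine le_trans ?_ (hlow (x + 1 / 2))
    gcongr
    rw [hN]
    refine Finset.sum_le_sum_of_ne_zero fun u hu hu0 => ?_
    obtain ⟨i, hi, rfl⟩ := Finset.mem_image.1 hu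
    simp only [Finite.mem_toFinset, mem_ofPred_eq] at hi
    have him := i.2.2
    have him' : (i.1 - 1 / 2 : ℂ).im = i.1.im := by simp
    simp only [hP, Finset.mem_filter, memS]
    refine ⟨⟨hu0, (norm_le_abs_re_add_abs_im _).trans ?_⟩, by rwa [him']⟩
    rw [him', abs_of_pos him]
    linarith [hre _ hu0]

lemma exists_abs_zeroOrdinateCount_sub_le : ∃ a b C : ℝ, ∀ x : ℝ, 2 ≤ x →
    |zeroOrdinateCount x - (a * (x * Real.log x) + b * x)| ≤ C * Real.log x := by
  obtain ⟨a, b, C, h⟩ := exists_abs_zeroCount_centeredXi_sub_le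
  have hl2 : 0 < Real.log 2 := Real.log_pos (by norm_num)
  have hC0 : 0 ≤ C := by
    have h8 := (abs_nonneg _).trans (h 8 le_rfl)
    exact nonneg_of_mul_nonneg_left h8 (Real.log_pos (by norm_num))
  set K₁ : ℝ := (12 * |a| + |b| + 2 * C + zeroCount centeredXi 1 / Real.log 2) / 2 with hK₁
  set K₂ : ℝ := (zeroOrdinateCount 8 + |a / 2| * (8 * Real.log 8) + |b / 2| * 8) / Real.log 2 with hK₂
  have hK₁0 : 0 ≤ K₁ := by positivity
  have hK₂0 : 0 ≤ K₂ := by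
    have : 0 ≤ Real.log 8 := Real.log_nonneg (by norm_num)
    positivity
  refine ⟨a / 2, b / 2, K₁ + K₂, fun x hx => ?_⟩
  have hlx : Real.log 2 ≤ Real.log x := Real.log_le_log (by norm_num) hx
  have hlx0 : 0 < Real.log x := hl2.trans_le hlx
  rcases lt_or_ge x 8 with hx8 | hx8
  · have h1 : (zeroOrdinateCount x : ℝ) ≤ zeroOrdinateCount 8 := by
      exact_mod_cast zeroOrdinateCount_mono hx8.le
    have h2 : x * Real.log x ≤ 8 * Real.log 8 := by
      gcongr
    have h3 : |(zeroOrdinateCount x : ℝ) - (a / 2 * (x * Real.log x) + b / 2 * x)| ≤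
        K₂ * Real.log 2 := by
      calc _ ≤ |(zeroOrdinateCount x : ℝ)| + (|a / 2 * (x * Real.log x)| + |b / 2 * x|) :=
            (abs_sub _ _).trans (by gcongr; exact abs_add_le _ _)
        _ ≤ zeroOrdinateCount 8 + |a / 2| * (8 * Real.log 8) + |b / 2| * 8 := by
            rw [abs_mul, abs_mul (b / 2), Nat.abs_cast, abs_of_pos (by positivity : 0 < x * Real.log x),
              abs_of_pos (by positivity : 0 < x), add_assoc]
            gcongr
        _ = _ := by rw [hK₂]; field_simp
    refine h3.trans ?_
    calc K₂ * Real.log 2 ≤ K₂ * Real.log x := by gcongr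
      _ ≤ _ := by gcongr; linarith
  · obtain ⟨hA, hB⟩ := two_mul_zeroOrdinateCount_bounds x
    have hA' : (zeroCount centeredXi x : ℝ) ≤ 2 * zeroOrdinateCount x + zeroCount centeredXi 1 := by
      exact_mod_cast hA
    have hB' : (2 * zeroOrdinateCount x : ℝ) ≤ zeroCount centeredXi (x + 1 / 2) := by
      exact_mod_cast hB
    have e1 := abs_le.1 (h x hx8)
    have e2 := abs_le.1 (h (x + 1 / 2) (by linarith))
    have e3 := abs_mul_log_sub_mul_log_le (x := x) (y := x + 1 / 2) hx8 (by linarith) (by linarith)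
    have e4 : Real.log (x + 1 / 2) ≤ 2 * Real.log x := by
      rw [← Real.log_rpow (by linarith)]
      refine Real.log_le_log (by linarith) ?_
      norm_num
      nlinarith
    have e5 : (zeroCount centeredXi 1 : ℝ) ≤ zeroCount centeredXi 1 / Real.log 2 * Real.log x := by
      rw [div_mul_eq_mul_div, le_div_iff₀ hl2]
      gcongr
    have e6 : |a * ((x + 1 / 2) * Real.log (x + 1 / 2) - x * Real.log x)| ≤ |a| * (12 * Real.log x) := by
      rw [abs_mul]; gcongr
    have e7 : b * (1 / 2) ≤ |b| * Real.log x := by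
      have : (1 : ℝ) / 2 ≤ Real.log x := by linarith [Real.log_two_gt_d9]
      calc b * (1 / 2) ≤ |b| * (1 / 2) := by gcongr; exact le_abs_self b
        _ ≤ _ := by gcongr
    have e6' := (abs_le.1 e6).2
    have e8 : C * Real.log (x + 1 / 2) ≤ C * (2 * Real.log x) := by gcongr
    have e9 : 0 ≤ |a| * Real.log x := by positivity
    have e10 : 0 ≤ |b| * Real.log x := by positivity
    have e11 : 0 ≤ K₂ * Real.log x := by positivity
    have e12 : 0 ≤ C * Real.log x := by positivity
    have e13 : (0 : ℝ) ≤ zeroCount centeredXi 1 / Real.log 2 * Real.log x := by positivity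
    have hK : K₁ * Real.log x = (12 * (|a| * Real.log x) + |b| * Real.log x + 2 * (C * Real.log x) +
      zeroCount centeredXi 1 / Real.log 2 * Real.log x) / 2 := by rw [hK₁]; ring
    rw [abs_le, add_mul, hK]
    constructor <;> nlinarith

lemma integral_gaussian_mul_norm_sq_le {α : Type*} [MeasurableSpace α] (μ : Measure α) [SFinite μ]
    {f : α → ℂ} {φ : α → ℝ} (hf : Integrable f μ) (hφ : Measurable φ) {δ : ℝ} (hδ : 0 < δ) :
    Integrable (fun t : ℝ => Real.exp (-δ * t ^ 2) * ‖∫ a, f a * cexp (-(t * φ a) * I) ∂μ‖ ^ 2) ∧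
    ∫ t : ℝ, Real.exp (-δ * t ^ 2) * ‖∫ a, f a * cexp (-(t * φ a) * I) ∂μ‖ ^ 2 ≤
      √(π / δ) * ∫ p : α × α, ‖f p.1‖ * ‖f p.2‖ * Real.exp (-(φ p.1 - φ p.2) ^ 2 / (4 * δ))
        ∂(μ.prod μ) := by
  set H : ℝ → α × α → ℂ := fun t p => (Real.exp (-δ * t ^ 2) : ℂ) * (f p.1 * (starRingEnd ℂ) (f p.2)) *
    cexp (-(t * (φ p.1 - φ p.2) : ℝ) * I) with hH
  have hconj : Integrable (fun a => (starRingEnd ℂ) (f a)) μ := by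
    simpa using (conjCLE : ℂ →L[ℝ] ℂ).integrable_comp hf
  have hff : Integrable (fun p : α × α => f p.1 * (starRingEnd ℂ) (f p.2)) (μ.prod μ) :=
    hf.mul_prod hconj
  have hgauss : Integrable (fun t : ℝ => (Real.exp (-δ * t ^ 2) : ℂ)) :=
    (integrable_exp_neg_mul_sq hδ).ofReal
  have h_int : Integrable (Function.uncurry H) (volume.prod (μ.prod μ)) := by
    have h0 := hgauss.mul_prod hff
    have hmeas : Measurable (fun q : ℝ × (α × α) =>
        cexp (-(q.1 * (φ q.2.1 - φ q.2.2) : ℝ) * I)) := by fun_prop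
    refine (h0.bdd_mul (c := 1) hmeas.aestronglyMeasurable (.of_forall fun q => ?_)).congr
      (.of_forall fun q => ?_)
    · rw [← ofReal_neg, norm_exp_ofReal_mul_I]
    · simp only [hH, Function.uncurry]
      ring
  have hpt (t : ℝ) : ((Real.exp (-δ * t ^ 2) * ‖∫ a, f a * cexp (-(t * φ a) * I) ∂μ‖ ^ 2 : ℝ) : ℂ) =
      ∫ p, H t p ∂(μ.prod μ) := by
    rw [ofReal_mul, ofReal_pow, ← Complex.mul_conj', ← integral_conj, ← integral_prod_mul,
      ← integral_const_mul]
    refine integral_congr_ae (.of_forall fun p => ?_)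
    simp only [hH, map_mul, ← Complex.exp_conj, conj_ofReal, conj_I, map_neg]
    have : cexp (-(t * (φ p.1 - φ p.2) : ℝ) * I) =
        cexp (-(t * φ p.1) * I) * cexp (-(t * φ p.2) * -I) := by
      rw [← Complex.exp_add]
      congr 1
      push_cast
      ring
    rw [this]
    ring
  have h_int' := h_int.integral_prod_left
  have hre : Integrable (fun t : ℝ =>
      Real.exp (-δ * t ^ 2) * ‖∫ a, f a * cexp (-(t * φ a) * I) ∂μ‖ ^ 2) := by
    refine h_int'.re.congr (.of_forall fun t => ?_)
    change (∫ p, H t p ∂(μ.prod μ)).re = _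
    rw [← hpt, ofReal_re]
  refine ⟨hre, ?_⟩
  have hinner (p : α × α) : ∫ t : ℝ, H t p = (f p.1 * (starRingEnd ℂ) (f p.2)) *
      ((√(π / δ) * Real.exp (-(φ p.1 - φ p.2) ^ 2 / (4 * δ)) : ℝ) : ℂ) := by
    have h := fourierIntegral_gaussian (b := (δ : ℂ)) (by simpa using hδ)
      (-(φ p.1 - φ p.2 : ℝ) : ℂ)
    have h2 : ((π : ℂ) / δ) ^ (1 / 2 : ℂ) = ((√(π / δ) : ℝ) : ℂ) := by
      rw [Real.sqrt_eq_rpow, ofReal_cpow (by positivity)]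
      push_cast
      rfl
    rw [h2] at h
    have h3 : ∫ t : ℝ, H t p = ∫ t : ℝ, (f p.1 * (starRingEnd ℂ) (f p.2)) *
        (cexp (I * (-(φ p.1 - φ p.2 : ℝ) : ℂ) * t) * cexp (-δ * t ^ 2)) := by
      refine integral_congr_ae (.of_forall fun t => ?_)
      simp only [hH]
      have : cexp (-(t * (φ p.1 - φ p.2) : ℝ) * I) = cexp (I * (-(φ p.1 - φ p.2 : ℝ) : ℂ) * t) := by
        congr 1
        push_cast
        ring
      rw [this]
      push_cast
      ring
    rw [h3, integral_const_mul, h]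
    push_cast
    ring_nf
  have hswap : ((∫ t : ℝ, Real.exp (-δ * t ^ 2) * ‖∫ a, f a * cexp (-(t * φ a) * I) ∂μ‖ ^ 2 : ℝ) : ℂ) =
      ∫ p, (f p.1 * (starRingEnd ℂ) (f p.2)) *
      ((√(π / δ) * Real.exp (-(φ p.1 - φ p.2) ^ 2 / (4 * δ)) : ℝ) : ℂ) ∂(μ.prod μ) := by
    rw [← integral_complex_ofReal]
    simp_rw [hpt]
    rw [integral_integral_swap h_int]
    simp_rw [hinner]
  refine (le_abs_self _).trans ?_
  rw [← Real.norm_eq_abs, ← Complex.norm_real, hswap, ← integral_const_mul]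
  refine (norm_integral_le_integral_norm _).trans (le_of_eq ?_)
  refine integral_congr_ae (.of_forall fun p => ?_)
  simp only [norm_mul, RCLike.norm_conj, Complex.norm_real]
  rw [Real.norm_of_nonneg (Real.sqrt_nonneg _), Real.norm_of_nonneg (Real.exp_pos _).le]
  ring

lemma integral_interval_norm_sq_le {α : Type*} [MeasurableSpace α] (μ : Measure α) [SFinite μ]
    {f : α → ℂ} {φ : α → ℝ} (hf : Integrable f μ) (hφ : Measurable φ) {T : ℝ} (hT : 1 ≤ T) :
    ∫ t in (1 : ℝ)..T, ‖∫ a, f a * cexp (-(t * φ a) * I) ∂μ‖ ^ 2 ≤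
      Real.exp 1 * (√π * T) * ∫ p : α × α, ‖f p.1‖ * ‖f p.2‖ *
        Real.exp (-(T * (φ p.1 - φ p.2)) ^ 2 / 4) ∂(μ.prod μ) := by
  have hT0 : 0 < T := by linarith
  obtain ⟨hi, hle⟩ := integral_gaussian_mul_norm_sq_le μ hf hφ (δ := 1 / T ^ 2) (by positivity)
  have h1 : √(π / (1 / T ^ 2)) = √π * T := by
    rw [div_div_eq_mul_div, div_one, Real.sqrt_mul Real.pi_pos.le, Real.sqrt_sq hT0.le]
  have h2 (p : α × α) : -(φ p.1 - φ p.2) ^ 2 / (4 * (1 / T ^ 2)) =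
      -(T * (φ p.1 - φ p.2)) ^ 2 / 4 := by
    field_simp
  simp_rw [h1, h2] at hle
  rw [intervalIntegral.integral_of_le hT, mul_assoc]
  refine le_trans ?_ (mul_le_mul_of_nonneg_left hle (Real.exp_pos 1).le)
  rw [← integral_const_mul]
  have hi' := hi.const_mul (Real.exp 1)
  refine le_trans ?_ (setIntegral_le_integral (s := Ioc 1 T) hi'
    (.of_forall fun t => by simp only [Pi.zero_apply]; positivity))
  refine integral_mono_of_nonneg (.of_forall fun t => by simp only [Pi.zero_apply]; positivity)
    hi'.integrableOn ?_
  filter_upwards [ae_restrict_mem measurableSet_Ioc] with t ht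
  rw [← mul_assoc, ← Real.exp_add]
  refine le_mul_of_one_le_left (by positivity) (Real.one_le_exp ?_)
  have : t ^ 2 / T ^ 2 ≤ 1 := by
    rw [div_le_one (by positivity)]
    nlinarith [ht.1, ht.2]
  have e : -(1 / T ^ 2) * t ^ 2 = -(t ^ 2 / T ^ 2) := by ring
  rw [e]
  linarith

lemma integral_interval_norm_sq_le_of_real {h : ℝ → ℂ} (hh : Integrable h)
    (hh2 : Integrable (fun u => ‖h u‖ ^ 2)) {T : ℝ} (hT : 1 ≤ T) :
    ∫ t in (1 : ℝ)..T, ‖∫ u, h u * cexp (-(t * u) * I)‖ ^ 2 ≤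
      Real.exp 1 * (2 * π) * ∫ u, ‖h u‖ ^ 2 := by
  have hT0 : 0 < T := by linarith
  refine (integral_interval_norm_sq_le volume hh measurable_id hT).trans ?_
  have hker : Integrable (fun w : ℝ => Real.exp (-(T ^ 2 / 4) * w ^ 2)) :=
    integrable_exp_neg_mul_sq (by positivity)
  have hprod : Integrable (fun p : ℝ × ℝ => ‖h p.1‖ ^ 2 * Real.exp (-(T ^ 2 / 4) * (p.1 - p.2) ^ 2))
      (volume.prod volume) := by
    have h1 := hh2.mul_prod hker
    refine ((measurePreserving_prod_neg_add (volume : Measure ℝ)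
      (volume : Measure ℝ)).integrable_comp_of_integrable h1).congr (.of_forall fun p => ?_)
    simp only [Function.comp]
    congr 2
    ring
  have hval : ∫ p : ℝ × ℝ, ‖h p.1‖ ^ 2 * Real.exp (-(T ^ 2 / 4) * (p.1 - p.2) ^ 2) =
      (∫ u, ‖h u‖ ^ 2) * (2 * √π / T) := by
    rw [Measure.volume_eq_prod, integral_prod _ hprod, ← integral_mul_const]
    refine integral_congr_ae (.of_forall fun u => ?_)
    simp only
    rw [integral_const_mul, integral_sub_left_eq_self (fun w => Real.exp (-(T ^ 2 / 4) * w ^ 2)),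
      integral_gaussian]
    congr 1
    rw [div_div_eq_mul_div, Real.sqrt_div (by positivity), Real.sqrt_sq hT0.le,
      Real.sqrt_mul Real.pi_pos.le, show (4 : ℝ) = 2 ^ 2 by norm_num, Real.sqrt_sq (by norm_num)]
    ring
  have hprod' : Integrable (fun p : ℝ × ℝ => ‖h p.2‖ ^ 2 * Real.exp (-(T ^ 2 / 4) * (p.1 - p.2) ^ 2))
      (volume.prod volume) := by
    refine hprod.swap.congr (.of_forall fun p => ?_)
    simp only [Function.comp, Prod.fst_swap, Prod.snd_swap]
    rw [← neg_sub p.1 p.2, neg_sq]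
  have hval' : ∫ p : ℝ × ℝ, ‖h p.2‖ ^ 2 * Real.exp (-(T ^ 2 / 4) * (p.1 - p.2) ^ 2) =
      (∫ u, ‖h u‖ ^ 2) * (2 * √π / T) := by
    rw [← hval, Measure.volume_eq_prod, ← integral_prod_swap]
    refine integral_congr_ae (.of_forall fun p => ?_)
    simp only [Prod.fst_swap, Prod.snd_swap]
    rw [← neg_sub p.1 p.2, neg_sq]
  have hle : ∫ p : ℝ × ℝ, ‖h p.1‖ * ‖h p.2‖ * Real.exp (-(T * (id p.1 - id p.2)) ^ 2 / 4)
      ∂(volume.prod volume) ≤ (∫ u, ‖h u‖ ^ 2) * (2 * √π / T) := by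
    calc _ ≤ ∫ p : ℝ × ℝ, (1 / 2 * (‖h p.1‖ ^ 2 * Real.exp (-(T ^ 2 / 4) * (p.1 - p.2) ^ 2)) +
          1 / 2 * (‖h p.2‖ ^ 2 * Real.exp (-(T ^ 2 / 4) * (p.1 - p.2) ^ 2))) ∂(volume.prod volume) := by
          refine integral_mono_of_nonneg (.of_forall fun p => by simp only [Pi.zero_apply]; positivity)
            ((hprod.const_mul _).add (hprod'.const_mul _)) (.of_forall fun p => ?_)
          have e : -(T * (id p.1 - id p.2)) ^ 2 / 4 = -(T ^ 2 / 4) * (p.1 - p.2) ^ 2 := by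
            simp only [id]; ring
          simp only [e]
          nlinarith [sq_nonneg (‖h p.1‖ - ‖h p.2‖), Real.exp_pos (-(T ^ 2 / 4) * (p.1 - p.2) ^ 2),
            mul_nonneg (sq_nonneg (‖h p.1‖ - ‖h p.2‖)) (Real.exp_pos (-(T ^ 2 / 4) * (p.1 - p.2) ^ 2)).le]
      _ = _ := by
          rw [integral_add (hprod.const_mul _) (hprod'.const_mul _), integral_const_mul,
            integral_const_mul, ← Measure.volume_eq_prod, hval, hval']
          ring
  calc _ ≤ Real.exp 1 * (√π * T) * ((∫ u, ‖h u‖ ^ 2) * (2 * √π / T)) := by gcongr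
    _ = Real.exp 1 * (2 * (√π * √π)) * ∫ u, ‖h u‖ ^ 2 := by field_simp
    _ = _ := by rw [Real.mul_self_sqrt Real.pi_pos.le]

lemma integral_interval_norm_sum_sq_le {ι : Type*} (S : Finset ι) (c φ : ι → ℝ) (hc : ∀ i, 0 ≤ c i)
    {T : ℝ} (hT : 1 ≤ T) :
    ∫ t in (1 : ℝ)..T, ‖∑ i ∈ S, (c i : ℂ) * cexp (-(t * φ i) * I)‖ ^ 2 ≤
      Real.exp 1 * (√π * T) * ∑ i ∈ S, ∑ j ∈ S, c i * c j *
        Real.exp (-(T * (φ i - φ j)) ^ 2 / 4) := by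
  let _ : MeasurableSpace S := ⊤
  have : MeasurableSingletonClass S := ⟨fun _ => trivial⟩
  have h := integral_interval_norm_sq_le (Measure.count : Measure S) (f := fun i => (c i : ℂ))
    (φ := fun i => φ i) .of_finite (measurable_from_top) hT
  rw [integral_prod _ .of_finite] at h
  simp only [integral_count, Complex.norm_real, Real.norm_of_nonneg (hc _)] at h
  have e1 (t : ℝ) : ∑ i : S, (c i : ℂ) * cexp (-(t * φ i) * I) =
      ∑ i ∈ S, (c i : ℂ) * cexp (-(t * φ i) * I) :=
    Finset.sum_coe_sort S fun i => (c i : ℂ) * cexp (-(t * φ i) * I)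
  have e2 (i : ι) : ∑ j : S, c i * c j * Real.exp (-(T * (φ i - φ j)) ^ 2 / 4) =
      ∑ j ∈ S, c i * c j * Real.exp (-(T * (φ i - φ j)) ^ 2 / 4) :=
    Finset.sum_coe_sort S fun j => c i * c j * Real.exp (-(T * (φ i - φ j)) ^ 2 / 4)
  simp only [e1, e2] at h
  rwa [Finset.sum_coe_sort S
    fun i => ∑ j ∈ S, c i * c j * Real.exp (-(T * (φ i - φ j)) ^ 2 / 4)] at h

/-- The nontrivial zeros of the Riemann zeta function in the upper half plane. -/
abbrev UpperZero : Type := {ρ : ℂ // IsNontrivialZero ρ ∧ 0 < ρ.im}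

instance : Countable UpperZero := by
  have h : ({ρ : ℂ | IsNontrivialZero ρ ∧ 0 < ρ.im}).Countable :=
    countable_riemannZetaZeros.mono fun ρ hρ => mem_riemannZetaZeros.2 hρ.1.1
  exact h.to_subtype

lemma exists_zeroOrdinateCount_le_rpow {ε : ℝ} (hε : 0 < ε) : ∃ C : ℝ, ∀ x : ℝ, 2 ≤ x →
    (zeroOrdinateCount x : ℝ) ≤ C * x ^ (1 + ε) := by
  obtain ⟨a, b, C, h⟩ := exists_abs_zeroOrdinateCount_sub_le
  refine ⟨|a| / ε + |b| + |C| / ε, fun x hx => ?_⟩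
  have hx0 : 0 < x := by linarith
  have h1 := (abs_le.1 (h x hx)).2
  have h2 : Real.log x ≤ x ^ ε / ε := Real.log_le_rpow_div hx0.le hε
  have h3 : 0 ≤ Real.log x := Real.log_nonneg (by linarith)
  have h4 : 1 ≤ x ^ ε := Real.one_le_rpow (by linarith) hε.le
  have h5 : a * (x * Real.log x) ≤ |a| * (x * (x ^ ε / ε)) := by
    calc _ ≤ |a| * (x * Real.log x) := by gcongr; exact le_abs_self a
      _ ≤ _ := by gcongr
  have h6 : b * x ≤ |b| * (x * x ^ ε) := by
    calc _ ≤ |b| * (x * 1) := by rw [mul_one]; gcongr; exact le_abs_self b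
      _ ≤ _ := by gcongr
  have h7 : C * Real.log x ≤ |C| * (x * (x ^ ε / ε)) := by
    calc _ ≤ |C| * (1 * Real.log x) := by rw [one_mul]; gcongr; exact le_abs_self C
      _ ≤ _ := by gcongr; linarith
  rw [Real.rpow_add hx0, Real.rpow_one]
  calc (zeroOrdinateCount x : ℝ) ≤ |a| * (x * (x ^ ε / ε)) + |b| * (x * x ^ ε) +
        |C| * (x * (x ^ ε / ε)) := by linarith
    _ = _ := by ring

lemma measurable_zeroOrdinateCount : Measurable (fun x => (zeroOrdinateCount x : ℝ)) := by
  have : Monotone (fun x => (zeroOrdinateCount x : ℝ)) := fun x y h =>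
    Nat.cast_le.2 (zeroOrdinateCount_mono h)
  exact this.measurable

lemma sum_zetaMult_indicator_le (u : Finset UpperZero) (x : ℝ) :
    ∑ i ∈ u, (if i.1.im ≤ x then (zetaMult i.1 : ℝ) else 0) ≤ zeroOrdinateCount x := by
  rw [zeroOrdinateCount, Nat.cast_sum, ← Finset.sum_filter]
  refine Finset.sum_le_sum_of_subset_of_nonneg (fun i hi => ?_) fun _ _ _ => Nat.cast_nonneg _
  simpa using (Finset.mem_filter.1 hi).2

lemma hasSum_max_cpow {X : ℝ} (hX : 2 ≤ X) {s : ℂ} (hs : 1 < s.re) :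
    HasSum (fun i : UpperZero => (zetaMult i.1 : ℂ) * ((max i.1.im X : ℝ) : ℂ) ^ (-s))
      (s * ∫ x in Ioi X, (zeroOrdinateCount x : ℂ) * (x : ℂ) ^ (-s - 1)) := by
  have hX0 : 0 < X := by linarith
  have hs0 : s ≠ 0 := by rintro rfl; simp at hs; linarith
  set F : UpperZero → ℝ → ℂ := fun i x => (Ici i.1.im).indicator
    (fun x => (zetaMult i.1 : ℂ) * (x : ℂ) ^ (-s - 1)) x with hF
  have hpow (Y : ℝ) (hY : 0 < Y) : IntegrableOn (fun x : ℝ => (x : ℂ) ^ (-s - 1)) (Ioi Y) :=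
    integrableOn_Ioi_cpow_of_lt (by simp; linarith) hY
  have hFint (i : UpperZero) : IntegrableOn (F i) (Ioi X) :=
    ((hpow X hX0).const_mul _).indicator measurableSet_Ici
  have hFval (i : UpperZero) : ∫ x in Ioi X, F i x =
      (zetaMult i.1 : ℂ) * ((max i.1.im X : ℝ) : ℂ) ^ (-s) / s := by
    have hset : (∫ x in Ioi X ∩ Ici i.1.im, (zetaMult i.1 : ℂ) * (x : ℂ) ^ (-s - 1)) =
        ∫ x in Ioi (max i.1.im X), (zetaMult i.1 : ℂ) * (x : ℂ) ^ (-s - 1) := by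
      rcases le_or_gt i.1.im X with h | h
      · rw [max_eq_right h, inter_eq_left.2 (Ioi_subset_Ici h)]
      · rw [max_eq_left h.le, inter_eq_right.2 (Ici_subset_Ioi.2 h),
          integral_Ici_eq_integral_Ioi]
    rw [hF, setIntegral_indicator measurableSet_Ici, hset, integral_const_mul,
      integral_Ioi_cpow_of_lt (by simp; linarith) (lt_max_of_lt_right hX0)]
    have : -s - 1 + 1 = -s := by ring
    rw [this, neg_div_neg_eq, mul_div_assoc]
  obtain ⟨C, hC⟩ := exists_zeroOrdinateCount_le_rpow (ε := (s.re - 1) / 2) (by linarith)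
  have hNint : IntegrableOn (fun x : ℝ => (zeroOrdinateCount x : ℂ) * (x : ℂ) ^ (-s - 1)) (Ioi X) := by
    refine integrableOn_Ioi_mul_cpow (C := C) (ε := 1 + (s.re - 1) / 2) hX0 ?_ (fun x hx => ?_)
      (by linarith)
    · exact_mod_cast measurable_ofReal.comp measurable_zeroOrdinateCount
    · simpa using hC x (hX.trans (le_of_lt hx))
  have hnorm (i : UpperZero) (x : ℝ) : ‖F i x‖ =
      (if i.1.im ≤ x then (zetaMult i.1 : ℝ) else 0) * ‖(x : ℂ) ^ (-s - 1)‖ := by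
    simp only [hF, indicator, mem_Ici]
    split_ifs <;> simp
  have hsummable : Summable fun i => ∫ x in Ioi X, ‖F i x‖ := by
    refine summable_of_sum_le (c := ∫ x in Ioi X, ‖(zeroOrdinateCount x : ℂ) * (x : ℂ) ^ (-s - 1)‖)
      (fun i => by positivity) fun u => ?_
    rw [← integral_finsetSum _ fun i _ => (hFint i).norm]
    refine integral_mono (integrable_finsetSum _ fun i _ => (hFint i).norm) hNint.norm fun x => ?_
    simp only [hnorm, norm_mul, Complex.norm_natCast, ← Finset.sum_mul]
    gcongr
    exact sum_zetaMult_indicator_le u x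
  have htsum (x : ℝ) : ∑' i, F i x = (zeroOrdinateCount x : ℂ) * (x : ℂ) ^ (-s - 1) := by
    rw [tsum_eq_sum (s := (finite_nontrivialZero_im_le x).toFinset)]
    · rw [zeroOrdinateCount, Nat.cast_sum, Finset.sum_mul]
      refine Finset.sum_congr rfl fun i hi => ?_
      simp only [Finite.mem_toFinset, mem_ofPred_eq] at hi
      simp [hF, hi]
    · intro i hi
      simp only [Finite.mem_toFinset, mem_ofPred_eq] at hi
      simp [hF, hi]
  have h := (hasSum_integral_of_summable_integral_norm hFint hsummable).mul_left s
  simp only [htsum, hFval] at h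
  refine h.congr_fun fun i => ?_
  rw [mul_div_cancel₀ _ hs0]

lemma hasSum_zetaMult_mul_cpow {X : ℝ} (hX : 2 ≤ X) {s : ℂ} (hs : 1 < s.re) :
    HasSum (fun i : UpperZero => (zetaMult i.1 : ℂ) * (i.1.im : ℂ) ^ (-s))
      (∑ i ∈ (finite_nontrivialZero_im_le X).toFinset, (zetaMult i.1 : ℂ) * (i.1.im : ℂ) ^ (-s) -
        zeroOrdinateCount X * (X : ℂ) ^ (-s) +
        s * ∫ x in Ioi X, (zeroOrdinateCount x : ℂ) * (x : ℂ) ^ (-s - 1)) := by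
  have h1 := hasSum_sum_of_ne_finset_zero (L := .unconditional _) (s := (finite_nontrivialZero_im_le X).toFinset)
    (f := fun i : UpperZero => if i.1.im ≤ X then
      (zetaMult i.1 : ℂ) * (i.1.im : ℂ) ^ (-s) - (zetaMult i.1 : ℂ) * (X : ℂ) ^ (-s) else 0)
    (fun i hi => by
      simp only [Finite.mem_toFinset, mem_ofPred_eq] at hi
      simp [hi])
  have h2 := h1.add (hasSum_max_cpow hX hs)
  convert h2 using 1
  · ext i
    split_ifs with h
    · rw [max_eq_right h]; ring
    · rw [max_eq_left (le_of_not_ge h)]; ring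
  · congr 1
    rw [zeroOrdinateCount, Nat.cast_sum, Finset.sum_mul, ← Finset.sum_sub_distrib]
    refine Finset.sum_congr rfl fun i hi => ?_
    simp only [Finite.mem_toFinset, mem_ofPred_eq] at hi
    simp [hi]

lemma summable_zetaMult_mul_rpow {σ : ℝ} (hσ : 1 < σ) :
    Summable (fun i : UpperZero => (zetaMult i.1 : ℝ) * i.1.im ^ (-σ)) := by
  have h := (hasSum_zetaMult_mul_cpow (X := 2) le_rfl (s := σ) (by simpa using hσ)).summable.norm
  refine h.congr fun i => ?_
  rw [norm_mul, Complex.norm_natCast, Complex.norm_cpow_eq_rpow_re_of_pos i.2.2]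
  simp

lemma integral_Ioi_log_mul_cpow {X : ℝ} (hX : 2 ≤ X) {s : ℂ} (hs : 1 < s.re) :
    IntegrableOn (fun x : ℝ => ((x * Real.log x : ℝ) : ℂ) * (x : ℂ) ^ (-s - 1)) (Ioi X) ∧
    ∫ x in Ioi X, ((x * Real.log x : ℝ) : ℂ) * (x : ℂ) ^ (-s - 1) =
      (X : ℂ) ^ (1 - s) * (Real.log X / (s - 1) + 1 / (s - 1) ^ 2) := by
  have hX0 : 0 < X := by linarith
  have hs1 : s - 1 ≠ 0 := by
    intro h
    have := congrArg Complex.re h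
    simp at this
    linarith
  set ε : ℝ := (s.re - 1) / 2 with hε
  have hε0 : 0 < ε := by rw [hε]; linarith
  have h_int : IntegrableOn (fun x : ℝ => ((x * Real.log x : ℝ) : ℂ) * (x : ℂ) ^ (-s - 1)) (Ioi X) := by
    refine integrableOn_Ioi_mul_cpow (C := 1 / ε) (ε := 1 + ε) hX0
      (measurable_ofReal.comp (by fun_prop)) (fun x hx => ?_) (by rw [hε]; linarith)
    have hx0 : 0 < x := hX0.trans hx
    have hlog : 0 ≤ Real.log x := Real.log_nonneg (by linarith)
    rw [Function.comp_apply, Complex.norm_real, Real.norm_of_nonneg (by positivity), Real.rpow_add hx0, Real.rpow_one]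
    have := Real.log_le_rpow_div hx0.le hε0
    calc x * Real.log x ≤ x * (x ^ ε / ε) := by gcongr
      _ = _ := by ring
  refine ⟨h_int, ?_⟩
  set f : ℝ → ℂ := fun x => -((x : ℂ) ^ (1 - s) * (Real.log x / (s - 1) + 1 / (s - 1) ^ 2)) with hf
  have hderiv (x : ℝ) (hx : x ∈ Ici X) :
      HasDerivAt f (((x * Real.log x : ℝ) : ℂ) * (x : ℂ) ^ (-s - 1)) x := by
    have hx0 : 0 < x := hX0.trans_le hx
    have hxc : (x : ℂ) ≠ 0 := by exact_mod_cast hx0.ne'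
    have h1 : HasDerivAt (fun y : ℝ => (y : ℂ) ^ (1 - s)) ((1 - s) * (x : ℂ) ^ (1 - s - 1)) x := by
      simpa using ((hasDerivAt_id (x : ℂ)).cpow_const (c := 1 - s)
        (by simp [slitPlane, hx0])).comp_ofReal
    have h2 : HasDerivAt (fun y : ℝ => ((Real.log y : ℝ) : ℂ)) ((x⁻¹ : ℝ) : ℂ) x :=
      (Real.hasDerivAt_log hx0.ne').ofReal_comp
    have h3 := (h1.mul ((h2.div_const (s - 1)).add_const (1 / (s - 1) ^ 2))).neg
    refine h3.congr_deriv ?_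
    have e1 : (x : ℂ) ^ (1 - s - 1) = x * (x : ℂ) ^ (-s - 1) := by
      rw [show 1 - s - 1 = 1 + (-s - 1) by ring, cpow_add _ _ hxc, cpow_one]
    have e2 : (x : ℂ) ^ (1 - s) = x * (x * (x : ℂ) ^ (-s - 1)) := by
      rw [show 1 - s = 1 + (1 + (-s - 1)) by ring, cpow_add _ _ hxc, cpow_add _ _ hxc, cpow_one]
    rw [e1, e2]
    push_cast
    field_simp
    ring
  have hlim : Tendsto f atTop (nhds 0) := by
    have hb : ∀ᶠ x in atTop, ‖f x‖ ≤ (1 / ε / ‖s - 1‖ + 1 / ‖s - 1‖ ^ 2) * x ^ (-ε) := by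
      filter_upwards [eventually_ge_atTop X] with x hx
      have hx0 : 0 < x := hX0.trans_le hx
      have hlog : 0 ≤ Real.log x := Real.log_nonneg (by linarith)
      have h1 : 1 ≤ x ^ ε := Real.one_le_rpow (by linarith) hε0.le
      have h2 := Real.log_le_rpow_div hx0.le hε0
      have h3 : x ^ (1 - s.re) = x ^ (-ε) / x ^ ε := by
        rw [← Real.rpow_sub hx0]; congr 1; rw [hε]; ring
      have hxe : 0 < x ^ ε := by positivity
      rw [hf, norm_neg, norm_mul, norm_cpow_eq_rpow_re_of_pos hx0]
      simp only [sub_re, one_re]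
      have h4 : ‖(Real.log x : ℂ) / (s - 1) + 1 / (s - 1) ^ 2‖ ≤
          (1 / ε / ‖s - 1‖ + 1 / ‖s - 1‖ ^ 2) * x ^ ε := by
        refine (norm_add_le _ _).trans ?_
        rw [norm_div, norm_div, norm_pow, Complex.norm_real, Real.norm_of_nonneg hlog, norm_one, add_mul]
        have hn : 0 < ‖s - 1‖ := norm_pos_iff.2 hs1
        gcongr
        · calc Real.log x / ‖s - 1‖ ≤ (x ^ ε / ε) / ‖s - 1‖ := by gcongr
            _ = _ := by ring
        · exact le_mul_of_one_le_right (by positivity) h1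
      rw [h3]
      calc _ ≤ x ^ (-ε) / x ^ ε * ((1 / ε / ‖s - 1‖ + 1 / ‖s - 1‖ ^ 2) * x ^ ε) := by gcongr
        _ = _ := by field_simp
    refine squeeze_zero_norm' hb ?_
    rw [← mul_zero (1 / ε / ‖s - 1‖ + 1 / ‖s - 1‖ ^ 2)]
    exact (tendsto_rpow_neg_atTop hε0).const_mul _
  rw [integral_Ioi_of_hasDerivAt_of_tendsto' hderiv h_int hlim]
  simp [hf]

/-- The error term in the asymptotic formula for the number of ordinates up to `x`. -/
def zeroOrdinateError (a b x : ℝ) : ℝ := zeroOrdinateCount x - (a * (x * Real.log x) + b * x)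

lemma measurable_zeroOrdinateError (a b : ℝ) : Measurable (zeroOrdinateError a b) := by
  unfold zeroOrdinateError
  exact measurable_zeroOrdinateCount.sub (by fun_prop)

/-- The partial sum of the zeta function of ordinates, smoothed with its main and error terms. -/
def ordinateZetaApprox (a b X : ℝ) (s : ℂ) : ℂ :=
  ∑ i ∈ (finite_nontrivialZero_im_le X).toFinset, (zetaMult i.1 : ℂ) * (i.1.im : ℂ) ^ (-s) +
    (X : ℂ) ^ (1 - s) * ((a * Real.log X + b : ℝ) / (s - 1) + a * s / (s - 1) ^ 2) -
    zeroOrdinateError a b X * (X : ℂ) ^ (-s)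

lemma tsum_eq_ordinateZetaApprox_add {a b C ε : ℝ} (hε : ε ≤ 1)
    (hR : ∀ x : ℝ, 2 ≤ x → |zeroOrdinateError a b x| ≤ C * x ^ ε)
    {X : ℝ} (hX : 2 ≤ X) {s : ℂ} (hs : 1 < s.re) :
    ∑' i : UpperZero, (zetaMult i.1 : ℂ) * (i.1.im : ℂ) ^ (-s) =
      ordinateZetaApprox a b X s +
        s * ∫ x in Ioi X, (zeroOrdinateError a b x : ℂ) * (x : ℂ) ^ (-s - 1) := by
  have hX0 : 0 < X := by linarith
  have hXc : (X : ℂ) ≠ 0 := by exact_mod_cast hX0.ne'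
  have hs1 : s - 1 ≠ 0 := by
    intro h
    have := congrArg Complex.re h
    simp at this
    linarith
  rw [(hasSum_zetaMult_mul_cpow hX hs).tsum_eq]
  obtain ⟨hli, hlv⟩ := integral_Ioi_log_mul_cpow hX hs
  have hEint : IntegrableOn (fun x : ℝ => (zeroOrdinateError a b x : ℂ) * (x : ℂ) ^ (-s - 1)) (Ioi X) := by
    refine integrableOn_Ioi_mul_cpow (C := C) (ε := ε) hX0
      (measurable_ofReal.comp (measurable_zeroOrdinateError a b)) (fun x hx => ?_) (by linarith)
    rw [Function.comp_apply, Complex.norm_real]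
    exact hR x (hX.trans (le_of_lt hx))
  have hxint : IntegrableOn (fun x : ℝ => (x : ℂ) ^ (-s)) (Ioi X) :=
    integrableOn_Ioi_cpow_of_lt (by simp; linarith) hX0
  have hxv : ∫ x in Ioi X, (x : ℂ) ^ (-s) = (X : ℂ) ^ (1 - s) / (s - 1) := by
    rw [integral_Ioi_cpow_of_lt (by simp; linarith) hX0, show -s + 1 = -(s - 1) by ring,
      neg_div_neg_eq, neg_sub]
  have hsplit : ∫ x in Ioi X, (zeroOrdinateCount x : ℂ) * (x : ℂ) ^ (-s - 1) =
      (∫ x in Ioi X, (zeroOrdinateError a b x : ℂ) * (x : ℂ) ^ (-s - 1)) +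
      (a * ((X : ℂ) ^ (1 - s) * (Real.log X / (s - 1) + 1 / (s - 1) ^ 2)) +
        b * ((X : ℂ) ^ (1 - s) / (s - 1))) := by
    have hM : IntegrableOn (fun x : ℝ => (a : ℂ) * (((x * Real.log x : ℝ) : ℂ) * (x : ℂ) ^ (-s - 1)) +
        b * (x : ℂ) ^ (-s)) (Ioi X) := (hli.const_mul _).add (hxint.const_mul _)
    rw [← hlv, ← hxv, ← integral_const_mul, ← integral_const_mul,
      ← integral_add (hli.const_mul _) (hxint.const_mul _), ← integral_add hEint hM]
    refine setIntegral_congr_fun measurableSet_Ioi fun x hx => ?_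
    have hxc : (x : ℂ) ≠ 0 := by exact_mod_cast (hX0.trans hx).ne'
    have e : (x : ℂ) ^ (-s) = x * (x : ℂ) ^ (-s - 1) := by
      rw [show -s = 1 + (-s - 1) by ring, cpow_add _ _ hxc, cpow_one]
      ring_nf
    simp only [e, zeroOrdinateError]
    push_cast
    ring
  have e : (X : ℂ) ^ (1 - s) = X * (X : ℂ) ^ (-s) := by
    rw [show 1 - s = 1 + -s by ring, cpow_add _ _ hXc, cpow_one]
  have hN : (zeroOrdinateCount X : ℂ) =
      zeroOrdinateError a b X + (a * (X * Real.log X) + b * X) := by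
    rw [zeroOrdinateError]
    push_cast
    ring
  rw [hsplit, ordinateZetaApprox, hN, e]
  push_cast
  field_simp
  ring

lemma differentiableAt_ordinateZetaApprox (a b : ℝ) {X : ℝ} (hX : 0 < X) {s : ℂ} (hs : s ≠ 1) :
    DifferentiableAt ℂ (ordinateZetaApprox a b X) s := by
  have hXc : (X : ℂ) ≠ 0 := by exact_mod_cast hX.ne'
  have hs1 : s - 1 ≠ 0 := sub_ne_zero.2 hs
  unfold ordinateZetaApprox
  refine ((DifferentiableAt.fun_sum fun i _ => ?_).add (.mul ?_ ?_)).sub ?_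
  · have : (i.1.im : ℂ) ≠ 0 := by exact_mod_cast i.2.2.ne'
    exact (DifferentiableAt.const_cpow (by fun_prop) (.inl this)).const_mul _
  · exact DifferentiableAt.const_cpow (by fun_prop) (.inl hXc)
  · exact .add (.div (by fun_prop) (by fun_prop) hs1)
      (.div (by fun_prop) (by fun_prop) (pow_ne_zero 2 hs1))
  · exact (DifferentiableAt.const_cpow (by fun_prop) (.inl hXc)).const_mul _

lemma eq_ordinateZetaApprox_add {G : ℂ → ℂ}
    (hGser : ∀ s : ℂ, 1 < s.re →
      G s = ∑' ρ : UpperZero, (zetaMult ρ.1 : ℂ) * (ρ.1.im : ℂ) ^ (-s))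
    (hGan : ∀ s : ℂ, -1 < s.re → s ≠ 1 → DifferentiableAt ℂ G s)
    {a b C ε : ℝ} (hε0 : 0 < ε) (hε : ε ≤ 1)
    (hR : ∀ x : ℝ, 2 ≤ x → |zeroOrdinateError a b x| ≤ C * x ^ ε)
    {X : ℝ} (hX : 2 ≤ X) {s : ℂ} (hs : ε < s.re) (him : 0 < s.im) :
    G s = ordinateZetaApprox a b X s +
      s * ∫ x in Ioi X, (zeroOrdinateError a b x : ℂ) * (x : ℂ) ^ (-s - 1) := by
  have hX0 : 0 < X := by linarith
  set U : Set ℂ := {s | ε < s.re} ∩ {s | 0 < s.im} with hU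
  have hUo : IsOpen U := (isOpen_lt continuous_const continuous_re).inter
    (isOpen_lt continuous_const continuous_im)
  have hUc : IsPreconnected U :=
    ((convex_halfSpace_re_gt ε).inter (convex_halfSpace_im_gt 0)).isPreconnected
  have hne (z : ℂ) (hz : z ∈ U) : z ≠ 1 := by
    rintro rfl
    simpa using hz.2
  have hG : AnalyticOnNhd ℂ G U := DifferentiableOn.analyticOnNhd
    (fun z hz => (hGan z (by linarith [show ε < z.re from hz.1]) (hne z hz)).differentiableWithinAt) hUo
  have hF : AnalyticOnNhd ℂ (fun s => ordinateZetaApprox a b X s +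
      s * ∫ x in Ioi X, (zeroOrdinateError a b x : ℂ) * (x : ℂ) ^ (-s - 1)) U := by
    refine DifferentiableOn.analyticOnNhd (fun z hz => DifferentiableAt.differentiableWithinAt ?_) hUo
    refine (differentiableAt_ordinateZetaApprox a b hX0 (hne z hz)).add (differentiableAt_id.mul ?_)
    refine differentiableAt_integral_Ioi_mul_cpow (C := C) (ε := ε) hX0
      (measurable_ofReal.comp (measurable_zeroOrdinateError a b)) (fun x hx => ?_) hz.1
    rw [Function.comp_apply, Complex.norm_real]
    exact hR x (hX.trans (le_of_lt hx))
  have h0 : (2 + I : ℂ) ∈ U := by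
    constructor
    · change ε < (2 + I : ℂ).re
      simp; linarith
    · change 0 < (2 + I : ℂ).im
      simp
  refine hG.eqOn_of_preconnected_of_eventuallyEq hF hUc h0 ?_ ⟨hs, him⟩
  have hmem : {z : ℂ | 1 < z.re} ∈ nhds (2 + I) :=
    (isOpen_lt continuous_const continuous_re).mem_nhds (by simp)
  filter_upwards [hmem] with z hz
  rw [hGser z hz]
  exact tsum_eq_ordinateZetaApprox_add hε hR hX hz

lemma exists_sum_zetaMult_unit_interval_le {ε : ℝ} (hε : 0 < ε) : ∃ D : ℝ, ∀ (u : Finset UpperZero) (x : ℝ),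
    ∑ i ∈ u, (if i.1.im ≤ x ∧ x < i.1.im + 1 then (zetaMult i.1 : ℝ) else 0) ≤ D * (1 + |x|) ^ ε := by
  obtain ⟨a, b, C, h⟩ := exists_abs_zeroOrdinateCount_sub_le
  have hdiff (u : Finset UpperZero) (x : ℝ) :
      ∑ i ∈ u, (if i.1.im ≤ x ∧ x < i.1.im + 1 then (zetaMult i.1 : ℝ) else 0) +
        zeroOrdinateCount (x - 1) ≤ zeroOrdinateCount x := by
    classical
    rw [zeroOrdinateCount, zeroOrdinateCount, Nat.cast_sum, Nat.cast_sum, ← Finset.sum_filter,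
      ← Finset.sum_union]
    · refine Finset.sum_le_sum_of_subset_of_nonneg (fun i hi => ?_) fun _ _ _ => Nat.cast_nonneg _
      simp only [Finset.mem_union, Finset.mem_filter, Finite.mem_toFinset, mem_ofPred_eq] at hi ⊢
      rcases hi with hi | hi
      · exact hi.2.1
      · linarith
    · rw [Finset.disjoint_left]
      intro i hi hi'
      simp only [Finset.mem_filter, Finite.mem_toFinset, mem_ofPred_eq] at hi hi'
      linarith [hi.2.2]
  refine ⟨zeroOrdinateCount 3 + (2 * |a| + |b| + 2 * |C|) / ε, fun u x => ?_⟩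
  have hone : 1 ≤ (1 + |x|) ^ ε := Real.one_le_rpow (by linarith [abs_nonneg x]) hε.le
  have hd := hdiff u x
  rcases lt_or_ge x 3 with hx | hx
  · have h3 : (zeroOrdinateCount x : ℝ) ≤ zeroOrdinateCount 3 :=
      Nat.cast_le.2 (zeroOrdinateCount_mono hx.le)
    have h4 : (0 : ℝ) ≤ zeroOrdinateCount (x - 1) := Nat.cast_nonneg _
    calc _ ≤ (zeroOrdinateCount 3 : ℝ) * 1 := by linarith
      _ ≤ _ := by
        gcongr
        exact le_add_of_nonneg_right (by positivity)
  · have hx0 : 0 < x := by linarith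
    have e1 := (abs_le.1 (h x (by linarith))).2
    have e2 := (abs_le.1 (h (x - 1) (by linarith))).1
    have hl1 : 1 ≤ Real.log x := by
      rw [Real.le_log_iff_exp_le hx0]
      linarith [Real.exp_one_lt_d9]
    have hmono : Real.log (x - 1) ≤ Real.log x := Real.log_le_log (by linarith) (by linarith)
    have hl0 : 0 ≤ Real.log (x - 1) := Real.log_nonneg (by linarith)
    have hquot : (x - 1) * (Real.log x - Real.log (x - 1)) ≤ 1 := by
      have hx1 : 0 < x - 1 := by linarith
      rw [← Real.log_div hx0.ne' hx1.ne']
      have := Real.log_le_sub_one_of_pos (div_pos hx0 hx1)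
      calc _ ≤ (x - 1) * (x / (x - 1) - 1) := by gcongr
        _ = 1 := by field_simp; ring
    have e3 : |a * (x * Real.log x - (x - 1) * Real.log (x - 1))| ≤ |a| * (2 * Real.log x) := by
      rw [abs_mul]
      gcongr
      rw [abs_of_nonneg]
      · nlinarith
      · nlinarith
    have e4 : b ≤ |b| * Real.log x :=
      (le_abs_self b).trans (le_mul_of_one_le_right (abs_nonneg b) hl1)
    have e5 : C * Real.log x ≤ |C| * Real.log x := by gcongr; exact le_abs_self C
    have e6 : C * Real.log (x - 1) ≤ |C| * Real.log x := by
      calc _ ≤ |C| * Real.log (x - 1) := by gcongr; exact le_abs_self C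
        _ ≤ _ := by gcongr
    have e7 : Real.log x ≤ (1 + |x|) ^ ε / ε := by
      refine (Real.log_le_rpow_div hx0.le hε).trans ?_
      gcongr
      rw [abs_of_pos hx0]; linarith
    have e8 : (2 * |a| + |b| + 2 * |C|) * Real.log x ≤
        (2 * |a| + |b| + 2 * |C|) * ((1 + |x|) ^ ε / ε) := by gcongr
    have e9 : (0 : ℝ) ≤ zeroOrdinateCount 3 * (1 + |x|) ^ ε := by positivity
    have e10 : (2 * |a| + |b| + 2 * |C|) / ε * (1 + |x|) ^ ε =
      (2 * |a| + |b| + 2 * |C|) * ((1 + |x|) ^ ε / ε) := by ring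
    rw [add_mul, e10]
    nlinarith [(abs_le.1 e3).2]

lemma exp_neg_sq_le_integral (y c : ℝ) : Real.exp (-(y - c) ^ 2 / 4) ≤
    Real.exp (1 / 4) * ∫ x in Ico c (c + 1), Real.exp (-(x - y) ^ 2 / 8) := by
  have hconst : Real.exp (-(y - c) ^ 2 / 4 - 1 / 4) =
      ∫ _ in Ico c (c + 1), Real.exp (-(y - c) ^ 2 / 4 - 1 / 4) := by
    simp
  have hle : Real.exp (-(y - c) ^ 2 / 4 - 1 / 4) ≤ ∫ x in Ico c (c + 1), Real.exp (-(x - y) ^ 2 / 8) := by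
    rw [hconst]
    refine setIntegral_mono_on (integrableOn_const (by simp)) ?_ measurableSet_Ico fun x hx => ?_
    · exact (Continuous.integrableOn_Icc (by fun_prop)).mono_set Ico_subset_Icc_self
    · refine Real.exp_le_exp.2 ?_
      nlinarith [hx.1, hx.2, sq_nonneg ((y - c) - (c - x)), sq_nonneg (y - c + (x - c))]
  calc Real.exp (-(y - c) ^ 2 / 4) = Real.exp (1 / 4) * Real.exp (-(y - c) ^ 2 / 4 - 1 / 4) := by
        rw [← Real.exp_add]; congr 1; ring
    _ ≤ _ := by gcongr

lemma exists_sum_zetaMult_mul_exp_le {ε : ℝ} (hε : 0 < ε) (hε1 : ε ≤ 1) : ∃ D : ℝ,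
    ∀ (u : Finset UpperZero) (y : ℝ), 0 ≤ y →
    ∑ i ∈ u, (zetaMult i.1 : ℝ) * Real.exp (-(y - i.1.im) ^ 2 / 4) ≤ D * (1 + y) ^ ε := by
  obtain ⟨D, hD⟩ := exists_sum_zetaMult_unit_interval_le hε
  have hD0 : 0 ≤ D := by simpa using hD ∅ 0
  set k : ℝ → ℝ := fun w => (1 + |w|) * Real.exp (-w ^ 2 / 8) with hk
  have hk1 : Integrable (fun w : ℝ => Real.exp (-w ^ 2 / 8)) :=
    (integrable_exp_neg_mul_sq (b := 1 / 8) (by norm_num)).congr (.of_forall fun w => by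
      simp only; congr 1; ring)
  have hkint : Integrable k := by
    have h2 := (integrable_mul_exp_neg_mul_sq (b := 1 / 8) (by norm_num)).norm
    refine (hk1.add h2).congr (.of_forall fun w => ?_)
    simp only [hk, Pi.add_apply, norm_mul, Real.norm_eq_abs, Real.abs_exp]
    rw [show -(1 / 8) * w ^ 2 = -w ^ 2 / 8 by ring]
    ring
  refine ⟨Real.exp (1 / 4) * (D * ∫ w, k w), fun u y hy => ?_⟩
  set f : UpperZero → ℝ → ℝ := fun i x => (Ico i.1.im (i.1.im + 1)).indicator
    (fun x => (zetaMult i.1 : ℝ) * Real.exp (-(x - y) ^ 2 / 8)) x with hf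
  have hfint (i : UpperZero) : Integrable (f i) :=
    ((hk1.comp_sub_right y).const_mul _).indicator measurableSet_Ico
  have hpt (x : ℝ) : ∑ i ∈ u, f i x ≤ D * (1 + y) ^ ε * k (x - y) := by
    have e1 : ∑ i ∈ u, f i x =
        (∑ i ∈ u, (if i.1.im ≤ x ∧ x < i.1.im + 1 then (zetaMult i.1 : ℝ) else 0)) *
          Real.exp (-(x - y) ^ 2 / 8) := by
      rw [Finset.sum_mul]
      refine Finset.sum_congr rfl fun i _ => ?_
      simp only [hf, indicator, mem_Ico]
      split_ifs <;> simp
    have e2 : (1 + |x|) ^ ε ≤ (1 + y) ^ ε * (1 + |x - y|) := by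
      have h1 : 1 + |x| ≤ (1 + y) * (1 + |x - y|) := by
        have : |x| ≤ |x - y| + y := by
          calc |x| = |(x - y) + y| := by ring_nf
            _ ≤ |x - y| + |y| := abs_add_le _ _
            _ = _ := by rw [abs_of_nonneg hy]
        nlinarith [abs_nonneg (x - y)]
      calc (1 + |x|) ^ ε ≤ ((1 + y) * (1 + |x - y|)) ^ ε := by gcongr
        _ = (1 + y) ^ ε * (1 + |x - y|) ^ ε := Real.mul_rpow (by positivity) (by positivity)
        _ ≤ (1 + y) ^ ε * (1 + |x - y|) ^ (1 : ℝ) := by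
            gcongr
            linarith [abs_nonneg (x - y)]
        _ = _ := by rw [Real.rpow_one]
    rw [e1]
    calc _ ≤ D * (1 + |x|) ^ ε * Real.exp (-(x - y) ^ 2 / 8) := by gcongr; exact hD u x
      _ ≤ D * ((1 + y) ^ ε * (1 + |x - y|)) * Real.exp (-(x - y) ^ 2 / 8) := by gcongr
      _ = _ := by rw [hk]; ring
  calc _ ≤ ∑ i ∈ u, Real.exp (1 / 4) * ∫ x, f i x := by
        refine Finset.sum_le_sum fun i _ => ?_
        rw [hf, integral_indicator measurableSet_Ico, integral_const_mul, mul_left_comm]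
        gcongr
        exact exp_neg_sq_le_integral y i.1.im
    _ = Real.exp (1 / 4) * ∫ x, ∑ i ∈ u, f i x := by
        rw [integral_finsetSum _ fun i _ => hfint i, Finset.mul_sum]
    _ ≤ Real.exp (1 / 4) * ∫ x, D * (1 + y) ^ ε * k (x - y) := by
        gcongr
        · exact integrable_finsetSum _ fun i _ => hfint i
        · exact (hkint.comp_sub_right y).const_mul _
        · exact hpt
    _ = _ := by
        rw [integral_const_mul, integral_sub_right_eq_self k]
        ring

lemma abs_sub_le_mul_abs_log_sub {x y T : ℝ} (hx : 0 < x) (hy : 0 < y) (hxT : x ≤ T) (hyT : y ≤ T) :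
    |x - y| ≤ |T * (Real.log x - Real.log y)| := by
  wlog h : y ≤ x generalizing x y
  · rw [abs_sub_comm, ← abs_neg (T * _), ← mul_neg, neg_sub]
    exact this hy hx hyT hxT (le_of_not_ge h)
  have h1 : 0 ≤ Real.log x - Real.log y := sub_nonneg.2 (Real.log_le_log hy h)
  rw [abs_of_nonneg (sub_nonneg.2 h), abs_of_nonneg (mul_nonneg (hx.le.trans hxT) h1)]
  have h2 := Real.log_le_sub_one_of_pos (div_pos hy hx)
  rw [Real.log_div hy.ne' hx.ne'] at h2
  have h3 : x * (y / x - 1) = y - x := by field_simp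
  calc x - y ≤ x * (Real.log x - Real.log y) := by nlinarith
    _ ≤ _ := by gcongr

lemma sum_sum_mul_le_of_symm {ι : Type*} (S : Finset ι) (m g : ι → ℝ) (E : ι → ι → ℝ)
    (hm : ∀ i, 0 ≤ m i) (hE : ∀ i j, 0 ≤ E i j) (hsymm : ∀ i j, E i j = E j i) :
    ∑ i ∈ S, ∑ j ∈ S, (m i * g i) * (m j * g j) * E i j ≤
      ∑ i ∈ S, m i * g i ^ 2 * ∑ j ∈ S, m j * E i j := by
  have hswap : ∑ i ∈ S, ∑ j ∈ S, m i * m j * E i j * g j ^ 2 =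
      ∑ i ∈ S, ∑ j ∈ S, m i * m j * E i j * g i ^ 2 := by
    rw [Finset.sum_comm]
    refine Finset.sum_congr rfl fun i _ => Finset.sum_congr rfl fun j _ => ?_
    rw [hsymm j i]
    ring
  calc _ ≤ ∑ i ∈ S, ∑ j ∈ S, (1 / 2 * (m i * m j * E i j * g i ^ 2) +
        1 / 2 * (m i * m j * E i j * g j ^ 2)) := by
        refine Finset.sum_le_sum fun i _ => Finset.sum_le_sum fun j _ => ?_
        have h0 : 0 ≤ m i * m j * E i j := mul_nonneg (mul_nonneg (hm i) (hm j)) (hE i j)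
        nlinarith [mul_nonneg h0 (sq_nonneg (g i - g j))]
    _ = ∑ i ∈ S, ∑ j ∈ S, m i * m j * E i j * g i ^ 2 := by
        simp only [Finset.sum_add_distrib, ← Finset.mul_sum]
        rw [hswap]
        ring
    _ = _ := by
        refine Finset.sum_congr rfl fun i _ => ?_
        rw [Finset.mul_sum]
        refine Finset.sum_congr rfl fun j _ => ?_
        ring

lemma ofReal_cpow_neg_add_mul_I {x : ℝ} (hx : 0 < x) (σ t : ℝ) :
    (x : ℂ) ^ (-(σ + t * I : ℂ)) = ((x ^ (-σ) : ℝ) : ℂ) * cexp (-(t * Real.log x) * I) := by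
  have hxc : (x : ℂ) ≠ 0 := by exact_mod_cast hx.ne'
  rw [neg_add, cpow_add _ _ hxc, ofReal_cpow hx.le, ofReal_neg]
  congr 1
  rw [cpow_def_of_ne_zero hxc, ← ofReal_log hx.le]
  congr 1
  ring

lemma exists_integral_norm_sq_partial_sum_le {σ : ℝ} (hσ : 1 / 2 < σ) (hσ1 : σ ≤ 1) :
    ∃ C : ℝ, ∀ T : ℝ, 2 ≤ T → ∫ t in (1 : ℝ)..T,
      ‖∑ i ∈ (finite_nontrivialZero_im_le T).toFinset,
        (zetaMult i.1 : ℂ) * (i.1.im : ℂ) ^ (-(σ + t * I : ℂ))‖ ^ 2 ≤ C * T := by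
  set ε : ℝ := σ - 1 / 2 with hε
  have hε0 : 0 < ε := by rw [hε]; linarith
  have hε1 : ε ≤ 1 := by rw [hε]; linarith
  obtain ⟨D, hD⟩ := exists_sum_zetaMult_mul_exp_le hε0 hε1
  have hD0 : 0 ≤ D := by simpa using hD ∅ 0 le_rfl
  have hs1 := summable_zetaMult_mul_rpow (σ := 2 * σ) (by linarith)
  have hs2 := summable_zetaMult_mul_rpow (σ := 2 * σ - ε) (by rw [hε]; linarith)
  set A : ℝ := (∑' i : UpperZero, (zetaMult i.1 : ℝ) * i.1.im ^ (-(2 * σ))) +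
    ∑' i : UpperZero, (zetaMult i.1 : ℝ) * i.1.im ^ (-(2 * σ - ε)) with hA
  refine ⟨Real.exp 1 * √π * (D * A), fun T hT => ?_⟩
  set S := (finite_nontrivialZero_im_le T).toFinset with hS
  have hST (i : UpperZero) (hi : i ∈ S) : i.1.im ≤ T := by simpa [hS] using hi
  have hpos (i : UpperZero) : 0 < i.1.im := i.2.2
  have hsum (t : ℝ) : ∑ i ∈ S, (zetaMult i.1 : ℂ) * (i.1.im : ℂ) ^ (-(σ + t * I : ℂ)) =
      ∑ i ∈ S, (((zetaMult i.1 : ℝ) * i.1.im ^ (-σ) : ℝ) : ℂ) *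
        cexp (-(t * (Real.log i.1.im : ℝ)) * I) := by
    refine Finset.sum_congr rfl fun i _ => ?_
    rw [ofReal_cpow_neg_add_mul_I (hpos i)]
    push_cast
    ring
  simp only [hsum]
  refine (integral_interval_norm_sum_sq_le S (fun i => (zetaMult i.1 : ℝ) * i.1.im ^ (-σ))
    (fun i => Real.log i.1.im) (fun i => mul_nonneg (Nat.cast_nonneg _)
      (Real.rpow_nonneg (hpos i).le _)) (by linarith)).trans ?_
  have hdouble : ∑ i ∈ S, ∑ j ∈ S, (zetaMult i.1 : ℝ) * i.1.im ^ (-σ) *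
      ((zetaMult j.1 : ℝ) * j.1.im ^ (-σ)) *
        Real.exp (-(T * (Real.log i.1.im - Real.log j.1.im)) ^ 2 / 4) ≤ D * A := by
    calc _ ≤ ∑ i ∈ S, ∑ j ∈ S, (zetaMult i.1 : ℝ) * i.1.im ^ (-σ) *
          ((zetaMult j.1 : ℝ) * j.1.im ^ (-σ)) * Real.exp (-(i.1.im - j.1.im) ^ 2 / 4) := by
          refine Finset.sum_le_sum fun i hi => Finset.sum_le_sum fun j hj => ?_
          have hi0 := Real.rpow_nonneg (hpos i).le (-σ)
          have hj0 := Real.rpow_nonneg (hpos j).le (-σ)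
          have hsq := sq_le_sq.2
            (abs_sub_le_mul_abs_log_sub (hpos i) (hpos j) (hST i hi) (hST j hj))
          exact mul_le_mul_of_nonneg_left (Real.exp_le_exp.2 (by linarith)) (by positivity)
      _ ≤ ∑ i ∈ S, (zetaMult i.1 : ℝ) * (i.1.im ^ (-σ)) ^ 2 *
            ∑ j ∈ S, (zetaMult j.1 : ℝ) * Real.exp (-(i.1.im - j.1.im) ^ 2 / 4) :=
          sum_sum_mul_le_of_symm S (fun i => (zetaMult i.1 : ℝ)) (fun i => i.1.im ^ (-σ))
            (fun i j => Real.exp (-(i.1.im - j.1.im) ^ 2 / 4)) (fun i => Nat.cast_nonneg _)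
            (fun i j => (Real.exp_pos _).le) (fun i j => by rw [← neg_sub, neg_sq])
      _ ≤ ∑ i ∈ S, D * ((zetaMult i.1 : ℝ) * i.1.im ^ (-(2 * σ)) +
            (zetaMult i.1 : ℝ) * i.1.im ^ (-(2 * σ - ε))) := by
          refine Finset.sum_le_sum fun i _ => ?_
          have h1 : (i.1.im ^ (-σ)) ^ 2 = i.1.im ^ (-(2 * σ)) := by
            rw [← Real.rpow_natCast, ← Real.rpow_mul (hpos i).le]
            congr 1
            push_cast
            ring
          have h2 : (1 + i.1.im) ^ ε ≤ 1 + i.1.im ^ ε := by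
            simpa using Real.rpow_add_le_add_rpow zero_le_one (hpos i).le hε0.le hε1
          have h3 : i.1.im ^ (-(2 * σ - ε)) = i.1.im ^ (-(2 * σ)) * i.1.im ^ ε := by
            rw [← Real.rpow_add (hpos i)]
            congr 1
            ring
          have h4 := Real.rpow_nonneg (hpos i).le (-(2 * σ))
          rw [h1, h3]
          calc _ ≤ (zetaMult i.1 : ℝ) * i.1.im ^ (-(2 * σ)) * (D * (1 + i.1.im ^ ε)) := by
                gcongr
                exact (hD S i.1.im (hpos i).le).trans (by gcongr)
            _ = _ := by ring
      _ ≤ D * A := by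
          rw [← Finset.mul_sum, Finset.sum_add_distrib]
          gcongr
          rw [hA]
          gcongr
          · exact hs1.sum_le_tsum _ fun i _ =>
              mul_nonneg (Nat.cast_nonneg _) (Real.rpow_nonneg (hpos i).le _)
          · exact hs2.sum_le_tsum _ fun i _ =>
              mul_nonneg (Nat.cast_nonneg _) (Real.rpow_nonneg (hpos i).le _)
  calc _ ≤ Real.exp 1 * (√π * T) * (D * A) := by gcongr
    _ = _ := by ring

lemma integral_norm_sq_tail_le {R : ℝ → ℝ} (hRm : Measurable R) {C σ : ℝ}
    (hR : ∀ x : ℝ, 2 ≤ x → |R x| ≤ C * x ^ (σ - 1 / 2)) {T : ℝ} (hT : 2 ≤ T) :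
    ∫ t in (1 : ℝ)..T, ‖∫ x in Ioi T, (R x : ℂ) * (x : ℂ) ^ (-(σ + t * I : ℂ) - 1)‖ ^ 2 ≤
      Real.exp 1 * (2 * π) * C ^ 2 / T := by
  have hT0 : 0 < T := by linarith
  set h : ℝ → ℂ := (Ioi (Real.log T)).indicator
    (fun u => ((R (Real.exp u) * Real.exp (-σ * u) : ℝ) : ℂ)) with hh
  have hC0 : 0 ≤ C := by
    have := (abs_nonneg _).trans (hR 2 le_rfl)
    exact nonneg_of_mul_nonneg_left this (by positivity)
  have hexp (u : ℝ) (hu : u ∈ Ioi (Real.log T)) : T < Real.exp u := (Real.log_lt_iff_lt_exp hT0).1 hu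
  have hbound (u : ℝ) : ‖h u‖ ≤ (Ioi (Real.log T)).indicator (fun u => C * Real.exp (-(1 / 2) * u)) u := by
    by_cases hu : u ∈ Ioi (Real.log T)
    · rw [hh, indicator_of_mem hu, indicator_of_mem hu, Complex.norm_real, Real.norm_eq_abs, abs_mul,
        Real.abs_exp]
      calc _ ≤ C * Real.exp u ^ (σ - 1 / 2) * Real.exp (-σ * u) := by
            gcongr
            exact hR _ (hT.trans (hexp u hu).le)
        _ = _ := by
            rw [← Real.exp_mul, mul_assoc, ← Real.exp_add]
            congr 2
            ring
    · rw [hh, indicator_of_notMem hu, indicator_of_notMem hu, norm_zero]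
  have hmeas : Measurable h :=
    (measurable_ofReal.comp ((hRm.comp Real.measurable_exp).mul (by fun_prop))).indicator measurableSet_Ioi
  have h_int : Integrable h :=
    ((integrable_indicator_iff measurableSet_Ioi).2
      ((integrableOn_exp_mul_Ioi (a := -(1 / 2)) (by norm_num) (Real.log T)).const_mul C)).mono' hmeas.aestronglyMeasurable (.of_forall hbound)
  have hbound2 (u : ℝ) : ‖h u‖ ^ 2 ≤ (Ioi (Real.log T)).indicator (fun u => C ^ 2 * Real.exp (-1 * u)) u := by
    have h1 := hbound u
    by_cases hu : u ∈ Ioi (Real.log T)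
    · rw [indicator_of_mem hu] at h1 ⊢
      calc _ ≤ (C * Real.exp (-(1 / 2) * u)) ^ 2 := by gcongr
        _ = _ := by
            rw [mul_pow, ← Real.exp_nat_mul]
            congr 2
            push_cast
            ring
    · rw [indicator_of_notMem hu] at h1 ⊢
      simp [le_antisymm h1 (norm_nonneg _)]
  have hint2' : Integrable ((Ioi (Real.log T)).indicator (fun u => C ^ 2 * Real.exp (-1 * u))) :=
    (integrable_indicator_iff measurableSet_Ioi).2
      ((integrableOn_exp_mul_Ioi (a := -1) (by norm_num) (Real.log T)).const_mul (C ^ 2))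
  have hint2 : Integrable (fun u => ‖h u‖ ^ 2) := by
    refine hint2'.mono' (hmeas.norm.pow_const 2).aestronglyMeasurable (.of_forall fun u => ?_)
    rw [Real.norm_of_nonneg (by positivity)]
    exact hbound2 u
  have hsq : ∫ u, ‖h u‖ ^ 2 ≤ C ^ 2 / T := by
    calc _ ≤ ∫ u, (Ioi (Real.log T)).indicator (fun u => C ^ 2 * Real.exp (-1 * u)) u :=
          integral_mono hint2 hint2' hbound2
      _ = _ := by
          rw [integral_indicator measurableSet_Ioi, integral_const_mul,
            integral_exp_mul_Ioi (by norm_num)]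
          rw [neg_one_mul, Real.exp_neg, Real.exp_log hT0]
          field_simp
  have himage : Real.exp '' Ioi (Real.log T) = Ioi T := by
    ext x
    simp only [mem_image, mem_Ioi]
    constructor
    · rintro ⟨u, hu, rfl⟩
      exact hexp u hu
    · intro hx
      exact ⟨Real.log x, Real.log_lt_log hT0 hx, Real.exp_log (hT0.trans hx)⟩
  have hval (t : ℝ) : ∫ x in Ioi T, (R x : ℂ) * (x : ℂ) ^ (-(σ + t * I : ℂ) - 1) =
      ∫ u, h u * cexp (-(t * u) * I) := by
    rw [← himage, integral_image_eq_integral_abs_deriv_smul measurableSet_Ioi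
      (fun u _ => (Real.hasDerivAt_exp u).hasDerivWithinAt) Real.exp_injective.injOn,
      ← integral_indicator measurableSet_Ioi]
    refine integral_congr_ae (.of_forall fun u => ?_)
    simp only
    by_cases hu : u ∈ Ioi (Real.log T)
    · rw [hh, indicator_of_mem hu, indicator_of_mem hu, Real.abs_exp, real_smul]
      have hec : ((Real.exp u : ℝ) : ℂ) ≠ 0 := by exact_mod_cast (Real.exp_pos u).ne'
      rw [cpow_sub _ _ hec, cpow_one, ofReal_cpow_neg_add_mul_I (Real.exp_pos u), Real.log_exp,
        ← Real.exp_mul, mul_comm u (-σ), ofReal_mul]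
      field_simp
    · rw [hh, indicator_of_notMem hu, indicator_of_notMem hu, zero_mul]
  simp only [hval]
  refine (integral_interval_norm_sq_le_of_real h_int hint2 (by linarith)).trans ?_
  calc _ ≤ Real.exp 1 * (2 * π) * (C ^ 2 / T) := by gcongr
    _ = _ := by ring

lemma intervalIntegral_rpow_neg_two_le_one {T : ℝ} (hT : 1 ≤ T) :
    ∫ t in (1 : ℝ)..T, t ^ (-2 : ℝ) ≤ 1 := by
  rw [integral_rpow (Or.inr ⟨by norm_num, by
    rw [uIcc_of_le hT]; exact fun h => absurd h.1 (by norm_num)⟩)]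
  have : 0 ≤ T ^ (-2 + 1 : ℝ) := by positivity
  rw [Real.one_rpow]
  have h : (-2 + 1 : ℝ) = -1 := by norm_num
  rw [h] at this ⊢
  linarith

lemma norm_add_add_add_sq_le {E : Type*} [SeminormedAddCommGroup E] (x y z w : E) :
    ‖x + y + z + w‖ ^ 2 ≤ 4 * (‖x‖ ^ 2 + ‖y‖ ^ 2 + ‖z‖ ^ 2 + ‖w‖ ^ 2) := by
  have h : ‖x + y + z + w‖ ≤ ‖x‖ + ‖y‖ + ‖z‖ + ‖w‖ :=
    (norm_add_le _ _).trans (add_le_add_left norm_add₃_le _)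
  calc _ ≤ (‖x‖ + ‖y‖ + ‖z‖ + ‖w‖) ^ 2 := by gcongr
    _ ≤ _ := by
      nlinarith [sq_nonneg (‖x‖ - ‖y‖), sq_nonneg (‖x‖ - ‖z‖), sq_nonneg (‖x‖ - ‖w‖),
        sq_nonneg (‖y‖ - ‖z‖), sq_nonneg (‖y‖ - ‖w‖), sq_nonneg (‖z‖ - ‖w‖)]

lemma norm_ordinate_main_term_sq_le (a b : ℝ) {σ T t : ℝ} (hσ : 1 / 2 < σ) (hσ1 : σ ≤ 1)
    (hT : 2 ≤ T) (ht : 1 ≤ t) :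
    ‖(T : ℂ) ^ (1 - (σ + t * I : ℂ)) * ((a * Real.log T + b : ℝ) / ((σ + t * I : ℂ) - 1) +
      a * (σ + t * I : ℂ) / ((σ + t * I : ℂ) - 1) ^ 2)‖ ^ 2 ≤
      (|a| / (σ - 1 / 2) + |b| + 2 * |a|) ^ 2 * T * t ^ (-2 : ℝ) := by
  have hT0 : 0 < T := by linarith
  have ht0 : 0 < t := by linarith
  set ε := σ - 1 / 2 with hε
  have hε0 : 0 < ε := by rw [hε]; linarith
  set s : ℂ := σ + t * I with hs
  have hs1 : t ≤ ‖s - 1‖ := by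
    have := abs_im_le_norm (s - 1)
    simpa [hs, abs_of_pos ht0] using this
  have hs2 : ‖s‖ ≤ 2 * t := by
    calc ‖s‖ ≤ ‖(σ : ℂ)‖ + ‖(t * I : ℂ)‖ := norm_add_le _ _
      _ = σ + t := by
        simp [abs_of_pos ht0, abs_of_pos (show 0 < σ by linarith)]
      _ ≤ _ := by linarith
  have hTε : 1 ≤ T ^ ε := Real.one_le_rpow (by linarith) hε0.le
  have hlog : Real.log T ≤ T ^ ε / ε := Real.log_le_rpow_div hT0.le hε0
  have hlog0 : 0 ≤ Real.log T := Real.log_nonneg (by linarith)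
  have hpow : ‖(T : ℂ) ^ (1 - s)‖ = T ^ (1 - σ) := by
    rw [norm_cpow_eq_rpow_re_of_pos hT0]
    simp [hs]
  have hfirst : ‖((a * Real.log T + b : ℝ) : ℂ) / (s - 1)‖ ≤ (|a| / ε + |b|) * T ^ ε / t := by
    rw [norm_div, Complex.norm_real, Real.norm_eq_abs]
    gcongr
    calc |a * Real.log T + b| ≤ |a| * Real.log T + |b| := by
          refine (abs_add_le _ _).trans ?_
          rw [abs_mul, abs_of_nonneg hlog0]
      _ ≤ |a| * (T ^ ε / ε) + |b| * T ^ ε := by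
          gcongr
          exact le_mul_of_one_le_right (abs_nonneg _) hTε
      _ = _ := by ring
  have hsecond : ‖a * s / (s - 1) ^ 2‖ ≤ 2 * |a| * T ^ ε / t := by
    rw [norm_div, norm_mul, norm_pow, Complex.norm_real, Real.norm_eq_abs]
    calc _ ≤ |a| * (2 * t) / t ^ 2 := by gcongr
      _ = 2 * |a| * 1 / t := by field_simp
      _ ≤ _ := by gcongr
  have hnorm : ‖(T : ℂ) ^ (1 - s) * ((a * Real.log T + b : ℝ) / (s - 1) + a * s / (s - 1) ^ 2)‖ ≤
      (|a| / ε + |b| + 2 * |a|) * T ^ (1 / 2 : ℝ) / t := by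
    rw [norm_mul, hpow]
    calc _ ≤ T ^ (1 - σ) * ((|a| / ε + |b|) * T ^ ε / t + 2 * |a| * T ^ ε / t) := by
          gcongr
          exact (norm_add_le _ _).trans (add_le_add hfirst hsecond)
      _ = (|a| / ε + |b| + 2 * |a|) * (T ^ (1 - σ) * T ^ ε) / t := by ring
      _ = _ := by
          rw [← Real.rpow_add hT0]
          congr 3
          rw [hε]
          ring
  calc _ ≤ ((|a| / ε + |b| + 2 * |a|) * T ^ (1 / 2 : ℝ) / t) ^ 2 := by gcongr
    _ = _ := by
      rw [← Real.sqrt_eq_rpow, div_pow, mul_pow, Real.sq_sqrt hT0.le, Real.rpow_neg ht0.le,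
        Real.rpow_two, div_eq_mul_inv]

theorem statement5
    (G : ℂ → ℂ)
    (hGser : ∀ s : ℂ, 1 < s.re →
      G s = ∑' ρ : {ρ : ℂ // IsNontrivialZero ρ ∧ 0 < ρ.im},
        (zetaMult ρ.1 : ℂ) * (ρ.1.im : ℂ) ^ (-s))
    (hGan : ∀ s : ℂ, -1 < s.re → s ≠ 1 → DifferentiableAt ℂ G s)
    : ∀ σ : ℝ, 1/2 < σ → σ ≤ 1 → ∃ C : ℝ, ∀ T : ℝ, 2 ≤ T →
      (∫ t in (1:ℝ)..T, ‖G (σ + t * I)‖ ^ 2) ≤ C * T := by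
  intro σ hσ hσ1
  obtain ⟨a, b, C₀, hC₀⟩ := exists_abs_zeroOrdinateCount_sub_le
  have hε0 : 0 < σ - 1 / 2 := by linarith
  set C : ℝ := |C₀| / (σ - 1 / 2) with hC
  have hR (x : ℝ) (hx : 2 ≤ x) : |zeroOrdinateError a b x| ≤ C * x ^ (σ - 1 / 2) := by
    calc _ ≤ C₀ * Real.log x := hC₀ x hx
      _ ≤ |C₀| * (x ^ (σ - 1 / 2) / (σ - 1 / 2)) :=
          mul_le_mul (le_abs_self _) (Real.log_le_rpow_div (by linarith) hε0)
            (Real.log_nonneg (by linarith)) (abs_nonneg _)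
      _ = _ := by rw [hC]; ring
  obtain ⟨P, hP⟩ := exists_integral_norm_sq_partial_sum_le hσ hσ1
  set K : ℝ := |a| / (σ - 1 / 2) + |b| + 2 * |a|
  refine ⟨4 * (P + K ^ 2 + C ^ 2 + 4 * (Real.exp 1 * (2 * π) * C ^ 2)), fun T hT => ?_⟩
  have hT0 : 0 < T := by linarith
  have hT1 : 1 ≤ T := by linarith
  have hne (t : ℝ) (ht : 1 ≤ t) : (σ + t * I : ℂ) ≠ 1 := fun h => by
    have := congrArg Complex.im h
    simp at this
    linarith
  have hline : Continuous fun t : ℝ => (σ + t * I : ℂ) := by fun_prop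
  set p : ℝ → ℂ := fun t => ∑ i ∈ (finite_nontrivialZero_im_le T).toFinset,
    (zetaMult i.1 : ℂ) * (i.1.im : ℂ) ^ (-(σ + t * I : ℂ)) with hp
  set H : ℝ → ℂ := fun t => ∫ x in Ioi T, (zeroOrdinateError a b x : ℂ) *
    (x : ℂ) ^ (-(σ + t * I : ℂ) - 1) with hH
  have hGint : IntervalIntegrable (fun t : ℝ => ‖G (σ + t * I)‖ ^ 2) volume 1 T := by
    refine ContinuousOn.intervalIntegrable fun t ht => ?_
    rw [uIcc_of_le hT1] at ht
    refine ((ContinuousAt.comp (f := fun t : ℝ => (σ + t * I : ℂ)) (hGan _ (by simp; linarith)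
      (hne t ht.1)).continuousAt hline.continuousAt).norm.pow 2).continuousWithinAt
  have hpint : IntervalIntegrable (fun t : ℝ => ‖p t‖ ^ 2) volume 1 T := by
    refine (Continuous.pow (Continuous.norm ?_) 2).intervalIntegrable _ _
    refine continuous_finsetSum _ fun i _ => continuous_const.mul ?_
    have hi : (i.1.im : ℂ) ≠ 0 := by exact_mod_cast i.2.2.ne'
    exact hline.neg.const_cpow (Or.inl hi)
  have hHint : IntervalIntegrable (fun t : ℝ => ‖H t‖ ^ 2) volume 1 T := by
    refine (Continuous.pow (Continuous.norm ?_) 2).intervalIntegrable _ _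
    refine continuous_iff_continuousAt.2 fun t => ?_
    refine ContinuousAt.comp (f := fun t : ℝ => (σ + t * I : ℂ))
      (g := fun s : ℂ => ∫ x in Ioi T, (zeroOrdinateError a b x : ℂ) * (x : ℂ) ^ (-s - 1))
      (differentiableAt_integral_Ioi_mul_cpow hT0
        (measurable_ofReal.comp (measurable_zeroOrdinateError a b)) (C := C) (ε := σ - 1 / 2)
        (fun x hx => ?_) (by simp)).continuousAt hline.continuousAt
    rw [Function.comp_apply, Complex.norm_real]
    exact hR x (hT.trans (le_of_lt hx))
  have htint : IntervalIntegrable (fun t : ℝ => K ^ 2 * T * t ^ (-2 : ℝ)) volume 1 T := by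
    refine (intervalIntegral.intervalIntegrable_rpow (Or.inr ?_)).const_mul _
    rw [uIcc_of_le hT1]
    exact fun h => absurd h.1 (by norm_num)
  have hpoint (t : ℝ) (ht : t ∈ Icc 1 T) : ‖G (σ + t * I)‖ ^ 2 ≤
      4 * (‖p t‖ ^ 2 + K ^ 2 * T * t ^ (-2 : ℝ) + C ^ 2 + 4 * T ^ 2 * ‖H t‖ ^ 2) := by
    have hA := norm_ordinate_main_term_sq_le a b hσ hσ1 hT ht.1
    have hB : ‖-(zeroOrdinateError a b T * (T : ℂ) ^ (-(σ + t * I : ℂ)))‖ ^ 2 ≤ C ^ 2 := by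
      rw [norm_neg, norm_mul, Complex.norm_real, norm_cpow_eq_rpow_re_of_pos hT0]
      gcongr
      calc _ ≤ C * T ^ (σ - 1 / 2) * T ^ (-σ) := by
            gcongr
            · exact hR T hT
            · simp
        _ = C * T ^ (-(1 / 2) : ℝ) := by
            rw [mul_assoc, ← Real.rpow_add hT0]
            congr 2
            ring
        _ ≤ C * 1 := by
            gcongr
            exact Real.rpow_le_one_of_one_le_of_nonpos hT1 (by norm_num)
        _ = C := mul_one C
    have hD : ‖(σ + t * I : ℂ) * H t‖ ^ 2 ≤ 4 * T ^ 2 * ‖H t‖ ^ 2 := by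
      rw [norm_mul, mul_pow]
      have : ‖(σ + t * I : ℂ)‖ ≤ 2 * T := by
        calc _ ≤ ‖(σ : ℂ)‖ + ‖(t * I : ℂ)‖ := norm_add_le _ _
          _ = σ + t := by
            simp [abs_of_pos (show 0 < t by linarith [ht.1]), abs_of_pos (show 0 < σ by linarith)]
          _ ≤ _ := by linarith [ht.2]
      calc _ ≤ (2 * T) ^ 2 * ‖H t‖ ^ 2 := by gcongr
        _ = _ := by ring
    rw [eq_ordinateZetaApprox_add hGser hGan hε0 (by linarith) hR hT (s := σ + t * I)
      (by simp) (by simpa using by linarith [ht.1]), ordinateZetaApprox, sub_eq_add_neg]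
    refine (norm_add_add_add_sq_le _ _ _ _).trans ?_
    gcongr
  calc _ ≤ ∫ t in (1 : ℝ)..T,
        4 * (‖p t‖ ^ 2 + K ^ 2 * T * t ^ (-2 : ℝ) + C ^ 2 + 4 * T ^ 2 * ‖H t‖ ^ 2) :=
        intervalIntegral.integral_mono_on hT1 hGint ((((hpint.add htint).add
          intervalIntegrable_const).add (hHint.const_mul _)).const_mul 4) hpoint
    _ = 4 * ((∫ t in (1 : ℝ)..T, ‖p t‖ ^ 2) + K ^ 2 * T * (∫ t in (1 : ℝ)..T, t ^ (-2 : ℝ)) +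
          (T - 1) * C ^ 2 + 4 * T ^ 2 * ∫ t in (1 : ℝ)..T, ‖H t‖ ^ 2) := by
        rw [intervalIntegral.integral_const_mul, intervalIntegral.integral_add
          ((hpint.add htint).add intervalIntegrable_const) (hHint.const_mul _),
          intervalIntegral.integral_add (hpint.add htint) intervalIntegrable_const,
          intervalIntegral.integral_add hpint htint, intervalIntegral.integral_const_mul,
          intervalIntegral.integral_const_mul, intervalIntegral.integral_const, smul_eq_mul]
    _ ≤ 4 * (P * T + K ^ 2 * T * 1 + T * C ^ 2 +
          4 * T ^ 2 * (Real.exp 1 * (2 * π) * C ^ 2 / T)) := by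
        gcongr
        · exact hP T hT
        · exact intervalIntegral_rpow_neg_two_le_one hT1
        · linarith
        · exact integral_norm_sq_tail_le (measurable_zeroOrdinateError a b) hR hT
    _ = _ := by
        field_simp
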